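/- arXiv:1008.4812 — 8 statements merged into one kernel-verified Lean document; each statement's English description precedes it below -/
import Mathlib

section
/- For every integer m ≥ 1 and every integer k ≥ 1, the limit as N → ∞ (with N ranging over positive multiples of m) of N^{−(k+1)} · E[Tr(A(x)^{2k})] exists and equals Σ_{σ ∈ P(2k)} m^{−(k+1−v(σ))}. -/
open MeasureTheory Filter

/-- A pairing: a fixed-point-free involution of `ZMod n`. -/
abbrev Pairing (n : ℕ) : Type :=
  {σ : Equiv.Perm (ZMod n) // (∀ j, σ (σ j) = j) ∧ ∀ j, σ j ≠ j}

noncomputable instance (n : ℕ) [NeZero n] : Fintype (Pairing n) :=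
  Fintype.ofFinite _

/-- `v(σ)`: the number of equivalence classes of `ZMod n` under the smallest equivalence
relation relating `j` and `σ j + 1`. -/
noncomputable def vfun (n : ℕ) (σ : Equiv.Perm (ZMod n)) : ℕ :=
  Nat.card (Quot (fun a b : ZMod n => b = σ a + 1))

/-- The index set `S(m,N)`: the quotient of `ZMod N × ZMod m` identifying each point
`(d, r)` with its image `(-d, r + ι d)` under the involution `τ`. -/
def BCidx (m N : ℕ) (hm : m ∣ N) : Type :=
  Quot (fun a b : ZMod N × ZMod m => b = (-a.1, a.2 + ZMod.castHom hm (ZMod m) a.1))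

/-- The symmetric `m`-block circulant matrix attached to `x : S(m,N) → ℝ`. -/
def BCmat (m N : ℕ) (hm : m ∣ N) (x : BCidx m N hm → ℝ) : Matrix (Fin N) (Fin N) ℝ :=
  fun i j => x (Quot.mk _ (((j : ℕ) : ZMod N) - ((i : ℕ) : ZMod N),
    ZMod.castHom hm (ZMod m) ((i : ℕ) : ZMod N)))

/-- `E[Tr (A(x)^e)]` for the i.i.d. product measure with marginal `μ`. -/
noncomputable def expTrace (μ : Measure ℝ) (m N e : ℕ) (hm : m ∣ N) (hN : N ≠ 0) : ℝ :=
  haveI : NeZero N := ⟨hN⟩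
  haveI : NeZero m := ⟨by rintro rfl; exact hN (zero_dvd_iff.mp hm)⟩
  haveI : Finite (BCidx m N hm) := Finite.of_surjective _ (fun q => Quot.exists_rep q)
  haveI : Fintype (BCidx m N hm) := Fintype.ofFinite _
  ∫ x : BCidx m N hm → ℝ, Matrix.trace ((BCmat m N hm x) ^ e) ∂(Measure.pi fun _ => μ)


section Walks

lemma pow_walk {ι : Type*} [Fintype ι] [DecidableEq ι] (A : Matrix ι ι ℝ) (n : ℕ) :
    ∀ a b : ι, (A ^ (n + 1)) a b =
      ∑ w : Fin n → ι, ∏ s : Fin (n + 1),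
        A ((Fin.cons a w : Fin (n + 1) → ι) s) ((Fin.snoc w b : Fin (n + 1) → ι) s) := by
  induction n with
  | zero =>
    intro a b
    simp [Fin.snoc]
  | succ n ih =>
    intro a b
    rw [pow_succ' A (n + 1), Matrix.mul_apply]
    rw [← (Fin.consEquiv (fun _ : Fin (n + 1) => ι)).sum_comp, Fintype.sum_prod_type]
    refine Finset.sum_congr rfl fun c _ => ?_
    rw [ih, Finset.mul_sum]
    refine Finset.sum_congr rfl fun w _ => ?_
    rw [Fin.prod_univ_succ (n := n + 1)]
    have h : (Fin.snoc (Fin.cons c w : Fin (n + 1) → ι) b : Fin (n + 2) → ι)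
        = Fin.cons c (Fin.snoc w b : Fin (n + 1) → ι) := by
      exact (Fin.cons_snoc_eq_snoc_cons (β := ι) c w b).symm
    simp only [Fin.consEquiv, Equiv.coe_fn_mk, h, Fin.cons_zero, Fin.cons_succ]

lemma trace_pow_walk {ι : Type*} [Fintype ι] [DecidableEq ι] (A : Matrix ι ι ℝ) (n : ℕ) :
    Matrix.trace (A ^ (n + 1)) =
      ∑ w : ZMod (n + 1) → ι, ∏ s : ZMod (n + 1), A (w s) (w (s + 1)) := by
  change _ = ∑ w : Fin (n + 1) → ι, ∏ s : Fin (n + 1), A (w s) (w (s + 1))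
  rw [Matrix.trace, ← (Fin.consEquiv (fun _ : Fin (n + 1) => ι)).sum_comp,
    Fintype.sum_prod_type]
  refine Finset.sum_congr rfl fun a _ => ?_
  rw [Matrix.diag_apply, pow_walk]
  refine Finset.sum_congr rfl fun w _ => Finset.prod_congr rfl fun s _ => ?_
  simp only [Fin.consEquiv, Equiv.coe_fn_mk]
  congr 1
  induction s using Fin.lastCases with
  | last => simp
  | cast s => simp

lemma trace_pow_walk' {ι : Type*} [Fintype ι] [DecidableEq ι] (A : Matrix ι ι ℝ) (n : ℕ)
    [NeZero n] :
    Matrix.trace (A ^ n) = ∑ w : ZMod n → ι, ∏ s : ZMod n, A (w s) (w (s + 1)) := by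
  obtain ⟨n', rfl⟩ := Nat.exists_eq_succ_of_ne_zero (NeZero.ne n)
  have := trace_pow_walk A n'
  convert this

/-- difference function of a closed walk -/
def dif {n N : ℕ} (i : ZMod n → ZMod N) (s : ZMod n) : ZMod N := i (s + 1) - i s

lemma walk_ext {n N : ℕ} [NeZero n] {i i' : ZMod n → ZMod N} (h0 : i 0 = i' 0)
    (hd : ∀ s, dif i s = dif i' s) : i = i' := by
  have h : ∀ t : ℕ, i (t : ZMod n) = i' (t : ZMod n) := by
    intro t
    induction t with
    | zero => simpa using h0
    | succ t ih =>
      have := hd (t : ZMod n)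
      unfold dif at this
      rw [ih] at this
      push_cast
      exact sub_left_injective this
  funext s
  have := h s.val
  simpa using this

lemma sum_dif {n N : ℕ} [NeZero n] (i : ZMod n → ZMod N) : ∑ s, dif i s = 0 := by
  simp only [dif]
  rw [Finset.sum_sub_distrib, sub_eq_zero]
  exact Equiv.sum_comp (Equiv.addRight (1 : ZMod n)) i

lemma sum_range_zmod {n : ℕ} [NeZero n] {M : Type*} [AddCommMonoid M] (d : ZMod n → M) :
    ∑ t ∈ Finset.range n, d (t : ZMod n) = ∑ s, d s := by
  symm
  refine Finset.sum_bij' (fun s _ => s.val) (fun t _ => (t : ZMod n)) ?_ ?_ ?_ ?_ ?_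
  · intro s _; simpa using ZMod.val_lt s
  · intro _ _; simp
  · intro s _; simp
  · intro t ht; exact ZMod.val_cast_of_lt (by simpa using ht)
  · intro s _; simp

lemma exists_walk {n N : ℕ} [NeZero n] (a : ZMod N) (d : ZMod n → ZMod N)
    (hd : ∑ s, d s = 0) : ∃ i : ZMod n → ZMod N, i 0 = a ∧ ∀ s, dif i s = d s := by
  refine ⟨fun s => a + ∑ t ∈ Finset.range s.val, d (t : ZMod n), by simp, fun s => ?_⟩
  simp only [dif]
  have hs := ZMod.val_lt s
  by_cases h : s.val + 1 < n
  · have h1 : (s + 1).val = s.val + 1 := by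
      rw [ZMod.val_add, ZMod.val_one_eq_one_mod, Nat.add_mod_mod, Nat.mod_eq_of_lt h]
    rw [h1, Finset.sum_range_succ]
    simp
  · have h2 : s.val + 1 = n := by omega
    have h1 : (s + 1).val = 0 := by
      rw [ZMod.val_add, ZMod.val_one_eq_one_mod, Nat.add_mod_mod, h2, Nat.mod_self]
    have h3 := sum_range_zmod d
    rw [hd] at h3
    have h4 : ∑ t ∈ Finset.range (s.val + 1), d (t : ZMod n) = 0 := by
      rw [← h3]; congr 1; rw [h2]
    rw [Finset.sum_range_succ] at h4
    rw [h1]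
    simp at h4 ⊢
    exact neg_eq_of_add_eq_zero_right h4

end Walks

section Moments

variable {α : Type*} [Fintype α] [DecidableEq α]

lemma prod_fiber {T : Type*} [Fintype T] (f : T → α) (x : α → ℝ) :
    ∏ s, x (f s) = ∏ c, x c ^ (Finset.univ.filter fun s => f s = c).card := by
  rw [← Finset.prod_fiberwise (s := Finset.univ) (g := f)]
  refine Finset.prod_congr rfl fun c _ => ?_
  rw [Finset.prod_congr rfl (g := fun _ => x c), Finset.prod_const]
  intro s hs
  rw [(Finset.mem_filter.mp hs).2]

lemma integrable_prod_walk {T : Type*} [Fintype T] (μ : Measure ℝ) [IsProbabilityMeasure μ]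
    (hmom : ∀ n : ℕ, Integrable (fun x : ℝ => x ^ n) μ) (f : T → α) :
    Integrable (fun x : α → ℝ => ∏ s, x (f s)) (Measure.pi fun _ => μ) := by
  simp_rw [prod_fiber f]
  exact Integrable.fintype_prod (f := fun c (y : ℝ) =>
    y ^ (Finset.univ.filter fun s => f s = c).card) (fun c => hmom _)

lemma integral_prod_walk {T : Type*} [Fintype T] (μ : Measure ℝ) [IsProbabilityMeasure μ]
    (f : T → α) :
    ∫ x : α → ℝ, ∏ s, x (f s) ∂(Measure.pi fun _ => μ) =
      ∏ c, ∫ y, y ^ (Finset.univ.filter fun s => f s = c).card ∂μ := by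
  simp_rw [prod_fiber f]
  exact integral_fintype_prod_eq_prod (fun c (y : ℝ) =>
    y ^ (Finset.univ.filter fun s => f s = c).card)

/-- number of pairings compatible with f -/
noncomputable def numPair (n : ℕ) [NeZero n] (f : ZMod n → α) : ℕ :=
  (Finset.univ.filter fun σ : Pairing n => ∀ s, f (σ.1 s) = f s).card

lemma numPair_eq_zero {n : ℕ} [NeZero n] (f : ZMod n → α) (s : ZMod n)
    (hs : (Finset.univ.filter fun t => f t = f s).card = 1) : numPair n f = 0 := by
  unfold numPair
  rw [Finset.card_eq_zero, Finset.filter_eq_empty_iff]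
  intro σ _ h
  obtain ⟨a, ha⟩ := Finset.card_eq_one.mp hs
  have h1 : s ∈ ({a} : Finset (ZMod n)) := by rw [← ha]; simp
  have h2 : σ.1 s ∈ ({a} : Finset (ZMod n)) := by rw [← ha]; simp [h s]
  rw [Finset.mem_singleton] at h1 h2
  exact σ.2.2 s (h2.trans h1.symm)

lemma numPair_eq_one {n : ℕ} [NeZero n] (f : ZMod n → α)
    (hs : ∀ s, (Finset.univ.filter fun t => f t = f s).card = 2) : numPair n f = 1 := by
  have key : ∀ s, ∃ t, t ≠ s ∧ f t = f s ∧ ∀ u, f u = f s → u = s ∨ u = t := by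
    intro s
    obtain ⟨a, b, hab, h⟩ := Finset.card_eq_two.mp (hs s)
    have hm : ∀ u, f u = f s ↔ u = a ∨ u = b := by
      intro u
      have : u ∈ (Finset.univ.filter fun t => f t = f s) ↔ u ∈ ({a, b} : Finset (ZMod n)) := by
        rw [h]
      simpa using this
    rcases (hm s).mp rfl with h1 | h1
    · exact ⟨b, by rw [h1]; exact hab.symm, (hm b).mpr (Or.inr rfl), fun u hu => by
        rw [h1]; exact (hm u).mp hu⟩
    · exact ⟨a, by rw [h1]; exact hab, (hm a).mpr (Or.inl rfl), fun u hu => by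
        rw [h1]; exact ((hm u).mp hu).symm⟩
  choose g hg1 hg2 hg3 using key
  have hgg : ∀ s, g (g s) = s := by
    intro s
    rcases hg3 s (g (g s)) ((hg2 _).trans (hg2 s)) with h | h
    · exact h
    · exact absurd h (hg1 (g s))
  unfold numPair
  rw [Finset.card_eq_one]
  refine ⟨⟨⟨g, g, hgg, hgg⟩, hgg, hg1⟩, ?_⟩
  ext σ
  simp only [Finset.mem_filter, Finset.mem_univ, true_and, Finset.mem_singleton]
  constructor
  · intro h
    apply Subtype.ext
    ext1 s
    rcases hg3 s (σ.1 s) (h s) with h | h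
    · exact absurd h (σ.2.2 s)
    · exact h
  · rintro rfl s
    exact hg2 s

lemma abs_weight_le {n : ℕ} [NeZero n] (M : ℕ → ℝ) (h0 : M 0 = 1) (f : ZMod n → α) :
    |∏ c, M (Finset.univ.filter fun s => f s = c).card| ≤
      (1 + ∑ j ∈ Finset.range (n + 1), |M j|) ^ n := by
  have hC : 1 ≤ 1 + ∑ j ∈ Finset.range (n + 1), |M j| := by
    have : 0 ≤ ∑ j ∈ Finset.range (n + 1), |M j| := Finset.sum_nonneg fun _ _ => abs_nonneg _
    linarith
  rw [Finset.abs_prod]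
  rw [← Finset.prod_subset (Finset.subset_univ (Finset.univ.image f))]
  · calc _ ≤ ∏ c ∈ Finset.univ.image f, (1 + ∑ j ∈ Finset.range (n + 1), |M j|) := by
          refine Finset.prod_le_prod (fun _ _ => abs_nonneg _) fun c _ => ?_
          have h1 : (Finset.univ.filter fun s => f s = c).card ≤ n := by
            refine (Finset.card_le_univ _).trans ?_
            rw [ZMod.card]
          have := Finset.single_le_sum (f := fun j => |M j|) (s := Finset.range (n + 1))
            (fun _ _ => abs_nonneg _)
            (Finset.mem_range.mpr (Nat.lt_succ_of_le h1))
          linarith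
      _ ≤ _ := by
          rw [Finset.prod_const]
          refine pow_le_pow_right₀ hC ?_
          refine Finset.card_image_le.trans ?_
          simp [ZMod.card]
  · intro c _ hc
    have : (Finset.univ.filter fun s => f s = c) = ∅ := by
      rw [Finset.filter_eq_empty_iff]
      intro s _ h
      exact hc (Finset.mem_image.mpr ⟨s, Finset.mem_univ _, h⟩)
    rw [this, Finset.card_empty, h0, abs_one]

lemma weight_sub_numPair {n k : ℕ} [NeZero n] (hn : n = 2 * k) (M : ℕ → ℝ) (h0 : M 0 = 1)
    (h1 : M 1 = 0) (h2 : M 2 = 1) (f : ZMod n → α) :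
    |∏ c, M (Finset.univ.filter fun s => f s = c).card - (numPair n f : ℝ)| ≤
      if (Finset.univ.image f).card < k then
        (1 + ∑ j ∈ Finset.range (n + 1), |M j|) ^ n + (Fintype.card (Pairing n) : ℝ) else 0 := by
  split_ifs with hk
  · refine (abs_sub _ _).trans (add_le_add (abs_weight_le M h0 f) ?_)
    rw [abs_of_nonneg (Nat.cast_nonneg _)]
    exact_mod_cast Finset.card_le_univ _
  · push Not at hk
    by_cases hs : ∃ s, (Finset.univ.filter fun t => f t = f s).card = 1
    · obtain ⟨s, hs⟩ := hs
      rw [numPair_eq_zero f s hs, Finset.prod_eq_zero (Finset.mem_univ (f s)) (by rw [hs, h1])]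
      simp
    · push Not at hs
      have hpos : ∀ s, 2 ≤ (Finset.univ.filter fun t => f t = f s).card := by
        intro s
        have : 0 < (Finset.univ.filter fun t => f t = f s).card :=
          Finset.card_pos.mpr ⟨s, by simp⟩
        have := hs s
        omega
      have hsum : ∑ c ∈ Finset.univ.image f, (Finset.univ.filter fun t => f t = c).card = n := by
        rw [← Finset.card_eq_sum_card_image, Finset.card_univ, ZMod.card]
      have hge : ∀ c ∈ Finset.univ.image f, 2 ≤ (Finset.univ.filter fun t => f t = c).card := by
        intro c hc
        obtain ⟨s, _, rfl⟩ := Finset.mem_image.mp hc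
        exact hpos s
      have hle : ∑ c ∈ Finset.univ.image f, 2 = ∑ c ∈ Finset.univ.image f,
          (Finset.univ.filter fun t => f t = c).card := by
        apply le_antisymm (Finset.sum_le_sum hge)
        rw [hsum, Finset.sum_const, smul_eq_mul]
        omega
      have heq := (Finset.sum_eq_sum_iff_of_le hge).mp hle
      have h2' : ∀ s, (Finset.univ.filter fun t => f t = f s).card = 2 := fun s =>
        (heq (f s) (Finset.mem_image_of_mem _ (Finset.mem_univ _))).symm
      rw [numPair_eq_one f h2', Finset.prod_eq_one]
      · simp
      · intro c _
        by_cases hc : c ∈ Finset.univ.image f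
        · rw [← heq c hc, h2]
        · have : (Finset.univ.filter fun s => f s = c) = ∅ := by
            rw [Finset.filter_eq_empty_iff]
            intro s _ h
            exact hc (Finset.mem_image.mpr ⟨s, Finset.mem_univ _, h⟩)
          rw [this, Finset.card_empty, h0]

end Moments

section Counting

variable {n N : ℕ} [NeZero n] [NeZero N]

/-- walks whose differences are prescribed up to sign by those on the range of `p` -/
noncomputable def signSet (n N : ℕ) [NeZero n] [NeZero N] (p : ZMod n → ZMod n)
    (ε : ZMod n → Bool) : Finset (ZMod n → ZMod N) :=
  Finset.univ.filter fun i => ∀ s, dif i s = if ε s then dif i (p s) else - dif i (p s)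

lemma signSet_card (p : ZMod n → ZMod n) (ε : ZMod n → Bool) (k : ℕ)
    (hp : (Finset.univ.image p).card < k) : (signSet n N p ε).card ≤ N ^ k := by
  have hinj : Set.InjOn (fun i : ZMod n → ZMod N =>
      ((i 0, fun r => dif i r.1) : ZMod N × (↥(Finset.univ.image p) → ZMod N)))
      (signSet n N p ε) := by
    intro i hi i' hi' h
    simp only [signSet, Finset.coe_filter, Finset.mem_univ, true_and, Set.mem_ofPred_eq] at hi hi'
    simp only [Prod.mk.injEq] at h
    refine walk_ext h.1 fun s => ?_
    have h2 := congrFun h.2 ⟨p s, Finset.mem_image_of_mem _ (Finset.mem_univ _)⟩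
    simp only at h2
    rw [hi s, hi' s, h2]
  have := Finset.card_le_card_of_injOn (t := Finset.univ) _ (fun _ _ => Finset.mem_coe.mpr (Finset.mem_univ _)) hinj
  refine this.trans ?_
  rw [Finset.card_univ, Fintype.card_prod, Fintype.card_fun, ZMod.card, Fintype.card_coe,
    ← pow_succ']
  exact Nat.pow_le_pow_right (NeZero.pos N) hp

lemma bad1_card {α : Type*} [DecidableEq α] (e : (ZMod n → ZMod N) → ZMod n → α)
    (he : ∀ i s t, e i s = e i t → dif i s = dif i t ∨ dif i s = - dif i t) (k : ℕ) :
    (Finset.univ.filter fun i => (Finset.univ.image (e i)).card < k).card ≤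
      Fintype.card ((ZMod n → ZMod n) × (ZMod n → Bool)) * N ^ k := by
  classical
  set P : Finset ((ZMod n → ZMod n) × (ZMod n → Bool)) :=
    Finset.univ.filter fun q => (Finset.univ.image q.1).card < k with hP
  have hsub : (Finset.univ.filter fun i => (Finset.univ.image (e i)).card < k) ⊆
      P.biUnion fun q => signSet n N q.1 q.2 := by
    intro i hi
    simp only [Finset.mem_filter, Finset.mem_univ, true_and] at hi
    let p : ZMod n → ZMod n := fun s => Function.invFun (e i) (e i s)
    have hp : ∀ s, e i (p s) = e i s := fun s => Function.invFun_eq ⟨s, rfl⟩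
    let ε : ZMod n → Bool := fun s => decide (dif i s = dif i (p s))
    rw [Finset.mem_biUnion]
    refine ⟨(p, ε), ?_, ?_⟩
    · simp only [hP, Finset.mem_filter, Finset.mem_univ, true_and]
      refine lt_of_le_of_lt ?_ hi
      have : Finset.univ.image p = (Finset.univ.image (e i)).image (Function.invFun (e i)) := by
        rw [Finset.image_image]; rfl
      rw [this]
      exact Finset.card_image_le
    · simp only [signSet, Finset.mem_filter, Finset.mem_univ, true_and]
      intro s
      rcases he i s (p s) (hp s).symm with h | h
      · simp [ε, h]
      · by_cases h' : dif i s = dif i (p s)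
        · simp [ε, h']
        · simp only [ε, h', decide_false]
          simpa using h
  refine (Finset.card_le_card hsub).trans ?_
  refine (Finset.card_biUnion_le_card_mul _ _ (N ^ k) ?_).trans ?_
  · intro q hq
    exact signSet_card _ _ _ (by simpa [hP] using hq)
  · exact Nat.mul_le_mul_right _ (Finset.card_le_univ _)

/-- representatives of the pairs -/
def reps {n : ℕ} [NeZero n] (σ : Equiv.Perm (ZMod n)) : Finset (ZMod n) :=
  Finset.univ.filter fun s => s.val < (σ s).val

lemma reps_iff (σ : Pairing n) (s : ZMod n) : σ.1 s ∈ reps σ.1 ↔ s ∉ reps σ.1 := by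
  simp only [reps, Finset.mem_filter, Finset.mem_univ, true_and, σ.2.1]
  have : (σ.1 s).val ≠ s.val := fun h => σ.2.2 s (ZMod.val_injective n h)
  omega

lemma sum_reps {M : Type*} [AddCommMonoid M] (σ : Pairing n) (g : ZMod n → M) :
    ∑ s, g s = ∑ s ∈ reps σ.1, (g s + g (σ.1 s)) := by
  rw [Finset.sum_add_distrib, ← Finset.sum_add_sum_compl (reps σ.1)]
  congr 1
  refine Finset.sum_bij' (fun s _ => σ.1 s) (fun s _ => σ.1 s) ?_ ?_ ?_ ?_ ?_
  · intro s hs; exact (reps_iff σ s).mpr (Finset.mem_compl.mp hs)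
  · intro s hs
    rw [Finset.mem_compl, reps_iff σ s]
    exact fun h => h hs
  · intro s _; exact σ.2.1 s
  · intro s _; exact σ.2.1 s
  · intro s _; rw [σ.2.1]

lemma reps_card {k : ℕ} (hn : n = 2 * k) (σ : Pairing n) : (reps σ.1).card = k := by
  have := sum_reps σ (fun _ => 1)
  simp [ZMod.card] at this
  omega

lemma two_mul_inj {x y : ZMod N} (h : x + x = y + y)
    (hb : decide (2 * x.val < N) = decide (2 * y.val < N)) : x = y := by
  apply ZMod.val_injective
  have hx := ZMod.val_lt x
  have hy := ZMod.val_lt y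
  have h1 : ((2 * x.val : ℕ) : ZMod N) = ((2 * y.val : ℕ) : ZMod N) := by
    push_cast
    rw [ZMod.natCast_zmod_val, ZMod.natCast_zmod_val, two_mul, two_mul, h]
  rw [ZMod.natCast_eq_natCast_iff] at h1
  rw [decide_eq_decide] at hb
  by_cases hxx : 2 * x.val < N
  · have hyy := hb.mp hxx
    have := Nat.ModEq.eq_of_lt_of_lt h1 hxx hyy
    omega
  · have hyy : ¬ 2 * y.val < N := fun h => hxx (hb.mpr h)
    have h2 : (2 * x.val - N) + N ≡ (2 * y.val - N) + N [MOD N] := by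
      rw [Nat.sub_add_cancel (by omega), Nat.sub_add_cancel (by omega)]
      exact h1
    have h3 := Nat.ModEq.add_right_cancel' N h2
    have := Nat.ModEq.eq_of_lt_of_lt h3 (by omega) (by omega)
    omega

/-- walks with a parallel pair -/
noncomputable def parSet (n N : ℕ) [NeZero n] [NeZero N] (σ : Pairing n)
    (ε : ZMod n → Bool) (s₀ : ZMod n) : Finset (ZMod n → ZMod N) :=
  Finset.univ.filter fun i => (∀ s, dif i (σ.1 s) = if ε s then dif i s else - dif i s) ∧
    dif i (σ.1 s₀) = dif i s₀

lemma parSet_card {k : ℕ} (hn : n = 2 * k) (σ : Pairing n) (ε : ZMod n → Bool) (s₀ : ZMod n)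
    (hs : s₀ ∈ reps σ.1) : (parSet n N σ ε s₀).card ≤ 2 * N ^ k := by
  have hinj : Set.InjOn (fun i : ZMod n → ZMod N =>
      ((i 0, (fun r => dif i r.1), decide (2 * (dif i s₀).val < N)) :
        ZMod N × (↥((reps σ.1).erase s₀) → ZMod N) × Bool))
      (parSet n N σ ε s₀) := by
    intro i hi i' hi' h
    simp only [parSet, Finset.coe_filter, Finset.mem_univ, true_and, Set.mem_ofPred_eq] at hi hi'
    simp only [Prod.mk.injEq] at h
    obtain ⟨h0, h1, h2⟩ := h
    have hr : ∀ s ∈ reps σ.1, s ≠ s₀ → dif i s = dif i' s := by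
      intro s hs hne
      have := congrFun h1 ⟨s, Finset.mem_erase.mpr ⟨hne, hs⟩⟩
      simpa using this
    have hsum : ∀ j : ZMod n → ZMod N, dif j (σ.1 s₀) = dif j s₀ → 
        (dif j s₀ + dif j s₀) + ∑ s ∈ (reps σ.1).erase s₀, (dif j s + dif j (σ.1 s)) = 0 := by
      intro j hj
      have := sum_dif j
      rw [sum_reps σ, ← Finset.add_sum_erase _ _ hs, hj] at this
      exact this
    have e1 := hsum i hi.2
    have e2 := hsum i' hi'.2
    have e3 : ∑ s ∈ (reps σ.1).erase s₀, (dif i s + dif i (σ.1 s)) =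
        ∑ s ∈ (reps σ.1).erase s₀, (dif i' s + dif i' (σ.1 s)) := by
      refine Finset.sum_congr rfl fun s hs => ?_
      have := hr s (Finset.mem_erase.mp hs).2 (Finset.mem_erase.mp hs).1
      rw [hi.1 s, hi'.1 s, this]
    rw [e3, ← e2] at e1
    have e4 := two_mul_inj (add_right_cancel e1) h2
    have hr' : ∀ s ∈ reps σ.1, dif i s = dif i' s := by
      intro s hs
      by_cases h : s = s₀
      · rw [h, e4]
      · exact hr s hs h
    refine walk_ext h0 fun s => ?_
    by_cases h : s ∈ reps σ.1
    · exact hr' s h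
    · have h5 := hr' (σ.1 s) ((reps_iff σ s).mpr h)
      have h6 := hi.1 (σ.1 s)
      have h7 := hi'.1 (σ.1 s)
      rw [σ.2.1] at h6 h7
      rw [h6, h7, h5]
  have := Finset.card_le_card_of_injOn (t := Finset.univ) _ (fun _ _ => Finset.mem_coe.mpr (Finset.mem_univ _)) hinj
  refine this.trans ?_
  have hk := reps_card hn σ
  have hkpos : 0 < (reps σ.1).card := Finset.card_pos.mpr ⟨_, hs⟩
  rw [Finset.card_univ, Fintype.card_prod, Fintype.card_prod, Fintype.card_fun, ZMod.card,
    Fintype.card_coe, Fintype.card_bool, ← mul_assoc, ← pow_succ', Finset.card_erase_of_mem hs,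
    hk, Nat.sub_add_cancel (by omega), mul_comm]

/-- antisymmetric walks -/
def antiGrp (n N : ℕ) (σ : Equiv.Perm (ZMod n)) : AddSubgroup (ZMod n → ZMod N) where
  carrier := {i | ∀ s, dif i (σ s) = - dif i s}
  zero_mem' := by intro s; simp [dif]
  add_mem' := by
    intro a b ha hb s
    have h1 := ha s
    have h2 := hb s
    simp only [dif, Pi.add_apply] at h1 h2 ⊢
    linear_combination h1 + h2
  neg_mem' := by
    intro a ha s
    have h1 := ha s
    simp only [dif, Pi.neg_apply] at h1 ⊢
    linear_combination - h1

/-- coordinates on antisymmetric walks -/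
def antiEv (n N : ℕ) [NeZero n] (σ : Pairing n) (i : antiGrp n N σ.1) :
    ZMod N × (↥(reps σ.1) → ZMod N) :=
  (i.1 0, fun r => dif i.1 r.1)

lemma antiEv_bij (σ : Pairing n) : Function.Bijective (antiEv n N σ) := by
  constructor
  · intro i i' h
    simp only [antiEv, Prod.mk.injEq] at h
    apply Subtype.ext
    have hr : ∀ s ∈ reps σ.1, dif i.1 s = dif i'.1 s := fun s hs => congrFun h.2 ⟨s, hs⟩
    refine walk_ext h.1 fun s => ?_
    by_cases hs : s ∈ reps σ.1
    · exact hr s hs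
    · have h5 := hr (σ.1 s) ((reps_iff σ s).mpr hs)
      have h6 := i.2 s
      have h7 := i'.2 s
      rw [h6, h7] at h5
      exact neg_injective h5
  · rintro ⟨a, δ⟩
    let d : ZMod n → ZMod N := fun s =>
      if h : s ∈ reps σ.1 then δ ⟨s, h⟩ else - δ ⟨σ.1 s, (reps_iff σ s).mpr h⟩
    have hd : ∀ s, d (σ.1 s) = - d s := by
      intro s
      by_cases h : s ∈ reps σ.1
      · have h' : σ.1 s ∉ reps σ.1 := by rw [reps_iff]; exact fun h' => h' h
        simp only [d, h, h', dite_true, dite_false]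
        congr 2
        exact Subtype.ext (σ.2.1 s)
      · have h' := (reps_iff σ s).mpr h
        simp only [d, h, h', dite_true, dite_false, neg_neg]
    have hsum : ∑ s, d s = 0 := by
      rw [sum_reps σ]
      refine Finset.sum_eq_zero fun s _ => ?_
      rw [hd, add_neg_cancel]
    obtain ⟨i, hi0, hi⟩ := exists_walk a d hsum
    refine ⟨⟨i, fun s => by rw [hi, hi, hd]⟩, ?_⟩
    simp only [antiEv, Prod.mk.injEq]
    refine ⟨hi0, ?_⟩
    funext r
    rw [hi]
    simp [d, r.2]

lemma antiGrp_card {k : ℕ} (hn : n = 2 * k) (σ : Pairing n) :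
    Nat.card (antiGrp n N σ.1) = N ^ (k + 1) := by
  rw [Nat.card_congr (Equiv.ofBijective _ (antiEv_bij (N := N) σ)), Nat.card_eq_fintype_card,
    Fintype.card_prod, Fintype.card_fun, ZMod.card, Fintype.card_coe, reps_card hn, pow_succ']

/-- reduction mod m -/
def antiRed (n : ℕ) {m N : ℕ} (hm : m ∣ N) (σ : Equiv.Perm (ZMod n)) :
    antiGrp n N σ →+ antiGrp n m σ where
  toFun i := ⟨fun s => ZMod.castHom hm (ZMod m) (i.1 s), by
    intro s
    have := congrArg (ZMod.castHom hm (ZMod m)) (i.2 s)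
    simp only [dif, map_sub, map_neg] at this ⊢
    exact this⟩
  map_zero' := by apply Subtype.ext; funext s; simp
  map_add' := by
    intro a b
    apply Subtype.ext
    funext s
    exact map_add (ZMod.castHom hm (ZMod m)) (a.1 s) (b.1 s)

lemma antiRed_surj {m : ℕ} [NeZero m] (hm : m ∣ N) (σ : Pairing n) :
    Function.Surjective (antiRed n hm σ.1) := by
  intro r
  have hsurj := ZMod.castHom_surjective hm
  obtain ⟨a, ha⟩ := hsurj (r.1 0)
  choose δ hδ using fun q : ↥(reps σ.1) => hsurj (dif r.1 q.1)
  obtain ⟨i, hi⟩ := (antiEv_bij (N := N) σ).2 (a, δ)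
  refine ⟨i, (antiEv_bij (N := m) σ).1 ?_⟩
  simp only [antiEv, Prod.mk.injEq] at hi ⊢
  refine ⟨?_, ?_⟩
  · simp only [antiRed, AddMonoidHom.coe_mk, ZeroHom.coe_mk]
    rw [hi.1, ha]
  · funext q
    rw [← hδ q, ← congrFun hi.2 q]
    exact (map_sub (ZMod.castHom hm (ZMod m)) (i.1 (q.1 + 1)) (i.1 q.1)).symm

/-- walks constant on the classes -/
def constGrp (n m : ℕ) (σ : Equiv.Perm (ZMod n)) : AddSubgroup (antiGrp n m σ) where
  carrier := {r | ∀ s, r.1 (σ s + 1) = r.1 s}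
  zero_mem' := by intro s; simp
  add_mem' := by
    intro a b ha hb s
    simp [ha s, hb s]
  neg_mem' := by
    intro a ha s
    simp [ha s]

lemma constGrp_card {m : ℕ} [NeZero m] (σ : Pairing n) :
    Nat.card (constGrp n m σ.1) = m ^ vfun n σ.1 := by
  let F : constGrp n m σ.1 ≃ (Quot (fun a b : ZMod n => b = σ.1 a + 1) → ZMod m) :=
    { toFun := fun r => Quot.lift r.1.1 (by
        rintro a b rfl
        exact (r.2 a).symm)
      invFun := fun g => ⟨⟨fun s => g (Quot.mk _ s), by
        intro s
        have h1 : ∀ s, (Quot.mk (fun a b : ZMod n => b = σ.1 a + 1) (σ.1 s + 1)) = Quot.mk _ s :=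
          fun s => (Quot.sound (r := fun a b : ZMod n => b = σ.1 a + 1) rfl).symm
        have h2 := h1 (σ.1 s)
        rw [σ.2.1] at h2
        simp only [dif]
        rw [h1, h2]
        ring⟩, by
        intro s
        exact congrArg g (Quot.sound (r := fun a b : ZMod n => b = σ.1 a + 1) rfl).symm⟩
      left_inv := fun r => rfl
      right_inv := fun g => by
        funext q
        induction q using Quot.ind
        rfl }
  rw [Nat.card_congr F, Nat.card_fun, Nat.card_zmod, vfun]

/-- the main set of walks attached to σ -/
noncomputable def mainSet (n : ℕ) {m N : ℕ} [NeZero n] [NeZero N] (hm : m ∣ N)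
    (σ : Equiv.Perm (ZMod n)) : Finset (ZMod n → ZMod N) :=
  Finset.univ.filter fun i => (∀ s, dif i (σ s) = - dif i s) ∧
    ∀ s, ZMod.castHom hm (ZMod m) (i (σ s + 1)) = ZMod.castHom hm (ZMod m) (i s)

lemma mainSet_card {m k : ℕ} [NeZero m] (hm : m ∣ N) (hn : n = 2 * k) (σ : Pairing n) :
    (mainSet n hm σ.1).card * m ^ (k + 1) = N ^ (k + 1) * m ^ vfun n σ.1 := by
  have h1 : (mainSet n hm σ.1).card =
      Nat.card ((constGrp n m σ.1).comap (antiRed n hm σ.1)) := by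
    rw [← Fintype.card_coe, ← Nat.card_eq_fintype_card]
    refine Nat.card_congr
      { toFun := fun i => ⟨⟨i.1, (Finset.mem_filter.mp i.2).2.1⟩, (Finset.mem_filter.mp i.2).2.2⟩
        invFun := fun i => ⟨i.1.1, Finset.mem_filter.mpr ⟨Finset.mem_univ _, i.1.2, i.2⟩⟩
        left_inv := fun _ => rfl
        right_inv := fun _ => rfl }
  have h2 := ((constGrp n m σ.1).comap (antiRed n hm σ.1)).card_mul_index
  rw [AddSubgroup.index_comap_of_surjective _ (antiRed_surj hm σ), antiGrp_card hn] at h2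
  have h3 := (constGrp n m σ.1).card_mul_index
  rw [antiGrp_card hn, constGrp_card] at h3
  rw [h1, ← h3, ← h2]
  ring

end Counting

section Final

lemma BCidx_eq {m N : ℕ} (hm : m ∣ N) (a b : ZMod N × ZMod m) :
    (Quot.mk (fun a b : ZMod N × ZMod m =>
        b = (-a.1, a.2 + ZMod.castHom hm (ZMod m) a.1)) a = Quot.mk _ b) ↔
      a = b ∨ b = (-a.1, a.2 + ZMod.castHom hm (ZMod m) a.1) := by
  constructor
  · intro h
    have h' := Quot.eqvGen_exact h
    clear h
    induction h' with
    | rel x y h => exact Or.inr h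
    | refl x => exact Or.inl rfl
    | symm x y _ ih =>
      rcases ih with h | h
      · exact Or.inl h.symm
      · right
        rw [h]
        simp only [map_neg, neg_neg, add_neg_cancel_right]
    | trans x y z _ _ ih1 ih2 =>
      rcases ih1 with rfl | h1
      · exact ih2
      · rcases ih2 with rfl | h2
        · exact Or.inr h1
        · left
          rw [h2, h1]
          simp only [map_neg, neg_neg, add_neg_cancel_right]
  · rintro (rfl | h)
    · rfl
    · exact Quot.sound h

/-- the index visited at step s -/
def edge {n m N : ℕ} (hm : m ∣ N) (i : ZMod n → ZMod N) (s : ZMod n) : BCidx m N hm :=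
  Quot.mk _ (i (s + 1) - i s, ZMod.castHom hm (ZMod m) (i s))

lemma edge_eq {n m N : ℕ} (hm : m ∣ N) (i : ZMod n → ZMod N) (s t : ZMod n) :
    edge hm i s = edge hm i t ↔
      (dif i s = dif i t ∧ ZMod.castHom hm (ZMod m) (i s) = ZMod.castHom hm (ZMod m) (i t)) ∨
      (dif i t = - dif i s ∧
        ZMod.castHom hm (ZMod m) (i t) = ZMod.castHom hm (ZMod m) (i (s + 1))) := by
  refine (BCidx_eq hm _ _).trans ?_
  simp only [Prod.mk.injEq, dif, map_sub, add_sub_cancel]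

/-- walks compatible with σ -/
noncomputable def compSet (n : ℕ) {m N : ℕ} [NeZero n] [NeZero N] (hm : m ∣ N)
    (σ : Equiv.Perm (ZMod n)) : Finset (ZMod n → ZMod N) :=
  haveI := Classical.decEq (BCidx m N hm)
  Finset.univ.filter fun i => ∀ s, edge hm i (σ s) = edge hm i s

lemma mainSet_subset {n m N : ℕ} [NeZero n] [NeZero N] (hm : m ∣ N) (σ : Pairing n) :
    mainSet n hm σ.1 ⊆ compSet n hm σ.1 := by
  intro i hi
  simp only [mainSet, compSet, Finset.mem_filter, Finset.mem_univ, true_and] at hi ⊢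
  intro s
  rw [eq_comm, edge_eq]
  right
  refine ⟨hi.1 s, ?_⟩
  have := hi.2 (σ.1 s)
  rw [σ.2.1] at this
  exact this.symm

lemma compSet_card {n m N k : ℕ} [NeZero n] [NeZero N] (hm : m ∣ N) (hn : n = 2 * k)
    (σ : Pairing n) :
    (compSet n hm σ.1).card ≤ (mainSet n hm σ.1).card +
      Fintype.card ((ZMod n → Bool) × ZMod n) * (2 * N ^ k) := by
  classical
  set P : Finset ((ZMod n → Bool) × ZMod n) :=
    Finset.univ.filter fun q => q.2 ∈ reps σ.1 with hP
  have hsub : compSet n hm σ.1 ⊆ mainSet n hm σ.1 ∪ P.biUnion fun q => parSet n N σ q.1 q.2 := by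
    intro i hi
    rw [Finset.mem_union, or_iff_not_imp_left]
    intro hnot
    simp only [mainSet, compSet, Finset.mem_filter, Finset.mem_univ, true_and] at hi hnot
    have hi' := fun s => (edge_eq hm i s (σ.1 s)).mp (hi s).symm
    let ε : ZMod n → Bool := fun s => decide (dif i (σ.1 s) = dif i s)
    have hε : ∀ s, dif i (σ.1 s) = if ε s then dif i s else - dif i s := by
      intro s
      by_cases h : dif i (σ.1 s) = dif i s
      · simp [ε, h]
      · rcases hi' s with h1 | h1
        · exact absurd h1.1.symm h
        · simp only [ε, h, decide_false]
          simpa using h1.1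
    have hex : ∃ s, dif i (σ.1 s) = dif i s := by
      by_contra hcon
      push Not at hcon
      have h2 : ∀ s, dif i (σ.1 s) = - dif i s ∧
        ZMod.castHom hm (ZMod m) (i (σ.1 s)) = ZMod.castHom hm (ZMod m) (i (s + 1)) := by
        intro s
        rcases hi' s with h1 | h1
        · exact absurd h1.1.symm (hcon s)
        · exact h1
      refine hnot ⟨fun s => (h2 s).1, fun s => ?_⟩
      have := (h2 (σ.1 s)).2
      rw [σ.2.1] at this
      exact this.symm
    obtain ⟨s, hs⟩ := hex
    rw [Finset.mem_biUnion]
    by_cases hr : s ∈ reps σ.1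
    · exact ⟨(ε, s), by simp [hP, hr], by simp only [parSet, Finset.mem_filter, Finset.mem_univ, true_and]; exact ⟨hε, hs⟩⟩
    · refine ⟨(ε, σ.1 s), by simpa [hP] using (reps_iff σ s).mpr hr, ?_⟩
      simp only [parSet, Finset.mem_filter, Finset.mem_univ, true_and]
      refine ⟨hε, ?_⟩
      rw [σ.2.1, hs]
  refine (Finset.card_le_card hsub).trans ((Finset.card_union_le _ _).trans ?_)
  refine Nat.add_le_add_left ?_ _
  refine (Finset.card_biUnion_le_card_mul _ _ (2 * N ^ k) ?_).trans ?_
  · intro q hq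
    exact parSet_card hn _ _ _ (by simpa [hP] using hq)
  · exact Nat.mul_le_mul_right _ (Finset.card_le_univ _)

/-- the constant in the moment bound -/
noncomputable def bigC (μ : Measure ℝ) (n : ℕ) [NeZero n] : ℝ :=
  ((1 + ∑ j ∈ Finset.range (n + 1), |∫ y, y ^ j ∂μ|) ^ n + (Fintype.card (Pairing n) : ℝ)) *
    (Fintype.card ((ZMod n → ZMod n) × (ZMod n → Bool)) : ℝ)

lemma expTrace_eq (μ : Measure ℝ) [IsProbabilityMeasure μ]
    (hmom : ∀ n : ℕ, Integrable (fun x : ℝ => x ^ n) μ) {n m N : ℕ} [NeZero n] [NeZero N]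
    (hm : m ∣ N) [Fintype (BCidx m N hm)] [DecidableEq (BCidx m N hm)] (hN : N ≠ 0) :
    expTrace μ m N n hm hN = ∑ i : ZMod n → ZMod N,
      ∏ c, ∫ y, y ^ (Finset.univ.filter fun s => edge hm i s = c).card ∂μ := by
  have hbij : Function.Bijective (fun i : Fin N => ((i : ℕ) : ZMod N)) := by
    rw [Fintype.bijective_iff_injective_and_card]
    refine ⟨fun a b h => ?_, by simp [ZMod.card]⟩
    simp only at h
    rw [ZMod.natCast_eq_natCast_iff] at h
    exact Fin.ext (Nat.ModEq.eq_of_lt_of_lt h a.2 b.2)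
  let E : Fin N ≃ ZMod N := Equiv.ofBijective _ hbij
  have htr : ∀ x : BCidx m N hm → ℝ, Matrix.trace ((BCmat m N hm x) ^ n) =
      ∑ i : ZMod n → ZMod N, ∏ s, x (edge hm i s) := by
    intro x
    rw [trace_pow_walk']
    exact Fintype.sum_equiv (Equiv.arrowCongr (Equiv.refl _) E) _ _ (fun w => rfl)
  unfold expTrace
  simp_rw [htr]
  rw [integral_finsetSum]
  · refine Finset.sum_congr rfl fun i _ => ?_
    convert integral_prod_walk μ (edge hm i)
  · intro i _
    convert integrable_prod_walk μ hmom (edge hm i)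

lemma expTrace_bound (μ : Measure ℝ) [IsProbabilityMeasure μ]
    (hmean : ∫ x : ℝ, x ∂μ = 0) (hvar : ∫ x : ℝ, x ^ 2 ∂μ = 1)
    (hmom : ∀ n : ℕ, Integrable (fun x : ℝ => x ^ n) μ) {n m N k : ℕ} [NeZero n] [NeZero N]
    (hm : m ∣ N) (hN : N ≠ 0) (hn : n = 2 * k) :
    |expTrace μ m N n hm hN - ∑ σ : Pairing n, ((compSet n hm σ.1).card : ℝ)| ≤
      bigC μ n * (N : ℝ) ^ k := by
  classical
  haveI : NeZero m := ⟨by rintro rfl; exact hN (zero_dvd_iff.mp hm)⟩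
  haveI : Finite (BCidx m N hm) := Finite.of_surjective _ (fun q => Quot.exists_rep q)
  haveI : Fintype (BCidx m N hm) := Fintype.ofFinite _
  have h1 : ∑ σ : Pairing n, ((compSet n hm σ.1).card : ℝ) =
      ∑ i : ZMod n → ZMod N, (numPair n (edge hm i) : ℝ) := by
    rw [← Nat.cast_sum, ← Nat.cast_sum]
    congr 1
    simp only [compSet, numPair, Finset.card_filter]
    rw [Finset.sum_comm]
  rw [h1, expTrace_eq μ hmom hm hN, ← Finset.sum_sub_distrib]
  refine (Finset.abs_sum_le_sum_abs _ _).trans ?_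
  have h2 : ∀ i : ZMod n → ZMod N, _ ≤ _ := fun i =>
    weight_sub_numPair hn (fun j => ∫ y, y ^ j ∂μ) (by simp) (by simpa using hmean) hvar
      (edge hm i)
  refine (Finset.sum_le_sum fun i _ => h2 i).trans ?_
  rw [← Finset.sum_filter, Finset.sum_const, nsmul_eq_mul, mul_comm, bigC, mul_assoc]
  refine mul_le_mul_of_nonneg_left ?_ ?_
  · have := bad1_card (n := n) (N := N) (edge hm) (fun i s t h => by
      rcases (edge_eq hm i s t).mp h with h | h
      · exact Or.inl h.1
      · exact Or.inr (by rw [h.1, neg_neg])) k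
    exact_mod_cast this
  · have : 0 ≤ ∑ j ∈ Finset.range (n + 1), |∫ y, y ^ j ∂μ| :=
      Finset.sum_nonneg fun _ _ => abs_nonneg _
    positivity

lemma expTrace_bound2 (μ : Measure ℝ) [IsProbabilityMeasure μ]
    (hmean : ∫ x : ℝ, x ∂μ = 0) (hvar : ∫ x : ℝ, x ^ 2 ∂μ = 1)
    (hmom : ∀ n : ℕ, Integrable (fun x : ℝ => x ^ n) μ) (n m k : ℕ) [NeZero n]
    (hn : n = 2 * k) : ∃ C : ℝ, ∀ (N : ℕ) (hm : m ∣ N) (hN : N ≠ 0),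
    |((N : ℝ) ^ (k + 1))⁻¹ * expTrace μ m N n hm hN -
      ∑ σ : Pairing n, (m : ℝ) ^ ((vfun n σ.1 : ℤ) - (k + 1 : ℤ))| ≤ C * (N : ℝ)⁻¹ := by
  refine ⟨bigC μ n + ∑ σ : Pairing n, (Fintype.card ((ZMod n → Bool) × ZMod n) : ℝ) * 2, ?_⟩
  intro N hm hN
  haveI : NeZero N := ⟨hN⟩
  haveI : NeZero m := ⟨by rintro rfl; exact hN (zero_dvd_iff.mp hm)⟩
  have hNpos : (0 : ℝ) < N := by exact_mod_cast Nat.pos_of_ne_zero hN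
  have hm0 : (m : ℝ) ≠ 0 := by exact_mod_cast NeZero.ne m
  have hmain : ∀ σ : Pairing n, ((mainSet n hm σ.1).card : ℝ) =
      (N : ℝ) ^ (k + 1) * (m : ℝ) ^ ((vfun n σ.1 : ℤ) - (k + 1 : ℤ)) := by
    intro σ
    have h := mainSet_card hm hn σ
    have h' : ((mainSet n hm σ.1).card : ℝ) * (m : ℝ) ^ (k + 1) =
      (N : ℝ) ^ (k + 1) * (m : ℝ) ^ vfun n σ.1 := by exact_mod_cast h
    rw [zpow_sub₀ hm0, zpow_natCast]
    have h3 : (m : ℝ) ^ ((k : ℤ) + 1) = (m : ℝ) ^ (k + 1) := by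
      rw [← zpow_natCast]; push_cast; rfl
    rw [h3, ← mul_div_assoc, ← h']
    field_simp
  have hb := expTrace_bound μ hmean hvar hmom hm hN hn
  have hσ : |∑ σ : Pairing n, ((compSet n hm σ.1).card : ℝ) -
      ∑ σ : Pairing n, (N : ℝ) ^ (k + 1) * (m : ℝ) ^ ((vfun n σ.1 : ℤ) - (k + 1 : ℤ))| ≤
      (∑ σ : Pairing n, (Fintype.card ((ZMod n → Bool) × ZMod n) : ℝ) * 2) * (N : ℝ) ^ k := by
    rw [← Finset.sum_sub_distrib, Finset.sum_mul]
    refine (Finset.abs_sum_le_sum_abs _ _).trans (Finset.sum_le_sum fun σ _ => ?_)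
    rw [← hmain σ]
    have a1 : ((mainSet n hm σ.1).card : ℝ) ≤ (compSet n hm σ.1).card := by
      exact_mod_cast Finset.card_le_card (mainSet_subset hm σ)
    have a2 : ((compSet n hm σ.1).card : ℝ) ≤ (mainSet n hm σ.1).card +
      Fintype.card ((ZMod n → Bool) × ZMod n) * (2 * (N : ℝ) ^ k) := by
      exact_mod_cast compSet_card hm hn σ
    rw [abs_of_nonneg (by linarith)]
    linarith
  rw [← Finset.mul_sum] at hσ
  set L := ∑ σ : Pairing n, (m : ℝ) ^ ((vfun n σ.1 : ℤ) - (k + 1 : ℤ))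
  have h5 := (abs_sub_le _ _ _).trans (add_le_add hb hσ)
  have h6 : ((N : ℝ) ^ (k + 1))⁻¹ * expTrace μ m N n hm hN - L =
      ((N : ℝ) ^ (k + 1))⁻¹ * (expTrace μ m N n hm hN - (N : ℝ) ^ (k + 1) * L) := by
    field_simp
  rw [h6, abs_mul, abs_of_pos (by positivity)]
  refine (mul_le_mul_of_nonneg_left h5 (by positivity)).trans (le_of_eq ?_)
  rw [pow_succ]
  field_simp

end Final

/-- for `m ≥ 1`, `k ≥ 1`, the limit as `N → ∞` over positive multiples of `m` of
`N^{-(k+1)} E[Tr(A^{2k})]` exists and equals `∑_{σ ∈ P(2k)} m^{-(k+1-v(σ))}`. -/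
theorem limiting_even_moment_eq_pairing_sum
    (μ : Measure ℝ) [IsProbabilityMeasure μ]
    (hmean : ∫ x : ℝ, x ∂μ = 0) (hvar : ∫ x : ℝ, x ^ 2 ∂μ = 1)
    (hmom : ∀ n : ℕ, Integrable (fun x : ℝ => x ^ n) μ)
    (m k : ℕ) (hm : 1 ≤ m) (hk : 1 ≤ k) :
    haveI : NeZero (2 * k) := ⟨by omega⟩
    Tendsto
      (fun j : ℕ =>
        (((m * (j + 1) : ℕ) : ℝ) ^ (k + 1))⁻¹ *
          expTrace μ m (m * (j + 1)) (2 * k) (dvd_mul_right m (j + 1))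
            (Nat.mul_ne_zero (by omega) (by omega)))
      atTop
      (nhds (∑ σ : Pairing (2 * k), (m : ℝ) ^ ((vfun (2 * k) σ.1 : ℤ) - (k + 1 : ℤ)))) := by
  haveI : NeZero (2 * k) := ⟨by omega⟩
  obtain ⟨C, hC⟩ := expTrace_bound2 μ hmean hvar hmom (2 * k) m k rfl
  rw [tendsto_iff_norm_sub_tendsto_zero]
  have hlim : Tendsto (fun j : ℕ => C * ((m * (j + 1) : ℕ) : ℝ)⁻¹) atTop (nhds 0) := by
    have h1 : Tendsto (fun j : ℕ => m * (j + 1)) atTop atTop :=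
      tendsto_atTop_mono (fun j => by simp only [id]; nlinarith) tendsto_id
    have h2 := (tendsto_inv_atTop_nhds_zero_nat (𝕜 := ℝ)).comp h1
    simpa using h2.const_mul C
  refine squeeze_zero (fun _ => norm_nonneg _) (fun j => ?_) hlim
  rw [Real.norm_eq_abs]
  exact hC (m * (j + 1)) _ _
end

section
/- Let k ≥ 1 and N ≥ 1 be integers, let σ ∈ P(2k), and let ε : ZMod (2k) → {−1, 1} satisfy ε ∘ σ = ε. If ε(j₀) = 1 for some j₀, then the number of functions i : ZMod (2k) → ZMod N satisfying i(j+1) − i(j) = ε(j) · (i(σ(j)+1) − i(σ(j))) in ZMod N for every j ∈ ZMod (2k) is at most 2 · N^k. -/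
open Filter

/-- if a pairing `σ` carries an orientation `ε` with some positive sign, then the
number of index functions `i : ZMod (2k) → ZMod N` satisfying the paired difference equations
is at most `2 · N^k`. -/
theorem count_positive_orientation_le
    (k N : ℕ) (hk : 1 ≤ k) (hN : 1 ≤ N) (σ : Pairing (2 * k))
    (ε : ZMod (2 * k) → ℤ) (hval : ∀ j, ε j = 1 ∨ ε j = -1)
    (hcomp : ∀ j, ε (σ.1 j) = ε j) (hone : ∃ j₀, ε j₀ = 1) :
    Nat.card {i : ZMod (2 * k) → ZMod N //
        ∀ j, i (j + 1) - i j = ε j • (i (σ.1 j + 1) - i (σ.1 j))} ≤ 2 * N ^ k := by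
  haveI : NeZero (2 * k) := ⟨by omega⟩
  haveI : NeZero N := ⟨by omega⟩
  classical
  obtain ⟨σ, hσ2, hσn⟩ := σ
  simp only at hcomp ⊢
  set R : Finset (ZMod (2 * k)) := Finset.univ.filter (fun j => j.val < (σ j).val) with hR
  have hmem : ∀ j, j ∈ R ↔ j.val < (σ j).val := by intro j; simp [hR]
  have hmem' : ∀ j, j ∈ Rᶜ ↔ σ j ∈ R := by
    intro j
    rw [Finset.mem_compl, hmem, hmem, hσ2]
    have : (σ j).val ≠ j.val := fun h => hσn j (ZMod.val_injective _ h)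
    omega
  have himg : Rᶜ = R.map σ.toEmbedding := by
    ext j
    rw [hmem', Finset.mem_map_equiv]
    have : σ.symm j = σ j := by rw [Equiv.symm_apply_eq, hσ2]
    rw [this]
  have hcard : R.card = k := by
    have h1 := Finset.card_add_card_compl R
    rw [himg, Finset.card_map, ZMod.card] at h1
    omega
  obtain ⟨j₀, hj₀R, hj₀⟩ : ∃ j, j ∈ R ∧ ε j = 1 := by
    obtain ⟨j, hj⟩ := hone
    by_cases h : j ∈ R
    · exact ⟨j, h, hj⟩
    · exact ⟨σ j, (hmem' j).1 (Finset.mem_compl.2 h), by rw [hcomp, hj]⟩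
  have htors : ∀ i : ZMod (2 * k) → ZMod N,
      (∀ j, i (j + 1) - i j = ε j • (i (σ j + 1) - i (σ j))) →
      2 • (∑ j ∈ R with ε j = 1, (i (j + 1) - i j)) = 0 := by
    intro i hi
    have h0 : ∑ j, (i (j + 1) - i j) = 0 := by
      rw [Finset.sum_sub_distrib, sub_eq_zero]
      exact Equiv.sum_comp (Equiv.addRight (1 : ZMod (2 * k))) i
    rw [← Finset.sum_add_sum_compl R, himg, Finset.sum_map, ← Finset.sum_add_distrib] at h0
    rw [← h0, Finset.smul_sum, Finset.sum_filter]
    refine Finset.sum_congr rfl fun j _ => ?_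
    have h1 := hi j
    simp only [Equiv.coe_toEmbedding]
    rcases hval j with h | h
    · rw [h, one_smul] at h1
      rw [if_pos h, ← h1, two_nsmul]
    · rw [h, neg_one_smul] at h1
      rw [if_neg (by rw [h]; decide), h1]
      ring
  let F : {i : ZMod (2 * k) → ZMod N // ∀ j, i (j + 1) - i j = ε j • (i (σ j + 1) - i (σ j))} →
      (R → ZMod N) × {x : ZMod N // 2 • x = 0} := fun i =>
    (fun r => if r.1 = j₀ then i.1 0 else i.1 (r.1 + 1) - i.1 r.1,
      ⟨∑ j ∈ R with ε j = 1, (i.1 (j + 1) - i.1 j), htors i.1 i.2⟩)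
  have hF : Function.Injective F := by
    rintro ⟨i, hi⟩ ⟨i', hi'⟩ h
    have h1 := congrArg Prod.fst h
    have h2 := congrArg (fun x => (Prod.snd x).1) h
    simp only [F] at h1 h2
    have hz : i 0 = i' 0 := by
      have := congrFun h1 ⟨j₀, hj₀R⟩
      simpa using this
    have hd : ∀ j ∈ R, j ≠ j₀ → i (j + 1) - i j = i' (j + 1) - i' j := by
      intro j hj hne
      have := congrFun h1 ⟨j, hj⟩
      simpa [hne] using this
    have hj0 : i (j₀ + 1) - i j₀ = i' (j₀ + 1) - i' j₀ := by
      have hm : j₀ ∈ R.filter (fun j => ε j = 1) := Finset.mem_filter.2 ⟨hj₀R, hj₀⟩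
      rw [← Finset.add_sum_erase _ _ hm, ← Finset.add_sum_erase _ _ hm] at h2
      rw [Finset.sum_congr rfl (g := fun j => i' (j + 1) - i' j)] at h2
      · exact add_right_cancel h2
      · intro j hj
        have h3 := Finset.mem_erase.1 hj
        exact hd j (Finset.mem_filter.1 h3.2).1 h3.1
    have hdR : ∀ j ∈ R, i (j + 1) - i j = i' (j + 1) - i' j := by
      intro j hj
      by_cases hne : j = j₀
      · rw [hne, hj0]
      · exact hd j hj hne
    have hall : ∀ j, i (j + 1) - i j = i' (j + 1) - i' j := by
      intro j
      by_cases hj : j ∈ R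
      · exact hdR j hj
      · rw [hi j, hi' j, hdR _ ((hmem' j).1 (Finset.mem_compl.2 hj))]
    have hn : ∀ n : ℕ, i (n : ZMod (2 * k)) = i' (n : ZMod (2 * k)) := by
      intro n
      induction n with
      | zero => simpa using hz
      | succ n ih =>
        have := hall (n : ZMod (2 * k))
        rw [ih] at this
        push_cast
        exact sub_left_injective this
    apply Subtype.ext
    funext j
    have := hn j.val
    rwa [ZMod.natCast_zmod_val] at this
  have h2 : Nat.card {x : ZMod N // 2 • x = 0} ≤ 2 := by
    have := IsAddCyclic.card_nsmul_eq_zero_le (α := ZMod N) (n := 2) (by norm_num)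
    rw [Nat.card_eq_fintype_card, Fintype.card_subtype]
    exact this
  calc _ ≤ Nat.card ((R → ZMod N) × {x : ZMod N // 2 • x = 0}) :=
        Nat.card_le_card_of_injective F hF
    _ = N ^ k * Nat.card {x : ZMod N // 2 • x = 0} := by
        rw [Nat.card_prod, Nat.card_fun, Nat.card_zmod, Nat.card_eq_fintype_card,
          Fintype.card_coe, hcard]
    _ ≤ 2 * N ^ k := by
        rw [mul_comm]
        exact Nat.mul_le_mul_right _ h2
end

section
/- Let k ≥ 1, let m and N be positive integers with m ∣ N, let ι : ZMod N → ZMod m be the natural ring homomorphism, and let σ ∈ P(2k). The number of functions i : ZMod (2k) → ZMod N satisfying, for every j ∈ ZMod (2k), both i(j+1) − i(j) = −(i(σ(j)+1) − i(σ(j))) in ZMod N and ι(i(j)) = ι(i(σ(j)+1)) in ZMod m, is exactly m^{v(σ)} · (N/m)^{k+1}. -/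
open Filter

namespace CountOpp

section
variable {n : ℕ} [NeZero n] (σ : Pairing n) {R S : Type*} [CommRing R] [CommRing S]

/-- A transversal of the pairing. -/
abbrev T : Type := {j : ZMod n // j.val < (σ.1 j).val}

theorem flip_lt {j : ZMod n} (h : ¬ j.val < (σ.1 j).val) :
    (σ.1 j).val < (σ.1 (σ.1 j)).val := by
  rw [σ.2.1 j]
  have h1 : (σ.1 j).val ≠ j.val := fun h' => σ.2.2 j (ZMod.val_injective n h')
  omega

/-- Antisymmetric extension. -/
def dext (g : T σ → R) (j : ZMod n) : R :=
  if h : j.val < (σ.1 j).val then g ⟨j, h⟩ else - g ⟨σ.1 j, flip_lt σ h⟩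

theorem dext_anti (g : T σ → R) (j : ZMod n) : dext σ g j = - dext σ g (σ.1 j) := by
  unfold dext
  by_cases h : j.val < (σ.1 j).val
  · have h2 : ¬ (σ.1 j).val < (σ.1 (σ.1 j)).val := by rw [σ.2.1 j]; omega
    rw [dif_pos h, dif_neg h2, neg_neg]
    congr 1
    exact Subtype.ext (σ.2.1 j).symm
  · rw [dif_neg h, dif_pos (flip_lt σ h)]

theorem sum_anti (d : ZMod n → R) (hd : ∀ j, d j = - d (σ.1 j)) :
    ∑ t ∈ Finset.range n, d (t : ZMod n) = 0 := by
  have h1 : ∑ j : ZMod n, d j = 0 := by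
    refine Finset.sum_involution (fun j _ => σ.1 j) ?_ ?_ ?_ ?_
    · intro j _; rw [hd j]; ring
    · intro j _ _; exact σ.2.2 j
    · intro j _; exact Finset.mem_univ _
    · intro j _; exact σ.2.1 j
  rw [← h1]
  refine Finset.sum_bij (fun t _ => (t : ZMod n)) (fun _ _ => Finset.mem_univ _) ?_ ?_ ?_
  · intro a ha b hb hab
    have := congrArg ZMod.val hab
    simpa [ZMod.val_natCast, Nat.mod_eq_of_lt (Finset.mem_range.1 ha),
      Nat.mod_eq_of_lt (Finset.mem_range.1 hb)] using this
  · intro b _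
    exact ⟨b.val, Finset.mem_range.2 (ZMod.val_lt b), ZMod.natCast_zmod_val b⟩
  · intros; rfl

/-- Build an index function from parameters. -/
def build (p : R × (T σ → R)) (j : ZMod n) : R :=
  p.1 + ∑ t ∈ Finset.range j.val, dext σ p.2 (t : ZMod n)

theorem step (j : ZMod n) : (j.val + 1 < n ∧ (j + 1).val = j.val + 1) ∨
    (j.val + 1 = n ∧ (j + 1).val = 0) := by
  have hj := ZMod.val_lt j
  have h : (j + 1 : ZMod n) = ((j.val + 1 : ℕ) : ZMod n) := by
    rw [Nat.cast_add, ZMod.natCast_zmod_val, Nat.cast_one]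
  rw [h, ZMod.val_natCast]
  rcases Nat.lt_or_ge (j.val + 1) n with h | h
  · left; exact ⟨h, Nat.mod_eq_of_lt h⟩
  · right
    have : j.val + 1 = n := by omega
    exact ⟨this, by rw [this, Nat.mod_self]⟩

theorem sum_step (x : R) (d : ZMod n → R) (hd : ∀ j, d j = - d (σ.1 j)) (j : ZMod n) :
    (x + ∑ t ∈ Finset.range (j + 1).val, d (t : ZMod n)) -
      (x + ∑ t ∈ Finset.range j.val, d (t : ZMod n)) = d j := by
  have h0 : ∑ t ∈ Finset.range (j.val + 1), d (t : ZMod n) =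
      ∑ t ∈ Finset.range j.val, d (t : ZMod n) + d j := by
    rw [Finset.sum_range_succ, ZMod.natCast_zmod_val]
  rcases step j with ⟨_, h2⟩ | ⟨h1, h2⟩
  · rw [h2, h0]; ring
  · rw [h1, sum_anti σ d hd] at h0
    rw [h2, Finset.range_zero, Finset.sum_empty]
    linear_combination h0

theorem build_step (p : R × (T σ → R)) (j : ZMod n) :
    build σ p (j + 1) - build σ p j = dext σ p.2 j :=
  sum_step σ p.1 _ (dext_anti σ p.2) j

/-- The orientation condition. -/
def IsH (i : ZMod n → R) : Prop :=
  ∀ j, i (j + 1) - i j = -(i (σ.1 j + 1) - i (σ.1 j))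

theorem build_isH (p : R × (T σ → R)) : IsH σ (build σ p) := by
  intro j
  rw [build_step, build_step]
  exact dext_anti σ p.2 j

theorem build_zero (p : R × (T σ → R)) : build σ p 0 = p.1 := by
  simp [build]

/-- Read off parameters. -/
def read (i : ZMod n → R) : R × (T σ → R) := (i 0, fun t => i (t.1 + 1) - i t.1)

theorem read_build (p : R × (T σ → R)) : read σ (build σ p) = p := by
  refine Prod.ext (build_zero σ p) ?_
  funext t
  change build σ p (t.1 + 1) - build σ p t.1 = _
  rw [build_step, dext, dif_pos t.2]

theorem build_read (i : ZMod n → R) (hi : IsH σ i) : build σ (read σ i) = i := by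
  have hd : ∀ j, dext σ (read σ i).2 j = i (j + 1) - i j := by
    intro j
    unfold dext
    split_ifs with h
    · rfl
    · exact (hi j).symm
  have key : ∀ s : ℕ, s < n → build σ (read σ i) (s : ZMod n) = i (s : ZMod n) := by
    intro s
    induction s with
    | zero => intro _; rw [Nat.cast_zero, build_zero]; rfl
    | succ s ih =>
      intro hs
      have h1 := build_step σ (read σ i) (s : ZMod n)
      rw [hd, ih (by omega)] at h1
      rw [Nat.cast_succ]
      linear_combination h1
  funext j
  rw [← ZMod.natCast_zmod_val j]
  exact key _ (ZMod.val_lt j)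

theorem map_build (f : R →+* S) (p : R × (T σ → R)) (j : ZMod n) :
    f (build σ p j) = build σ (Prod.map f (fun g => f ∘ g) p) j := by
  unfold build
  rw [map_add, map_sum]
  refine congrArg₂ _ rfl (Finset.sum_congr rfl fun t _ => ?_)
  unfold dext
  split_ifs
  · rfl
  · rw [map_neg]; rfl

/-- The parametrisation. -/
def paramEquiv : {i : ZMod n → R // IsH σ i} ≃ R × (T σ → R) where
  toFun i := read σ i.1
  invFun p := ⟨build σ p, build_isH σ p⟩
  left_inv i := Subtype.ext (build_read σ i.1 i.2)
  right_inv p := read_build σ p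

/-- The class condition. -/
def IsK (i : ZMod n → S) : Prop := ∀ j, i j = i (σ.1 j + 1)

theorem IsK.isH {i : ZMod n → S} (h : IsK σ i) : IsH σ i := by
  intro j
  have h1 := h j
  have h2 := h (σ.1 j)
  rw [σ.2.1 j] at h2
  rw [h1, h2]; ring

/-- Functions constant on classes. -/
def quotEquiv : {i : ZMod n → S // IsK σ i} ≃
    (Quot (fun a b : ZMod n => b = σ.1 a + 1) → S) where
  toFun i := Quot.lift i.1 (by rintro a b rfl; exact i.2 a)
  invFun g := ⟨fun j => g (Quot.mk _ j), fun j => congrArg g (Quot.sound rfl)⟩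
  left_inv i := rfl
  right_inv g := by funext q; induction q using Quot.ind; rfl

/-- parameters mod `m` for functions constant on classes. -/
def kEquiv : {q : S × (T σ → S) // IsK σ (build σ q)} ≃ {i : ZMod n → S // IsK σ i} where
  toFun q := ⟨build σ q.1, q.2⟩
  invFun i := ⟨read σ i.1, by rw [build_read σ i.1 (IsK.isH σ i.2)]; exact i.2⟩
  left_inv q := Subtype.ext (read_build σ q.1)
  right_inv i := Subtype.ext (build_read σ i.1 (IsK.isH σ i.2))

/-- Splitting a surjective homomorphism as a map of sets. -/
noncomputable def splitEquiv (f : R →+* S) (hf : Function.Surjective f) :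
    R ≃ S × {x : R // f x = 0} where
  toFun x := (f x, ⟨x - Function.surjInv hf (f x), by
    rw [map_sub, Function.surjInv_eq hf, sub_self]⟩)
  invFun y := Function.surjInv hf y.1 + y.2.1
  left_inv x := by simp
  right_inv y := by
    obtain ⟨a, b, hb⟩ := y
    have h : f (Function.surjInv hf a + b) = a := by
      rw [map_add, hb, Function.surjInv_eq hf, add_zero]
    refine Prod.ext h (Subtype.ext ?_)
    change Function.surjInv hf a + b - Function.surjInv hf (f (Function.surjInv hf a + b)) = b
    rw [h]; ring

/-- Splitting on parameters. -/
noncomputable def splitParam (f : R →+* S) (hf : Function.Surjective f) :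
    R × (T σ → R) ≃ (S × (T σ → S)) × ({x : R // f x = 0} × (T σ → {x : R // f x = 0})) :=
  (Equiv.prodCongr (splitEquiv f hf)
    ((Equiv.arrowCongr (Equiv.refl _) (splitEquiv f hf)).trans
      (Equiv.arrowProdEquivProdArrow _ _ _))).trans (Equiv.prodProdProdComm _ _ _ _)

theorem splitParam_fst (f : R →+* S) (hf : Function.Surjective f) (p : R × (T σ → R)) :
    (splitParam σ f hf p).1 = Prod.map f (fun g => f ∘ g) p := rfl

theorem card_main (f : R →+* S) (hf : Function.Surjective f) :
    Nat.card {i : ZMod n → R // IsH σ i ∧ IsK σ (fun j => f (i j))} =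
      Nat.card S ^ vfun n σ.1 *
        (Nat.card {x : R // f x = 0}) ^ (Nat.card (T σ) + 1) := by
  have e1 : {i : ZMod n → R // IsH σ i ∧ IsK σ (fun j => f (i j))} ≃
      {i : {i : ZMod n → R // IsH σ i} // IsK σ (fun j => f (i.1 j))} :=
    (Equiv.subtypeSubtypeEquivSubtypeInter (fun i : ZMod n → R => IsH σ i)
      (fun i => IsK σ (fun j => f (i j)))).symm
  have e2 : {i : {i : ZMod n → R // IsH σ i} // IsK σ (fun j => f (i.1 j))} ≃
      {p : (S × (T σ → S)) × ({x : R // f x = 0} × (T σ → {x : R // f x = 0})) //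
        IsK σ (build σ p.1)} := by
    refine Equiv.subtypeEquiv ((paramEquiv σ).trans (splitParam σ f hf)) ?_
    intro i
    have : (fun j => f (i.1 j)) =
        build σ (((paramEquiv σ).trans (splitParam σ f hf)) i).1 := by
      funext j
      rw [Equiv.trans_apply, splitParam_fst, ← map_build]
      change _ = f (build σ (read σ i.1) j)
      rw [build_read σ i.1 i.2]
    rw [this]
  have e3 : {p : (S × (T σ → S)) × ({x : R // f x = 0} × (T σ → {x : R // f x = 0})) //
        IsK σ (build σ p.1)} ≃ {q : S × (T σ → S) // IsK σ (build σ q)} ×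
          ({x : R // f x = 0} × (T σ → {x : R // f x = 0})) :=
    { toFun := fun p => (⟨p.1.1, p.2⟩, p.1.2)
      invFun := fun p => ⟨(p.1.1, p.2), p.1.2⟩
      left_inv := fun _ => rfl
      right_inv := fun _ => rfl }
  rw [Nat.card_congr (e1.trans (e2.trans e3)), Nat.card_prod, Nat.card_prod,
    Nat.card_congr ((kEquiv σ).trans (quotEquiv σ)), Nat.card_fun, Nat.card_fun, vfun]
  ring

theorem card_T : 2 * Nat.card (T σ) = n := by
  classical
  have e : T σ ≃ {j : ZMod n // ¬ j.val < (σ.1 j).val} :=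
    { toFun := fun t => ⟨σ.1 t.1, by rw [σ.2.1]; exact not_lt.2 t.2.le⟩
      invFun := fun t => ⟨σ.1 t.1, flip_lt σ t.2⟩
      left_inv := fun t => Subtype.ext (σ.2.1 _)
      right_inv := fun t => Subtype.ext (σ.2.1 _) }
  have h := Nat.card_congr (Equiv.sumCompl (fun j : ZMod n => j.val < (σ.1 j).val))
  rw [Nat.card_sum, ← Nat.card_congr e, Nat.card_zmod] at h
  change Nat.card (T σ) + Nat.card (T σ) = n at h
  omega

end

end CountOpp

/-- for a pairing with all edges matched in opposite orientation, together with
the modulo-`m` constraints, the number of index functions is exactly `m^{v(σ)} (N/m)^{k+1}`. -/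
theorem count_opposite_orientation_eq
    (k m N : ℕ) (hk : 1 ≤ k) (hm : 1 ≤ m) (hN : 1 ≤ N) (hdvd : m ∣ N)
    (σ : Pairing (2 * k)) :
    Nat.card {i : ZMod (2 * k) → ZMod N //
        ∀ j, i (j + 1) - i j = -(i (σ.1 j + 1) - i (σ.1 j)) ∧
          ZMod.castHom hdvd (ZMod m) (i j) = ZMod.castHom hdvd (ZMod m) (i (σ.1 j + 1))} =
      m ^ vfun (2 * k) σ.1 * (N / m) ^ (k + 1) := by
  have : NeZero (2 * k) := ⟨by omega⟩
  have hf : Function.Surjective (ZMod.castHom hdvd (ZMod m)) := ZMod.castHom_surjective hdvd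
  have h1 := CountOpp.card_main σ (ZMod.castHom hdvd (ZMod m)) hf
  have hT : Nat.card (CountOpp.T σ) = k := by
    have := CountOpp.card_T σ
    omega
  have hF : Nat.card {x : ZMod N // ZMod.castHom hdvd (ZMod m) x = 0} = N / m := by
    have h := Nat.card_congr (CountOpp.splitEquiv (ZMod.castHom hdvd (ZMod m)) hf)
    rw [Nat.card_prod, Nat.card_zmod, Nat.card_zmod] at h
    exact (Nat.div_eq_of_eq_mul_right hm h).symm
  rw [hT, hF, Nat.card_zmod] at h1
  rw [← h1]
  refine Nat.card_congr (Equiv.subtypeEquivRight fun i => ?_)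
  exact forall_and
end

section
/- For every integer k ≥ 1 and every σ ∈ P(2k), one has v(σ) ≤ k + 1 and k + 1 − v(σ) is even (it equals twice the genus of the orientable surface obtained by gluing the edges of a 2k-gon in oppositely oriented pairs according to σ). -/
open Filter

/-- Number of orbits of a permutation, as the cardinality of a `Quot`. -/
noncomputable def orbCount {α : Type} (f : Equiv.Perm α) : ℕ :=
  Nat.card (Quot (fun a b : α => b = f a))

theorem quot_mk_pow {α : Type} (f : Equiv.Perm α) (a : α) (i : ℕ) :
    Quot.mk (fun a b : α => b = f a) ((f ^ i) a) = Quot.mk _ a := by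
  induction i with
  | zero => rfl
  | succ i ih =>
    rw [← ih, pow_succ']
    exact (Quot.sound (r := fun a b : α => b = f a) (a := (f ^ i) a) rfl).symm

theorem quot_mk_sameCycle {α : Type} [Fintype α] [DecidableEq α] (f : Equiv.Perm α) {a b : α}
    (h : f.SameCycle a b) :
    Quot.mk (fun a b : α => b = f a) a = Quot.mk _ b := by
  obtain ⟨i, -, -, hi⟩ := h.exists_pow_eq
  rw [← hi, quot_mk_pow]

theorem orbCount_eq {α : Type} [Fintype α] [DecidableEq α] (f : Equiv.Perm α) :
    orbCount f + f.support.card = f.cycleType.card + Fintype.card α := by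
  classical
  let F : α → f.cycleFactorsFinset ⊕ {x // f x = x} := fun x =>
    if h : f x = x then Sum.inr ⟨x, h⟩ else
      Sum.inl ⟨f.cycleOf x, Equiv.Perm.cycleOf_mem_cycleFactorsFinset_iff.2
        (Equiv.Perm.mem_support.2 h)⟩
  have hF : ∀ a b, b = f a → F a = F b := by
    rintro a b rfl
    by_cases h : f a = a
    · rw [h]
    · have h' : ¬ f (f a) = f a := fun e => h (f.injective e)
      simp only [F, dif_neg h, dif_neg h']
      congr 2
      exact (Equiv.Perm.SameCycle.cycleOf_eq (Equiv.Perm.sameCycle_apply_right.2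
        (Equiv.Perm.SameCycle.refl f a)))
  have hb : Function.Bijective (Quot.lift F hF) := by
    constructor
    · rintro ⟨a⟩ ⟨b⟩ hab
      change F a = F b at hab
      by_cases ha : f a = a <;> by_cases hb : f b = b
      · simp only [F, dif_pos ha, dif_pos hb, Sum.inr.injEq, Subtype.mk.injEq] at hab
        rw [hab]
      · simp [F, ha, hb] at hab
      · simp [F, ha, hb] at hab
      · simp only [F, dif_neg ha, dif_neg hb, Sum.inl.injEq, Subtype.mk.injEq] at hab
        exact quot_mk_sameCycle f ((Equiv.Perm.sameCycle_iff_cycleOf_eq_of_mem_support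
          (Equiv.Perm.mem_support.2 ha) (Equiv.Perm.mem_support.2 hb)).2 hab)
    · rintro (⟨c, hc⟩ | ⟨x, hx⟩)
      · obtain ⟨x, hx⟩ := (Equiv.Perm.mem_cycleFactorsFinset_iff.1 hc).1.nonempty_support
        have e := Equiv.Perm.cycle_is_cycleOf hx hc
        refine ⟨Quot.mk _ x, ?_⟩
        have hfx : ¬ f x = x := Equiv.Perm.mem_support.1
          (Equiv.Perm.mem_cycleFactorsFinset_support_le hc hx)
        change F x = _
        simp only [F, dif_neg hfx, e]
      · exact ⟨Quot.mk _ x, by change F x = _; simp [F, hx]⟩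
  have h1 : orbCount f = f.cycleType.card + Fintype.card {x // f x = x} := by
    unfold orbCount
    rw [Nat.card_eq_of_bijective _ hb, Nat.card_sum, Nat.card_eq_fintype_card,
      Nat.card_eq_fintype_card, Equiv.Perm.cycleType_def]
    simp
  have h2 : Fintype.card {x // f x = x} + f.support.card = Fintype.card α := by
    rw [Fintype.card_subtype, Equiv.Perm.support]
    exact Finset.card_filter_add_card_filter_not (s := Finset.univ) (fun x => f x = x)
  omega

theorem sign_eq_orbCount {α : Type} [Fintype α] [DecidableEq α] (f : Equiv.Perm α) :
    Equiv.Perm.sign f = (-1) ^ (orbCount f + Fintype.card α) := by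
  rw [Equiv.Perm.sign_of_cycleType, Equiv.Perm.sum_cycleType]
  have h := orbCount_eq f
  have h2 : f.support.card ≤ Fintype.card α := Finset.card_le_univ _
  have : orbCount f + Fintype.card α
      = f.support.card + f.cycleType.card + 2 * (Fintype.card α - f.support.card) := by omega
  rw [this, pow_add _ _ (2 * _), pow_mul]
  simp

/-- Functions invariant under a permutation. -/
def invFun' {α : Type} (f : Equiv.Perm α) : Submodule ℚ (α → ℚ) where
  carrier := {g | ∀ a, g (f a) = g a}
  add_mem' := by
    intro g h hg hh a
    simp [hg a, hh a]
  zero_mem' := fun a => rfl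
  smul_mem' := by
    intro c g hg a
    simp [hg a]

theorem finrank_invFun' {α : Type} [Finite α] (f : Equiv.Perm α) :
    Module.finrank ℚ (invFun' f) = orbCount f := by
  classical
  have : Fintype (Quot (fun a b : α => b = f a)) := Fintype.ofFinite _
  let e : invFun' f ≃ₗ[ℚ] (Quot (fun a b : α => b = f a) → ℚ) :=
    { toFun := fun g => Quot.lift g.1 (by rintro a b rfl; exact (g.2 a).symm)
      invFun := fun h => ⟨fun a => h (Quot.mk _ a), fun a => by
        
        exact congrArg h (Quot.sound (r := fun a b : α => b = f a) (a := a) rfl).symm⟩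
      left_inv := fun g => rfl
      right_inv := fun h => by ext ⟨a⟩; rfl
      map_add' := fun g h => by ext ⟨a⟩; rfl
      map_smul' := fun g h => by ext ⟨a⟩; rfl }
  rw [e.finrank_eq, Module.finrank_fintype_fun_eq_card, orbCount, Nat.card_eq_fintype_card]

theorem orbCount_mul_le {α : Type} [Fintype α] (s t : Equiv.Perm α) :
    orbCount (t * s) + orbCount s ≤ Fintype.card α + orbCount t := by
  rw [← finrank_invFun', ← finrank_invFun', ← finrank_invFun',
    ← Submodule.finrank_sup_add_finrank_inf_eq]
  have h1 := Submodule.finrank_le (invFun' (t * s) ⊔ invFun' s)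
  rw [Module.finrank_fintype_fun_eq_card] at h1
  have h2 : invFun' (t * s) ⊓ invFun' s ≤ invFun' t := by
    rintro g ⟨hg, hs⟩ a
    have h3 := hg (s.symm a)
    have h4 := hs (s.symm a)
    simp at h3 h4
    rw [h3, ← h4]
  have h3 := Submodule.finrank_mono h2
  omega

theorem orbCount_rot (n : ℕ) [NeZero n] : orbCount (Equiv.addRight (1 : ZMod n)) = 1 := by
  have h : ∀ a : ZMod n, Quot.mk (fun a b => b = Equiv.addRight (1 : ZMod n) a) a
      = Quot.mk _ 0 := by
    intro a
    rw [← quot_mk_pow _ 0 a.val]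
    congr 1
    simp
  rw [orbCount, Nat.card_eq_one_iff_unique]
  refine ⟨⟨?_⟩, ⟨Quot.mk _ 0⟩⟩
  rintro ⟨a⟩ ⟨b⟩
  exact (h a).trans (h b).symm

/-- for every pairing `σ` of the edges of a `2k`-gon, `v(σ) ≤ k + 1` and
`k + 1 - v(σ)` is even (twice the genus of the glued orientable surface). -/
theorem vfun_le_and_even_defect (k : ℕ) (hk : 1 ≤ k) (σ : Pairing (2 * k)) :
    vfun (2 * k) σ.1 ≤ k + 1 ∧ 2 ∣ (k + 1 - vfun (2 * k) σ.1) := by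
  have : NeZero (2 * k) := ⟨by omega⟩
  obtain ⟨s, hs, hs'⟩ := σ
  have hv : vfun (2 * k) s = orbCount (Equiv.addRight (1 : ZMod (2 * k)) * s) := rfl
  have hc : Fintype.card (ZMod (2 * k)) = 2 * k := ZMod.card _
  have hsup : s.support.card = 2 * k := by
    have : s.support = Finset.univ := by
      ext a
      simp [hs' a]
    rw [this, Finset.card_univ, hc]
  have hsk : orbCount s = k := by
    have h1 : s ^ 2 = 1 := by
      ext a
      simp [pow_two, hs a]
    have : Fact (Nat.Prime 2) := ⟨Nat.prime_two⟩
    have h2 := Equiv.Perm.cycleType_of_pow_prime_eq_one h1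
    have h3 := s.sum_cycleType
    rw [h2, Multiset.sum_replicate, hsup, smul_eq_mul] at h3
    have h4 := orbCount_eq s
    omega
  have hr := orbCount_rot (2 * k)
  have hle := orbCount_mul_le s (Equiv.addRight (1 : ZMod (2 * k)))
  have hsgn := sign_eq_orbCount (Equiv.addRight (1 : ZMod (2 * k)) * s)
  rw [Equiv.Perm.sign_mul, sign_eq_orbCount, sign_eq_orbCount s] at hsgn
  change vfun (2 * k) s ≤ k + 1 ∧ 2 ∣ (k + 1 - vfun (2 * k) s)
  rw [← hv, hr, hsk, hc, ← pow_add] at hsgn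
  rw [← hv, hr, hsk, hc] at hle
  have hle' : vfun (2 * k) s ≤ k + 1 := by omega
  refine ⟨hle', ?_⟩
  rcases Nat.even_or_odd (1 + 2 * k + (k + 2 * k)) with h | h <;>
  rcases Nat.even_or_odd (vfun (2 * k) s + 2 * k) with h' | h'
  · rw [Nat.even_iff] at h h'
    omega
  · rw [h.neg_one_pow, h'.neg_one_pow] at hsgn
    exact absurd hsgn (by decide)
  · rw [h.neg_one_pow, h'.neg_one_pow] at hsgn
    exact absurd hsgn (by decide)
  · rw [Nat.odd_iff] at h h'
    omega
end

section
/- For every integer k ≥ 1, the number of pairings σ ∈ P(2k) with v(σ) = k + 1 equals the k-th Catalan number C_k = (1/(k+1)) · C(2k, k). -/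
open Filter

/-- Predicate: `f` is a noncrossing fixed-point-free involution on `[l, l + 2n)`. -/
structure IsNC (f : ℕ → ℕ) (l n : ℕ) : Prop where
  inv : ∀ x, f (f x) = x
  supp : ∀ x, f x ≠ x ↔ l ≤ x ∧ x < l + 2 * n
  nc : ∀ a b, a < b → b < f a → a < f b ∧ f b < f a

lemma IsNC.mem {f : ℕ → ℕ} {l n : ℕ} (h : IsNC f l n) {x : ℕ} (h1 : l ≤ x)
    (h2 : x < l + 2 * n) : l ≤ f x ∧ f x < l + 2 * n ∧ f x ≠ x := by
  have h3 := (h.supp x).2 ⟨h1, h2⟩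
  have h4 : f (f x) ≠ f x := by rw [h.inv]; exact h3.symm
  have h5 := (h.supp _).1 h4
  exact ⟨h5.1, h5.2, h3⟩

lemma IsNC.out {f : ℕ → ℕ} {l n : ℕ} (h : IsNC f l n) {x : ℕ} (h1 : x < l ∨ l + 2 * n ≤ x) :
    f x = x := by
  by_contra h3
  have := (h.supp x).1 h3
  omega

/-- The involution attached to a binary tree. -/
def phi : BinaryTree Unit → ℕ → ℕ → ℕ
  | .nil, _, x => x
  | .node _ L R, l, x =>
    if x = l then l + 1 + 2 * L.numNodes
    else if x = l + 1 + 2 * L.numNodes then l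
    else if x < l + 1 + 2 * L.numNodes then phi L (l + 1) x
    else phi R (l + 2 * L.numNodes + 2) x

lemma phi_isNC (t : BinaryTree Unit) : ∀ l, IsNC (phi t l) l t.numNodes := by
  induction t with
  | nil =>
    intro l
    refine ⟨fun x => rfl, fun x => ?_, fun a b h1 h2 => ?_⟩
    · simp [phi, BinaryTree.numNodes]
    · simp [phi] at h2; omega
  | node u L R ihL ihR =>
    intro l
    have hL := ihL (l + 1)
    have hR := ihR (l + 2 * L.numNodes + 2)
    have key : ∀ x, (x < l ∧ phi (.node u L R) l x = x) ∨
        (x = l ∧ phi (.node u L R) l x = l + 1 + 2 * L.numNodes) ∨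
        (l < x ∧ x < l + 1 + 2 * L.numNodes ∧ phi (.node u L R) l x = phi L (l + 1) x ∧
          l < phi L (l + 1) x ∧ phi L (l + 1) x < l + 1 + 2 * L.numNodes ∧
          phi L (l + 1) x ≠ x) ∨
        (x = l + 1 + 2 * L.numNodes ∧ phi (.node u L R) l x = l) ∨
        (l + 1 + 2 * L.numNodes < x ∧ x < l + 2 * (L.numNodes + R.numNodes + 1) ∧
          phi (.node u L R) l x = phi R (l + 2 * L.numNodes + 2) x ∧
          l + 1 + 2 * L.numNodes < phi R (l + 2 * L.numNodes + 2) x ∧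
          phi R (l + 2 * L.numNodes + 2) x < l + 2 * (L.numNodes + R.numNodes + 1) ∧
          phi R (l + 2 * L.numNodes + 2) x ≠ x) ∨
        (l + 2 * (L.numNodes + R.numNodes + 1) ≤ x ∧ phi (.node u L R) l x = x) := by
      intro x
      have a1 := @IsNC.mem _ _ _ hL x
      have a2 := @IsNC.mem _ _ _ hR x
      have a3 := @IsNC.out _ _ _ hL x
      have a4 := @IsNC.out _ _ _ hR x
      simp only [phi]
      split_ifs <;> omega
    have nn : (BinaryTree.node u L R).numNodes = L.numNodes + R.numNodes + 1 := rfl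
    rw [nn]
    refine ⟨fun x => ?_, fun x => ?_, fun a b h1 h2 => ?_⟩
    · have k1 := key x
      have k2 := key (phi (.node u L R) l x)
      have i1 := hL.inv x
      have i2 := hR.inv x
      rcases k1 with h | h | h | h | h | h
      · rw [h.2, h.2]
      · rw [h.2] at k2 ⊢; omega
      · rw [h.2.2.1] at k2 ⊢; omega
      · rw [h.2] at k2 ⊢; omega
      · rw [h.2.2.1] at k2 ⊢; omega
      · rw [h.2, h.2]
    · have k1 := key x
      omega
    · have k1 := key a
      have k2 := key b
      have i1 := hL.nc a b
      have i2 := hR.nc a b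
      omega

lemma phi_inj (t : BinaryTree Unit) : ∀ (t' : BinaryTree Unit) (l : ℕ), t.numNodes = t'.numNodes →
    phi t l = phi t' l → t = t' := by
  induction t with
  | nil =>
    intro t' l h _
    cases t' with
    | nil => rfl
    | node u L R => simp [BinaryTree.numNodes] at h
  | node u L R ihL ihR =>
    intro t' l h e
    cases t' with
    | nil => simp [BinaryTree.numNodes] at h
    | node u' L' R' =>
      have h0 := congrFun e l
      simp only [phi, if_true] at h0
      have hL : L.numNodes = L'.numNodes := by omega
      have hR : R.numNodes = R'.numNodes := by
        simp only [BinaryTree.numNodes] at h; omega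
      have eL : L = L' := by
        refine ihL L' (l + 1) hL ?_
        funext x
        have a1 := @IsNC.out _ _ _ (phi_isNC L (l + 1)) x
        have a2 := @IsNC.out _ _ _ (phi_isNC L' (l + 1)) x
        have h1 := congrFun e x
        simp only [phi, ← hL] at h1 a2
        by_cases c : x < l + 1 ∨ l + 1 + 2 * L.numNodes ≤ x
        · rw [a1 c, a2 c]
        · rwa [if_neg (by omega), if_neg (by omega), if_pos (by omega), if_neg (by omega),
            if_neg (by omega), if_pos (by omega)] at h1
      have eR : R = R' := by
        refine ihR R' (l + 2 * L.numNodes + 2) hR ?_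
        funext x
        have a1 := @IsNC.out _ _ _ (phi_isNC R (l + 2 * L.numNodes + 2)) x
        have a2 := @IsNC.out _ _ _ (phi_isNC R' (l + 2 * L.numNodes + 2)) x
        have h1 := congrFun e x
        simp only [phi, ← hL, ← hR] at h1 a2
        by_cases c : x < l + 2 * L.numNodes + 2
        · rw [a1 (Or.inl c), a2 (Or.inl c)]
        · rwa [if_neg (by omega), if_neg (by omega), if_neg (by omega), if_neg (by omega),
            if_neg (by omega), if_neg (by omega)] at h1
      subst eL eR
      rfl

/-- An interval preserved by a fixed-point-free involution has even cardinality. -/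
lemma even_of_inv (f : ℕ → ℕ) (p q : ℕ) (hinv : ∀ x, f (f x) = x)
    (hm : ∀ x, p ≤ x → x < q → p ≤ f x ∧ f x < q ∧ f x ≠ x) : ((q - p : ℕ) : ZMod 2) = 0 := by
  have h : ∑ x ∈ Finset.Ico p q, (1 : ZMod 2) = 0 := by
    refine Finset.sum_involution (fun x _ => f x) ?_ ?_ ?_ ?_
    · intros; decide
    · intro x hx _
      rw [Finset.mem_Ico] at hx
      exact (hm x hx.1 hx.2).2.2
    · intro x hx
      rw [Finset.mem_Ico] at hx ⊢
      exact ⟨(hm x hx.1 hx.2).1, (hm x hx.1 hx.2).2.1⟩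
    · intro x _
      exact hinv x
  simpa using h

lemma phi_surj (n : ℕ) : ∀ (f : ℕ → ℕ) (l : ℕ), IsNC f l n →
    ∃ t : BinaryTree Unit, t.numNodes = n ∧ phi t l = f := by
  induction n using Nat.strong_induction_on with
  | _ n ih =>
    intro f l hf
    rcases Nat.eq_zero_or_pos n with rfl | hn
    · refine ⟨.nil, rfl, ?_⟩
      funext x
      exact (hf.out (by omega)).symm
    have hp := hf.mem (x := l) le_rfl (by omega)
    have hfp := hf.inv l
    obtain ⟨p, hpe⟩ : ∃ p, p = f l := ⟨_, rfl⟩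
    rw [← hpe] at hp hfp
    have hin : ∀ x, l < x → x < p → l < f x ∧ f x < p ∧ f x ≠ x := by
      intro x h1 h2
      have := hf.nc l x h1 (by omega)
      have := hf.mem (x := x) (by omega) (by omega)
      omega
    have hout : ∀ x, p < x → x < l + 2 * n → p < f x ∧ f x < l + 2 * n ∧ f x ≠ x := by
      intro x h1 h2
      have := hf.mem (x := x) (by omega) (by omega)
      have i := hf.inv x
      have := hin (f x)
      have c1 : f x ≠ l := by intro c; rw [c] at i; omega
      have c2 : f x ≠ p := by intro c; rw [c] at i; omega
      omega
    obtain ⟨m, hm⟩ : ∃ m, p = l + 1 + 2 * m := by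
      have := even_of_inv f (l + 1) p hf.inv (fun x h1 h2 => by have := hin x; omega)
      rw [ZMod.natCast_eq_zero_iff] at this
      obtain ⟨m, hm⟩ := this
      exact ⟨m, by omega⟩
    obtain ⟨L, hLn, hL⟩ := ih m (by omega) (fun x => if l < x ∧ x < p then f x else x) (l + 1) (by
      refine ⟨fun x => ?_, fun x => ?_, fun a b h1 h2 => ?_⟩
      · have := hin x
        have := hf.inv x
        split_ifs <;> omega
      · have := hin x
        split_ifs <;> omega
      · have := hf.nc a b
        have := hin a
        have := hin b
        split_ifs at h2 ⊢ <;> omega)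
    obtain ⟨R, hRn, hR⟩ := ih (n - m - 1) (by omega) (fun x => if p < x then f x else x)
      (l + 2 * m + 2) (by
      refine ⟨fun x => ?_, fun x => ?_, fun a b h1 h2 => ?_⟩
      · have := hout x
        have := hf.inv x
        have := @IsNC.out _ _ _ hf x
        split_ifs <;> omega
      · have := hout x
        have := @IsNC.out _ _ _ hf x
        split_ifs <;> omega
      · have := hf.nc a b
        have := hout a
        have := hout b
        split_ifs at h2 ⊢ <;> omega)
    refine ⟨.node () L R, ?_, ?_⟩
    · simp only [BinaryTree.numNodes]; omega
    · funext x
      simp only [phi, hLn, hL, hR]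
      have := @IsNC.out _ _ _ hf x
      split_ifs with h1 h2
      · rw [h1]; omega
      · rw [h2, ← hm]; omega
      all_goals first | rfl | omega

section Main

variable {n : ℕ} [NeZero n]

/-- The function on naturals attached to a permutation of `ZMod n`. -/
def natFun (n : ℕ) (σ : Equiv.Perm (ZMod n)) (x : ℕ) : ℕ :=
  if x < n then (σ (x : ZMod n)).val else x

lemma natFun_val (σ : Equiv.Perm (ZMod n)) (a : ZMod n) : natFun n σ a.val = (σ a).val := by
  simp [natFun, ZMod.val_lt]

lemma natFun_lt (σ : Equiv.Perm (ZMod n)) {x : ℕ} (hx : x < n) : natFun n σ x < n := by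
  simp [natFun, hx, ZMod.val_lt]

lemma natFun_cast (σ : Equiv.Perm (ZMod n)) {x : ℕ} (hx : x < n) :
    ((natFun n σ x : ℕ) : ZMod n) = σ x := by
  simp [natFun, hx]

lemma natFun_inv (σ : Pairing n) (x : ℕ) : natFun n σ.1 (natFun n σ.1 x) = x := by
  by_cases hx : x < n
  · have h := natFun_lt σ.1 hx
    have h2 := natFun_cast σ.1 hx
    conv_lhs => rw [natFun]
    rw [if_pos h, h2, σ.2.1, ZMod.val_natCast_of_lt hx]
  · simp [natFun, hx]

lemma natFun_ne (σ : Pairing n) {x : ℕ} (hx : x < n) : natFun n σ.1 x ≠ x := by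
  intro h
  have h2 := natFun_cast σ.1 hx
  rw [h] at h2
  exact σ.2.2 _ h2.symm

/-- noncrossing condition -/
def NCr (f : ℕ → ℕ) : Prop := ∀ a b, a < b → b < f a → a < f b ∧ f b < f a

lemma natFun_isNC {k : ℕ} [NeZero (2 * k)] (σ : Pairing (2 * k)) (h : NCr (natFun (2 * k) σ.1)) :
    IsNC (natFun (2 * k) σ.1) 0 k := by
  refine ⟨natFun_inv σ, fun x => ⟨fun hx => ?_, fun hx => natFun_ne σ (by omega)⟩, h⟩
  by_contra hc
  apply hx
  rw [natFun, if_neg (by omega)]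

/-- invariant functions modulo 2 -/
abbrev SymF (σ : Pairing n) : Type := {g : ZMod n → ZMod 2 // ∀ a, g (σ.1 a) = g a}

/-- openers of the pairing -/
abbrev Op (σ : Pairing n) : Type := {a : ZMod n // a.val < (σ.1 a).val}

lemma not_op (σ : Pairing n) (a : ZMod n) (h : ¬ a.val < (σ.1 a).val) :
    (σ.1 a).val < (σ.1 (σ.1 a)).val := by
  rw [σ.2.1]
  have : (σ.1 a).val ≠ a.val := fun h => σ.2.2 a (ZMod.val_injective n h)
  omega

lemma card_op (σ : Pairing n) : 2 * Nat.card (Op σ) = n := by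
  have e : Op σ ≃ {a : ZMod n // ¬ a.val < (σ.1 a).val} :=
    { toFun := fun a => ⟨σ.1 a.1, by rw [σ.2.1]; have := a.2; omega⟩
      invFun := fun a => ⟨σ.1 a.1, not_op σ a.1 a.2⟩
      left_inv := fun a => Subtype.ext (σ.2.1 _)
      right_inv := fun a => Subtype.ext (σ.2.1 _) }
  have h1 := Nat.card_congr e
  have h2 := Nat.card_congr (Equiv.sumCompl (fun a : ZMod n => a.val < (σ.1 a).val))
  rw [Nat.card_sum, ← h1, Nat.card_zmod] at h2
  change Nat.card (Op σ) + Nat.card (Op σ) = n at h2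
  omega

lemma card_symF (σ : Pairing n) : Nat.card (SymF σ) = 2 ^ Nat.card (Op σ) := by
  have e : SymF σ ≃ (Op σ → ZMod 2) :=
    { toFun := fun g a => g.1 a.1
      invFun := fun u => ⟨fun a => if h : a.val < (σ.1 a).val then u ⟨a, h⟩
          else u ⟨σ.1 a, not_op σ a h⟩, by
        intro a
        have h1 := not_op σ a
        by_cases h : a.val < (σ.1 a).val
        · have h2 : ¬ (σ.1 a).val < (σ.1 (σ.1 a)).val := by rw [σ.2.1]; omega
          simp only [h, h2, dif_pos, dif_neg, not_false_eq_true]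
          congr 1
          exact Subtype.ext (σ.2.1 a)
        · simp only [h, h1 h, dif_pos, dif_neg, not_false_eq_true]⟩
      left_inv := by
        intro g
        apply Subtype.ext
        funext a
        dsimp only
        split_ifs
        · rfl
        · exact g.2 a
      right_inv := by
        intro u
        funext a
        simp [a.2] }
  rw [Nat.card_congr e, Nat.card_fun, Nat.card_zmod]

/-- The relation defining the vertices. -/
abbrev rel (σ : Pairing n) : ZMod n → ZMod n → Prop := fun a b => b = σ.1 a + 1

lemma rel_eq (σ : Pairing n) (h : Quot (rel σ) → ZMod 2) (a : ZMod n) :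
    h (Quot.mk _ (σ.1 a + 1)) = h (Quot.mk _ a) :=
  congrArg h (Quot.sound (r := rel σ) (a := a) (b := σ.1 a + 1) rfl).symm

/-- discrete derivative -/
def tmap (σ : Pairing n) (h : Quot (rel σ) → ZMod 2) : ZMod 2 × SymF σ :=
  (h (Quot.mk _ 0), ⟨fun a => h (Quot.mk _ (a + 1)) - h (Quot.mk _ a), by
    intro a
    have h1 := rel_eq σ h a
    have h2 := rel_eq σ h (σ.1 a)
    rw [σ.2.1] at h2
    dsimp only
    rw [h1, h2, CharTwo.sub_eq_add, CharTwo.sub_eq_add, add_comm]⟩)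

lemma tmap_sum (σ : Pairing n) (h : Quot (rel σ) → ZMod 2) (m : ℕ) :
    h (Quot.mk _ (m : ZMod n)) =
      (tmap σ h).1 + ∑ i ∈ Finset.range m, (tmap σ h).2.1 (i : ZMod n) := by
  induction m with
  | zero => simp [tmap]
  | succ m ih =>
    rw [Finset.sum_range_succ, ← add_assoc, ← ih]
    simp [tmap]

lemma tmap_inj (σ : Pairing n) : Function.Injective (tmap σ) := by
  intro h h' e
  funext q
  induction q using Quot.ind with
  | mk a =>
    have h1 := tmap_sum σ h a.val
    have h2 := tmap_sum σ h' a.val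
    rw [e, ← h2] at h1
    simpa using h1

lemma vfun_iff_surj {k : ℕ} [NeZero (2 * k)] (σ : Pairing (2 * k)) :
    vfun (2 * k) σ.1 = k + 1 ↔ Function.Surjective (tmap σ) := by
  have c1 : Nat.card (Quot (rel σ) → ZMod 2) = 2 ^ vfun (2 * k) σ.1 := by
    rw [Nat.card_fun, Nat.card_zmod]; rfl
  have c2 : Nat.card (ZMod 2 × SymF σ) = 2 ^ (k + 1) := by
    have := card_op σ
    rw [Nat.card_prod, Nat.card_zmod, card_symF, show Nat.card (Op σ) = k by omega, pow_succ']
  constructor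
  · intro h
    exact ((Nat.bijective_iff_injective_and_card _).2 ⟨tmap_inj σ, by rw [c1, c2, h]⟩).2
  · intro h
    have := Nat.card_eq_of_bijective _ ⟨tmap_inj σ, h⟩
    rw [c1, c2] at this
    exact Nat.pow_right_injective le_rfl this

lemma nc_of_surj (σ : Pairing n) (hs : Function.Surjective (tmap σ)) : NCr (natFun n σ.1) := by
  intro a b hab hb
  obtain ⟨f, hf⟩ : ∃ f, f = natFun n σ.1 := ⟨_, rfl⟩
  have ha : a < n := by
    by_contra hc
    rw [natFun, if_neg hc] at hb
    omega
  have hfa := natFun_lt σ.1 ha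
  have hbn : b < n := by omega
  have hfb := natFun_lt σ.1 hbn
  by_contra hcon
  obtain ⟨h, hh⟩ := hs (0, ⟨fun x => if x = (b : ZMod n) ∨ x = σ.1 b then 1 else 0, by
    intro x
    have e1 : σ.1 x = (b : ZMod n) ↔ x = σ.1 b := by
      constructor
      · intro e; rw [← e, σ.2.1]
      · intro e; rw [e, σ.2.1]
    have e2 : σ.1 x = σ.1 b ↔ x = (b : ZMod n) := σ.1.injective.eq_iff
    simp only [e1, e2, or_comm]⟩)
  have h1 := tmap_sum σ h a
  have h2 := tmap_sum σ h (natFun n σ.1 a + 1)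
  have h3 := rel_eq σ h (a : ZMod n)
  rw [Nat.cast_add, natFun_cast σ.1 ha, Nat.cast_one, h3, h1] at h2
  have h4 := add_left_cancel h2
  rw [← Finset.sum_range_add_sum_Ico _ (show a ≤ natFun n σ.1 a + 1 by omega)] at h4
  have h5 := left_eq_add.1 h4
  have inj : ∀ x y : ℕ, x < n → y < n → (x : ZMod n) = y → x = y := by
    intro x y hx hy e
    rw [← ZMod.val_natCast_of_lt hx, ← ZMod.val_natCast_of_lt hy, e]
  rw [Finset.sum_eq_single b, hh] at h5
  · simp at h5
  · intro i hi hib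
    rw [hh]
    rw [Finset.mem_Ico] at hi
    have hne := natFun_ne σ hbn
    have i0 := natFun_inv σ a
    have i1 := natFun_inv σ b
    dsimp only
    rw [if_neg]
    rintro (e | e)
    · exact hib (inj _ _ (by omega) hbn e)
    · rw [← natFun_cast σ.1 hbn] at e
      have := inj _ _ (by omega) hfb e
      have n1 : natFun n σ.1 b ≠ a := by intro c; rw [c] at i1; omega
      have n2 : natFun n σ.1 b ≠ natFun n σ.1 a := by
        intro c; rw [c] at i1; omega
      omega
  · intro hc
    rw [Finset.mem_Ico] at hc
    omega

lemma sum_zero (σ : Pairing n) (g : SymF σ) (p q : ℕ) (hq : q ≤ n)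
    (hm : ∀ x, p ≤ x → x < q → p ≤ natFun n σ.1 x ∧ natFun n σ.1 x < q) :
    ∑ i ∈ Finset.Ico p q, g.1 (i : ZMod n) = 0 := by
  refine Finset.sum_involution (fun x _ => natFun n σ.1 x) ?_ ?_ ?_ ?_
  · intro x hx
    rw [Finset.mem_Ico] at hx
    rw [natFun_cast σ.1 (by omega), g.2]
    exact CharTwo.add_self_eq_zero _
  · intro x hx _
    rw [Finset.mem_Ico] at hx
    exact natFun_ne σ (by omega)
  · intro x hx
    rw [Finset.mem_Ico] at hx ⊢
    exact hm x hx.1 hx.2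
  · intro x _
    exact natFun_inv σ x

lemma surj_of_nc (σ : Pairing n) (hnc : NCr (natFun n σ.1)) : Function.Surjective (tmap σ) := by
  rintro ⟨c, g⟩
  obtain ⟨F, hF⟩ : ∃ F : ZMod n → ZMod 2,
    F = fun a => c + ∑ i ∈ Finset.range a.val, g.1 (i : ZMod n) := ⟨_, rfl⟩
  have hstep : ∀ a : ZMod n, F (a + 1) = c + ∑ i ∈ Finset.range (a.val + 1), g.1 (i : ZMod n) := by
    intro a
    have hv := ZMod.val_lt a
    rw [hF]
    dsimp only
    by_cases h : a.val + 1 < n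
    · have : (a + 1).val = a.val + 1 := by
        have e : a + 1 = ((a.val + 1 : ℕ) : ZMod n) := by simp
        rw [e, ZMod.val_natCast_of_lt h]
      rw [this]
    · have e1 : a.val + 1 = n := by omega
      have e : a + 1 = 0 := by
        have e : a + 1 = ((a.val + 1 : ℕ) : ZMod n) := by simp
        rw [e, e1, ZMod.natCast_self]
      have := sum_zero σ g 0 n le_rfl (fun x _ hx => ⟨Nat.zero_le _, natFun_lt σ.1 hx⟩)
      rw [← Finset.range_eq_Ico] at this
      rw [e, e1, this]
      simp
  have hrel : ∀ a b, rel σ a b → F a = F b := by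
    rintro a b rfl
    rw [hstep, hF]
    dsimp only
    congr 1
    have hv := ZMod.val_lt a
    have hv2 := ZMod.val_lt (σ.1 a)
    have hne : (σ.1 a).val ≠ a.val := fun h => σ.2.2 a (ZMod.val_injective n h)
    have f1 := natFun_val σ.1 a
    have f2 := natFun_inv σ a.val
    rw [f1] at f2
    rcases Nat.lt_or_gt_of_ne hne with h | h
    · rw [← Finset.sum_range_add_sum_Ico _ (show (σ.1 a).val + 1 ≤ a.val by omega),
        sum_zero σ g _ _ (by omega), add_zero]
      intro x h1 h2
      have := hnc (σ.1 a).val x (by omega) (by omega)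
      omega
    · rw [← Finset.sum_range_add_sum_Ico _ (show a.val ≤ (σ.1 a).val + 1 by omega),
        sum_zero σ g _ _ (by omega), add_zero]
      intro x h1 h2
      by_cases c1 : x = a.val
      · rw [c1]; omega
      by_cases c2 : x = (σ.1 a).val
      · rw [c2]; omega
      have := hnc a.val x (by omega) (by omega)
      omega
  refine ⟨Quot.lift F hrel, ?_⟩
  refine Prod.ext ?_ (Subtype.ext ?_)
  · simp [tmap, hF]
  · funext a
    change F (a + 1) - F a = g.1 a
    rw [hstep, Finset.sum_range_succ, hF]
    simp

lemma vfun_iff_nc {k : ℕ} [NeZero (2 * k)] (σ : Pairing (2 * k)) :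
    vfun (2 * k) σ.1 = k + 1 ↔ NCr (natFun (2 * k) σ.1) :=
  (vfun_iff_surj σ).trans ⟨nc_of_surj σ, surj_of_nc σ⟩

/-- From a noncrossing involution of the naturals to a pairing. -/
lemma exists_pairing {k : ℕ} [NeZero (2 * k)] (f : ℕ → ℕ) (hf : IsNC f 0 k) :
    ∃ σ : Pairing (2 * k), natFun (2 * k) σ.1 = f := by
  have hlt : ∀ a : ZMod (2 * k), f a.val < 2 * k := by
    intro a
    have := ZMod.val_lt a
    have := hf.mem (x := a.val) (by omega) (by omega)
    omega
  have hinv : Function.Involutive (fun a : ZMod (2 * k) => ((f a.val : ℕ) : ZMod (2 * k))) := by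
    intro a
    dsimp only
    rw [ZMod.val_natCast_of_lt (hlt a), hf.inv]
    simp
  refine ⟨⟨hinv.toPerm _, hinv, ?_⟩, ?_⟩
  · intro a h
    have h1 : ((f a.val : ℕ) : ZMod (2 * k)) = a := h
    have h2 := ZMod.val_natCast_of_lt (hlt a)
    rw [h1] at h2
    have := ZMod.val_lt a
    have := hf.mem (x := a.val) (by omega) (by omega)
    omega
  · funext x
    by_cases hx : x < 2 * k
    · rw [natFun, if_pos hx]
      have h2 := hlt (x : ZMod (2 * k))
      rw [ZMod.val_natCast_of_lt hx] at h2
      change ((f (x : ZMod (2 * k)).val : ℕ) : ZMod (2 * k)).val = f x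
      rw [ZMod.val_natCast_of_lt hx, ZMod.val_natCast_of_lt h2]
    · rw [natFun, if_neg hx, hf.out (by omega)]

lemma natFun_inj (σ τ : Pairing n) (h : natFun n σ.1 = natFun n τ.1) : σ = τ := by
  apply Subtype.ext
  ext a
  have h1 := natFun_val σ.1 a
  rw [h, natFun_val] at h1
  exact (ZMod.val_injective n h1).symm

end Main

/-- the number of pairings `σ ∈ P(2k)` with `v(σ) = k + 1` is the `k`-th
Catalan number. -/
theorem card_noncrossing_pairings (k : ℕ) (hk : 1 ≤ k) :
    Nat.card {σ : Pairing (2 * k) // vfun (2 * k) σ.1 = k + 1} = catalan k := by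
  have : NeZero (2 * k) := ⟨by omega⟩
  have hex : ∀ s : {σ : Pairing (2 * k) // vfun (2 * k) σ.1 = k + 1},
      ∃ t : BinaryTree Unit, t.numNodes = k ∧ phi t 0 = natFun (2 * k) s.1.1 := fun s =>
    phi_surj k _ 0 (natFun_isNC s.1 ((vfun_iff_nc s.1).1 s.2))
  choose T hT1 hT2 using hex
  have hcard : Nat.card {t // t ∈ BinaryTree.treesOfNumNodesEq k} = catalan k := by
    rw [← BinaryTree.treesOfNumNodesEq_card_eq_catalan, Nat.card_eq_fintype_card,
      Fintype.card_coe]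
  rw [← hcard]
  refine Nat.card_eq_of_bijective
    (fun s => ⟨T s, BinaryTree.mem_treesOfNumNodesEq.2 (hT1 s)⟩) ⟨?_, ?_⟩
  · intro s s' h
    have h1 : T s = T s' := congrArg Subtype.val h
    have h2 := hT2 s
    rw [h1, hT2 s'] at h2
    exact Subtype.ext (natFun_inj _ _ h2.symm)
  · rintro ⟨t, ht⟩
    rw [BinaryTree.mem_treesOfNumNodesEq] at ht
    have hnc := phi_isNC t 0
    rw [ht] at hnc
    obtain ⟨σ, hσ⟩ := exists_pairing _ hnc
    refine ⟨⟨σ, (vfun_iff_nc σ).2 (by rw [hσ]; exact hnc.nc)⟩, Subtype.ext ?_⟩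
    refine phi_inj _ _ 0 ((hT1 _).trans ht.symm) ?_
    rw [hT2, hσ]
end

section
/- For every integer m ≥ 1 and every x ∈ ℝ, the function t ↦ φ_m(t) e^{−i t x} is integrable over ℝ and (1/(2π)) · ∫_ℝ φ_m(t) · e^{−i t x} dt = f_m(x). -/
open MeasureTheory Filter

/-- The characteristic function `φ_m` of the limiting spectral measure of the symmetric
`m`-block circulant ensemble. -/
noncomputable def phiFn (m : ℕ) (t : ℝ) : ℝ :=
  (1 / (m : ℝ)) * Real.exp (-(t ^ 2) / (2 * m)) *
    ∑ l ∈ Finset.Icc 1 m,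
      (Nat.choose m l : ℝ) * (1 / (Nat.factorial (l - 1) : ℝ)) * (-(t ^ 2) / m) ^ (l - 1)

/-- The limiting spectral density `f_m` of the symmetric `m`-block circulant ensemble. -/
noncomputable def fmFn (m : ℕ) (x : ℝ) : ℝ :=
  (Real.exp (-((m : ℝ) * x ^ 2) / 2) / Real.sqrt (2 * Real.pi * m)) *
    ∑ r ∈ Finset.range m,
      (1 / (Nat.factorial (2 * r) : ℝ)) *
        (∑ s ∈ Finset.range (m - r + 1),
          (Nat.choose m (r + s + 1) : ℝ) *
            ((Nat.factorial (2 * r + 2 * s) : ℝ) /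
              ((Nat.factorial (r + s) : ℝ) * (Nat.factorial s : ℝ))) *
            (-(1 : ℝ) / 2) ^ s) *
        ((m : ℝ) * x ^ 2) ^ r


open Polynomial in
lemma derivative_hermite_succ (n : ℕ) :
    derivative (hermite (n + 1)) = ((n : ℤ[X]) + 1) * hermite n := by
  induction n with
  | zero => simp
  | succ n ih =>
    rw [hermite_succ (n + 1), derivative_sub, derivative_mul, ih, derivative_X, hermite_succ n]
    simp only [derivative_mul, derivative_add, derivative_natCast, derivative_one]
    push_cast
    ring

/-- Real values of the probabilist Hermite polynomials. -/
noncomputable def hermVal (n : ℕ) (y : ℝ) : ℝ := Polynomial.aeval y (Polynomial.hermite n)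

lemma hermVal_zero (y : ℝ) : hermVal 0 y = 1 := by simp [hermVal]

lemma hermVal_one (y : ℝ) : hermVal 1 y = y := by simp [hermVal]

lemma hermVal_succ_succ (n : ℕ) (y : ℝ) :
    hermVal (n + 2) y = y * hermVal (n + 1) y - (n + 1) * hermVal n y := by
  unfold hermVal
  rw [Polynomial.hermite_succ (n + 1), derivative_hermite_succ]
  simp

lemma sum_range_even (f : ℕ → ℝ) (hf : ∀ r, f (2 * r + 1) = 0) (k : ℕ) :
    ∑ i ∈ Finset.range (2 * k + 1), f i = ∑ r ∈ Finset.range (k + 1), f (2 * r) := by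
  induction k with
  | zero => simp
  | succ k ih =>
    rw [Finset.sum_range_succ _ (k + 1), ← ih, show 2 * (k + 1) + 1 = 2 * k + 1 + 1 + 1 by ring,
      Finset.sum_range_succ, Finset.sum_range_succ, hf]
    simp [mul_add]

lemma coeff_real (s r : ℕ) :
    ((Polynomial.hermite (2 * s + 2 * r)).coeff (2 * r) : ℝ) =
      (Nat.factorial (2 * r + 2 * s) : ℝ) / (Nat.factorial (2 * r) * Nat.factorial s) *
        (-(1 : ℝ) / 2) ^ s := by
  rw [Polynomial.coeff_hermite_explicit]
  have h1 : (Nat.doubleFactorial (2 * s - 1) : ℝ) * (2 ^ s * Nat.factorial s)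
      = Nat.factorial (2 * s) := by
    rcases s with _ | s
    · simp
    · have := Nat.factorial_eq_mul_doubleFactorial (2 * s + 1)
      have h2 := Nat.doubleFactorial_two_mul (s + 1)
      rw [show 2 * (s + 1) = 2 * s + 1 + 1 by ring] at h2 ⊢
      rw [h2] at this
      rw [this]
      push_cast
      ring
  have h3 : (Nat.choose (2 * s + 2 * r) (2 * r) : ℝ) * Nat.factorial (2 * r)
      * Nat.factorial (2 * s) = Nat.factorial (2 * r + 2 * s) := by
    have := Nat.choose_mul_factorial_mul_factorial (n := 2 * s + 2 * r) (k := 2 * r) (by omega)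
    rw [Nat.add_sub_cancel] at this
    rw [add_comm (2 * r) (2 * s)]
    exact_mod_cast this
  have p1 : (Nat.factorial (2 * r) : ℝ) ≠ 0 := by positivity
  have p2 : (Nat.factorial s : ℝ) ≠ 0 := by positivity
  have h4 : (-(1 : ℝ) / 2) ^ s = (-1) ^ s / 2 ^ s := by rw [div_pow]
  rw [h4, ← h3, ← h1]
  push_cast
  field_simp

lemma hermVal_even (k : ℕ) (y : ℝ) :
    hermVal (2 * k) y = ∑ r ∈ Finset.range (k + 1),
      (Nat.factorial (2 * r + 2 * (k - r)) : ℝ) /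
        (Nat.factorial (2 * r) * Nat.factorial (k - r)) *
        (-(1 : ℝ) / 2) ^ (k - r) * (y ^ 2) ^ r := by
  unfold hermVal
  rw [Polynomial.aeval_eq_sum_range, Polynomial.natDegree_hermite, sum_range_even]
  · refine Finset.sum_congr rfl fun r hr => ?_
    have hr' : r ≤ k := by simpa [Nat.lt_succ_iff] using hr
    rw [← coeff_real, show 2 * (k - r) + 2 * r = 2 * k by omega, ← pow_mul]
    simp
  · intro r
    rw [Polynomial.coeff_hermite_of_odd_add ⟨k + r, by ring⟩]
    simp

/-- The basic integrand. -/
noncomputable def gK (b x : ℝ) (n : ℕ) (t : ℝ) : ℂ :=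
  (t : ℂ) ^ n * (Complex.exp (Complex.I * (-x : ℂ) * t) * Complex.exp (-(b : ℂ) * (t : ℂ) ^ 2))

lemma gK_integrable (b x : ℝ) (hb : 0 < b) (n : ℕ) : Integrable (gK b x n) := by
  have h := integrable_rpow_mul_exp_neg_mul_sq hb (s := n)
    (by have : (0 : ℝ) ≤ n := by positivity
        linarith)
  simp only [Real.rpow_natCast] at h
  have h2 := Integrable.bdd_mul (c := 1) (f := fun t : ℝ => Complex.exp (Complex.I * (-x : ℂ) * t))
    h.ofReal (by fun_prop) (Eventually.of_forall fun t => by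
      simp [Complex.norm_exp])
  refine h2.congr (Eventually.of_forall fun t => ?_)
  simp only [gK]
  push_cast
  simp
  ring

lemma gK_hasDerivAt (b x : ℝ) (n : ℕ) (t : ℝ) :
    HasDerivAt (gK b x n)
      (n * gK b x (n - 1) t + (-(Complex.I * x)) * gK b x n t + (-(2 * b)) * gK b x (n + 1) t)
      t := by
  have h0 : HasDerivAt (fun t : ℝ => (t : ℂ)) 1 t := Complex.ofRealCLM.hasDerivAt
  have h1 := h0.pow n
  have h2 := (h0.const_mul (Complex.I * (-x : ℂ))).cexp
  have h3 := ((h0.pow 2).const_mul (-(b : ℂ))).cexp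
  refine (h1.mul (h2.mul h3)).congr_deriv ?_
  simp only [gK, Pi.mul_apply, Pi.pow_apply, pow_succ]
  push_cast
  ring

lemma gK_rec (b x : ℝ) (hb : 0 < b) (n : ℕ) :
    n * (∫ t, gK b x (n - 1) t) + (-(Complex.I * x)) * (∫ t, gK b x n t)
      + (-(2 * b)) * (∫ t, gK b x (n + 1) t) = 0 := by
  have i1 := (gK_integrable b x hb (n - 1)).const_mul (n : ℂ)
  have i2 := (gK_integrable b x hb n).const_mul (-(Complex.I * x))
  have i3 := (gK_integrable b x hb (n + 1)).const_mul (-(2 * b) : ℂ)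
  have := integral_eq_zero_of_hasDerivAt_of_integrable (gK_hasDerivAt b x n)
    ((i1.add i2).add i3) (gK_integrable b x hb n)
  have i12 : Integrable (fun t => (n : ℂ) * gK b x (n - 1) t + (-(Complex.I * x)) * gK b x n t) :=
    i1.add i2
  rw [integral_add i12 i3, integral_add i1 i2] at this
  simpa only [integral_const_mul] using this

lemma gK_integral (q x : ℝ) (hq : 0 < q) (n : ℕ) :
    ∫ t, gK (1 / (2 * q ^ 2)) x n t =
      (q * -Complex.I) ^ n * (hermVal n (q * x) : ℂ) * ∫ t, gK (1 / (2 * q ^ 2)) x 0 t := by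
  have hq' : (q : ℂ) ≠ 0 := by exact_mod_cast hq.ne'
  have hb : 0 < 1 / (2 * q ^ 2) := by positivity
  have key : ∀ n : ℕ, ∫ t, gK (1 / (2 * q ^ 2)) x (n + 1) t =
      q ^ 2 * (n * (∫ t, gK (1 / (2 * q ^ 2)) x (n - 1) t)
        - Complex.I * x * ∫ t, gK (1 / (2 * q ^ 2)) x n t) := by
    intro n
    have h := gK_rec _ x hb n
    generalize (∫ t, gK (1 / (2 * q ^ 2)) x (n + 1) t) = A at *
    generalize (∫ t, gK (1 / (2 * q ^ 2)) x n t) = B at *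
    generalize (∫ t, gK (1 / (2 * q ^ 2)) x (n - 1) t) = C at *
    push_cast at h
    field_simp at h
    linear_combination -h
  induction n using Nat.twoStepInduction with
  | zero => simp [hermVal_zero]
  | one =>
    rw [key 0, hermVal_one]
    push_cast
    ring
  | more n ih0 ih1 =>
    rw [key (n + 1), Nat.add_sub_cancel, ih0, ih1, hermVal_succ_succ]
    push_cast
    simp only [pow_succ, mul_neg]
    linear_combination (norm := skip) (0 : ℂ) * Complex.I_sq
    ring_nf
    simp only [Complex.I_sq]
    ring_nf

lemma gK_zero (q x : ℝ) (hq : 0 < q) :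
    ∫ t, gK (1 / (2 * q ^ 2)) x 0 t =
      ((Real.sqrt (2 * Real.pi) * q * Real.exp (-(q ^ 2 * x ^ 2) / 2) : ℝ) : ℂ) := by
  have hb : 0 < 1 / (2 * q ^ 2) := by positivity
  have h := fourierIntegral_gaussian (b := ((1 / (2 * q ^ 2) : ℝ) : ℂ)) (by rw [Complex.ofReal_re]; exact hb) (-x : ℂ)
  simp only [gK, pow_zero, one_mul]
  rw [h]
  have e1 : ((Real.pi : ℂ) / ((1 / (2 * q ^ 2) : ℝ) : ℂ)) ^ (1 / 2 : ℂ)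
      = ((Real.sqrt (2 * Real.pi) * q : ℝ) : ℂ) := by
    rw [show (1 / 2 : ℂ) = ((1 / 2 : ℝ) : ℂ) by norm_num, ← Complex.ofReal_div,
      ← Complex.ofReal_cpow (by positivity), ← Real.sqrt_eq_rpow]
    congr 1
    rw [show Real.pi / (1 / (2 * q ^ 2)) = (2 * Real.pi) * q ^ 2 by field_simp,
      Real.sqrt_mul (by positivity), Real.sqrt_sq hq.le]
  rw [e1, Complex.ofReal_mul _ (Real.exp _), Complex.ofReal_exp]
  congr 2
  have hq' : (q : ℂ) ≠ 0 := by exact_mod_cast hq.ne'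
  push_cast
  field_simp
  ring

lemma fm_eq (m : ℕ) (q x : ℝ) (hq : 0 < q) (hqm : q ^ 2 = m) :
    fmFn m x = (Real.exp (-(q ^ 2 * x ^ 2) / 2) / (Real.sqrt (2 * Real.pi) * q)) *
      ∑ k ∈ Finset.range m, (Nat.choose m (k + 1) : ℝ) * (1 / (Nat.factorial k : ℝ)) *
        hermVal (2 * k) (q * x) := by
  unfold fmFn
  rw [← hqm, Real.sqrt_mul (by positivity), Real.sqrt_sq hq.le]
  congr 1
  have := Finset.sum_range_diag_flip m (fun r s => (Nat.choose m (r + s + 1) : ℝ) *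
    (1 / (Nat.factorial (r + s) : ℝ)) * ((Nat.factorial (2 * r + 2 * s) : ℝ) /
        (Nat.factorial (2 * r) * Nat.factorial s) *
        (-(1 : ℝ) / 2) ^ s * ((q * x) ^ 2) ^ r))
  trans
  swap
  · refine Eq.trans this.symm (Finset.sum_congr rfl fun k hk => ?_)
    rw [hermVal_even, Finset.mul_sum]
    refine Finset.sum_congr rfl fun r hr => ?_
    have hr' : r + (k - r) = k := by
      have := Finset.mem_range.1 hr
      omega
    rw [hr']
  · refine Finset.sum_congr rfl fun r hr => ?_
    have hr' := Finset.mem_range.1 hr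
    rw [Finset.sum_range_succ, show r + (m - r) + 1 = m + 1 by omega, Nat.choose_succ_self]
    simp only [Nat.cast_zero, zero_mul, add_zero, Finset.mul_sum, Finset.sum_mul]
    refine Finset.sum_congr rfl fun s hs => ?_
    rw [mul_pow q x 2]
    field_simp

lemma phi_eq (m : ℕ) (q x : ℝ) (hq : 0 < q) (hqm : q ^ 2 = m) (t : ℝ) :
    (phiFn m t : ℂ) * Complex.exp (-(Complex.I * (t : ℂ) * (x : ℂ))) =
      ∑ k ∈ Finset.range m, ((1 / (q : ℂ) ^ 2) * ((Nat.choose m (k + 1) : ℂ) *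
        (1 / (Nat.factorial k : ℂ))) * (-1 / (q : ℂ) ^ 2) ^ k) *
          gK (1 / (2 * q ^ 2)) x (2 * k) t := by
  have hI : Finset.Icc 1 m = Finset.Ico 1 (m + 1) := by ext; simp [Nat.lt_succ_iff]
  unfold phiFn
  rw [hI, Finset.sum_Ico_eq_sum_range, ← hqm]
  push_cast
  rw [Finset.mul_sum, Finset.sum_mul]
  refine Finset.sum_congr rfl fun k _ => ?_
  have e1 : Complex.exp (-(Complex.I * (t : ℂ) * (x : ℂ))) = Complex.exp (Complex.I * (-x : ℂ) * t) := by
    congr 1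
    ring
  have e2 : Complex.exp (-(t : ℂ) ^ 2 / (2 * (q : ℂ) ^ 2))
      = Complex.exp (-((1 / (2 * q ^ 2) : ℝ) : ℂ) * (t : ℂ) ^ 2) := by
    congr 1
    push_cast
    ring
  have e3 : (-(t : ℂ) ^ 2 / (q : ℂ) ^ 2) ^ k = (-1 / (q : ℂ) ^ 2) ^ k * (t : ℂ) ^ (2 * k) := by
    rw [pow_mul, ← mul_pow]
    congr 1
    ring
  rw [e1, e2, add_comm 1 k, Nat.add_sub_cancel, e3]
  simp only [gK]
  ring

/-- `t ↦ φ_m(t) e^{-itx}` is integrable, and its normalized integral (the Fourier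
transform of the characteristic function) recovers the density `f_m`. -/
theorem fourier_inversion_phi_eq_fm (m : ℕ) (hm : 1 ≤ m) (x : ℝ) :
    MeasureTheory.Integrable
      (fun t : ℝ => (phiFn m t : ℂ) * Complex.exp (-(Complex.I * (t : ℂ) * (x : ℂ)))) ∧
    (1 / (2 * (Real.pi : ℂ))) *
        ∫ t : ℝ, (phiFn m t : ℂ) * Complex.exp (-(Complex.I * (t : ℂ) * (x : ℂ))) =
      (fmFn m x : ℂ) := by
  have hm0 : (0 : ℝ) < m := by exact_mod_cast hm
  obtain ⟨q, hq, hqm⟩ : ∃ q : ℝ, 0 < q ∧ q ^ 2 = m :=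
    ⟨Real.sqrt m, Real.sqrt_pos.2 hm0, Real.sq_sqrt hm0.le⟩
  have hb : 0 < 1 / (2 * q ^ 2) := by positivity
  have hq' : (q : ℂ) ≠ 0 := by exact_mod_cast hq.ne'
  simp only [phi_eq m q x hq hqm]
  refine ⟨integrable_finsetSum _ fun k _ => (gK_integrable _ x hb _).const_mul _, ?_⟩
  rw [integral_finsetSum _ fun k _ => (gK_integrable _ x hb _).const_mul _,
    fm_eq m q x hq hqm, Finset.mul_sum, Finset.mul_sum, Complex.ofReal_sum]
  refine Finset.sum_congr rfl fun k _ => ?_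
  rw [integral_const_mul, gK_integral q x hq, gK_zero q x hq]
  have hs : ((Real.sqrt (2 * Real.pi) : ℝ) : ℂ) ^ 2 = 2 * Real.pi := by
    rw [← Complex.ofReal_pow, Real.sq_sqrt (by positivity)]
    push_cast
    rfl
  have hs0 : ((Real.sqrt (2 * Real.pi) : ℝ) : ℂ) ≠ 0 := by
    have : Real.sqrt (2 * Real.pi) ≠ 0 := by positivity
    exact_mod_cast this
  have e : (-1 / (q : ℂ) ^ 2) ^ k * (q * -Complex.I) ^ (2 * k) = 1 := by
    rw [pow_mul, ← mul_pow, mul_pow (q : ℂ), neg_sq, Complex.I_sq]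
    rw [show -1 / (q : ℂ) ^ 2 * ((q : ℂ) ^ 2 * -1) = 1 by field_simp]
    simp
  have hk : (Nat.factorial k : ℂ) ≠ 0 := by exact_mod_cast Nat.factorial_ne_zero k
  rw [← hs]
  simp only [Complex.ofReal_mul, Complex.ofReal_div, Complex.ofReal_natCast, Complex.ofReal_one]
  generalize ((Real.sqrt (2 * Real.pi) : ℝ) : ℂ) = S at *
  generalize ((Real.exp (-(q ^ 2 * x ^ 2) / 2) : ℝ) : ℂ) = E at *
  generalize (hermVal (2 * k) (q * x) : ℂ) = H at *
  generalize (-1 / (q : ℂ) ^ 2) ^ k = U at *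
  generalize ((q : ℂ) * -Complex.I) ^ (2 * k) = V at *
  trans (U * V) * (E / (S * q) * (((Nat.choose m (k + 1)) : ℂ) * (1 / (Nat.factorial k : ℂ)) * H))
  · field_simp
  · rw [e, one_mul]
end

section
/- For every integer m ≥ 1, the function φ_m is infinitely differentiable on ℝ, satisfies φ_m(0) = 1, and for every t ∈ ℝ satisfies the differential equation t · φ_m''(t) + 3 · φ_m'(t) + t · (4 − t²/m²) · φ_m(t) = 0. -/
open Filter

open Polynomial in
/-- The polynomial part of `φ_m`, in the variable `x = -t²/m`. -/
noncomputable def lagPoly (m : ℕ) : Polynomial ℝ :=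
  ∑ k ∈ Finset.range m, C ((Nat.choose m (k + 1) : ℝ) / (Nat.factorial k : ℝ)) * X ^ k

lemma lagPoly_coeff (m n : ℕ) :
    (lagPoly m).coeff n = (Nat.choose m (n + 1) : ℝ) / (Nat.factorial n : ℝ) := by
  unfold lagPoly
  simp only [Polynomial.finsetSum_coeff, Polynomial.coeff_C_mul_X_pow]
  rw [Finset.sum_ite_eq]
  split_ifs with h
  · rfl
  · rw [Nat.choose_eq_zero_of_lt (by simp at h; omega)]
    simp

lemma lagPoly_rec (m n : ℕ) :
    (lagPoly m).coeff (n + 1) * (n + 1) * (n + 2) = ((m : ℝ) - 1 - n) * (lagPoly m).coeff n := by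
  rw [lagPoly_coeff, lagPoly_coeff, Nat.factorial_succ]
  have h : (Nat.choose m (n + 1 + 1) : ℝ) * (n + 2) = Nat.choose m (n + 1) * ((m : ℝ) - 1 - n) := by
    rcases Nat.lt_or_ge m (n + 1) with h | h
    · rw [Nat.choose_eq_zero_of_lt h, Nat.choose_eq_zero_of_lt (by omega)]
      simp
    · have := Nat.choose_succ_right_eq m (n + 1)
      have h2 : (Nat.choose m (n + 1 + 1) : ℝ) * ((n + 1 + 1 : ℕ) : ℝ)
          = Nat.choose m (n + 1) * ((m - (n + 1) : ℕ) : ℝ) := by exact_mod_cast this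
      rw [Nat.cast_sub h] at h2
      push_cast at h2
      linarith
  have hf : (Nat.factorial n : ℝ) ≠ 0 := by positivity
  have hn : (n : ℝ) + 1 ≠ 0 := by positivity
  push_cast
  field_simp
  linarith

open Polynomial in
lemma lagPoly_ode (m : ℕ) :
    X * derivative (derivative (lagPoly m)) + C 2 * derivative (lagPoly m)
      + X * derivative (lagPoly m) = C ((m : ℝ) - 1) * lagPoly m := by
  ext n
  rcases n with _ | n
  · have := lagPoly_rec m 0
    simp [coeff_derivative] at this ⊢
    linarith
  · have := lagPoly_rec m (n + 1)
    simp only [coeff_add, coeff_X_mul, coeff_C_mul, coeff_derivative]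
    push_cast at this ⊢
    linarith

lemma phiFn_eq (m : ℕ) (t : ℝ) : phiFn m t =
    (1 / (m : ℝ)) * Real.exp (-(t ^ 2) / (2 * m)) * (lagPoly m).eval (-(t ^ 2) / m) := by
  unfold phiFn lagPoly
  congr 1
  rw [Polynomial.eval_finsetSum]
  symm
  refine Finset.sum_bij (fun k _ => k + 1) ?_ ?_ ?_ ?_
  · intro a ha
    simp at ha ⊢
    omega
  · intro a _ b _ h
    omega
  · intro b hb
    simp at hb
    exact ⟨b - 1, by simp; omega, by omega⟩
  · intro a _
    simp [div_eq_mul_inv]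

lemma hasDerivAt_aux (m : ℕ) (hm : 1 ≤ m) (p : Polynomial ℝ) (t : ℝ) :
    HasDerivAt (fun t : ℝ => (1 / (m : ℝ)) * Real.exp (-(t ^ 2) / (2 * m)) *
        p.eval (-(t ^ 2) / m))
      ((-(2 * t) / m) * ((1 / (m : ℝ)) * Real.exp (-(t ^ 2) / (2 * m)) *
        (Polynomial.C (1 / 2) * p + Polynomial.derivative p).eval (-(t ^ 2) / m))) t := by
  have hm0 : (m : ℝ) ≠ 0 := by positivity
  have h0 : HasDerivAt (fun t : ℝ => -(t ^ 2)) (-(2 * t)) t := by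
    refine ((hasDerivAt_pow 2 t).neg).congr_deriv ?_
    simp
  have h1 := (h0.div_const (2 * (m : ℝ))).exp.const_mul (1 / (m : ℝ))
  have h2 := (p.hasDerivAt (-(t ^ 2) / m)).comp t (h0.div_const (m : ℝ))
  refine (h1.mul h2).congr_deriv ?_
  simp only [Polynomial.eval_add, Polynomial.eval_mul, Polynomial.eval_C, Function.comp]
  field_simp
  ring

/-- `φ_m` is smooth, `φ_m(0) = 1`, and `φ_m` satisfies the ODE
`t φ_m'' + 3 φ_m' + t (4 - t²/m²) φ_m = 0`. -/
theorem phi_smooth_ode (m : ℕ) (hm : 1 ≤ m) :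
    ContDiff ℝ (⊤ : ℕ∞) (phiFn m) ∧ phiFn m 0 = 1 ∧
    ∀ t : ℝ, t * deriv (deriv (phiFn m)) t + 3 * deriv (phiFn m) t +
      t * (4 - t ^ 2 / (m : ℝ) ^ 2) * phiFn m t = 0 := by
  have hm0 : (m : ℝ) ≠ 0 := by positivity
  have hfun : phiFn m = fun t : ℝ => (1 / (m : ℝ)) * Real.exp (-(t ^ 2) / (2 * m)) *
    (lagPoly m).eval (-(t ^ 2) / m) := funext (phiFn_eq m)
  refine ⟨?_, ?_, ?_⟩
  · unfold phiFn
    fun_prop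
  · rw [phiFn_eq]
    have := lagPoly_coeff m 0
    simp [Polynomial.coeff_zero_eq_eval_zero] at this
    simp [this, hm0]
  · intro t
    have hd1 := fun t => (hasDerivAt_aux m hm (lagPoly m) t).deriv
    have hd : deriv (phiFn m) = fun t => (-(2 * t) / (m : ℝ)) * ((1 / (m : ℝ)) *
        Real.exp (-(t ^ 2) / (2 * m)) * (Polynomial.C (1 / 2) * lagPoly m +
        Polynomial.derivative (lagPoly m)).eval (-(t ^ 2) / m)) := by
      rw [hfun]; exact funext hd1
    have h0 : HasDerivAt (fun t : ℝ => -(2 * t) / (m : ℝ)) (-2 / (m : ℝ)) t := by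
      have := (((hasDerivAt_id t).const_mul (2 : ℝ)).neg).div_const (m : ℝ)
      refine this.congr_deriv ?_
      simp
    have hd2 := (h0.mul (hasDerivAt_aux m hm (Polynomial.C (1 / 2) * lagPoly m
      + Polynomial.derivative (lagPoly m)) t)).deriv
    have hd2' := (congrArg (fun g => deriv g t) hd).trans hd2
    rw [hd2', hd, phiFn_eq]
    have ho := congrArg (Polynomial.eval (-(t ^ 2) / (m : ℝ))) (lagPoly_ode m)
    simp only [Polynomial.eval_add, Polynomial.eval_mul, Polynomial.eval_C, Polynomial.eval_X,
      Polynomial.derivative_add, Polynomial.derivative_mul, Polynomial.derivative_C,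
      Polynomial.eval_zero] at ho ⊢
    generalize Polynomial.eval (-(t ^ 2) / (m : ℝ)) (lagPoly m) = P at *
    generalize Polynomial.eval (-(t ^ 2) / (m : ℝ)) (Polynomial.derivative (lagPoly m)) = P1 at *
    generalize Polynomial.eval (-(t ^ 2) / (m : ℝ))
      (Polynomial.derivative (Polynomial.derivative (lagPoly m))) = P2 at *
    generalize Real.exp (-(t ^ 2) / (2 * (m : ℝ))) = E at *
    have key : ∀ G : ℝ, G = -(4 * t / m ^ 2) * E * ((-(t ^ 2) / m * P2 + 2 * P1
      + -(t ^ 2) / m * P1) - (m - 1) * P) → G = 0 := by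
      intro G hG
      rw [hG, ho]
      ring
    apply key
    field_simp
    ring
end

section
/- For every ε > 0 there exists a constant C > 0 such that for every integer m ≥ 1 and every x ∈ ℝ, |f_m(x) − f_Wig(x)| ≤ C · m^{−2/9+ε}; in particular f_m converges to f_Wig uniformly on ℝ as m → ∞. -/
open Filter

/-- The Wigner semicircle (semi-ellipse) density, with the paper's normalization. -/
noncomputable def fWig (x : ℝ) : ℝ :=
  if |x| ≤ 2 then (1 / Real.pi) * Real.sqrt (1 - (x / 2) ^ 2) else 0

/-- Solutions of the rescaled third-order equation which decay at infinity. -/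
structure SemiODE (m : ℝ) (f f1 f2 : ℝ → ℝ) : Prop where
  hm : 1 ≤ m
  d0 : ∀ y, HasDerivAt f (f1 y) y
  d1 : ∀ y, HasDerivAt f1 (f2 y) y
  d2 : ∀ y, HasDerivAt f2 (-m ^ 2 * ((4 - y ^ 2) * f1 y + y * f y)) y
  t0 : Tendsto f atTop (nhds 0)
  t1 : Tendsto f1 atTop (nhds 0)
  t1' : Tendsto (fun y => y * f1 y) atTop (nhds 0)
  t2 : Tendsto f2 atTop (nhds 0)
  pos : 0 < f 0

namespace SemiODE

variable {m : ℝ} {f f1 f2 : ℝ → ℝ}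

theorem first_integral (h : SemiODE m f f1 f2) (y : ℝ) :
    (f y - y * f1 y) ^ 2 = 4 * f1 y ^ 2 + f2 y ^ 2 / m ^ 2 := by
  have hm : m ≠ 0 := by have := h.hm; positivity
  have hd : ∀ y, HasDerivAt (fun y => (f y - y * f1 y) ^ 2 - 4 * f1 y ^ 2 - f2 y ^ 2 / m ^ 2) 0 y := by
    intro y
    have e1 := (((h.d0 y).sub ((hasDerivAt_id y).mul (h.d1 y))).pow 2).sub
      (((h.d1 y).pow 2).const_mul 4)
    have e2 := e1.sub (((h.d2 y).pow 2).div_const (m ^ 2))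
    refine e2.congr_deriv ?_
    simp
    field_simp
    ring
  have hc : ∀ x y, (fun y => (f y - y * f1 y) ^ 2 - 4 * f1 y ^ 2 - f2 y ^ 2 / m ^ 2) x
      = (fun y => (f y - y * f1 y) ^ 2 - 4 * f1 y ^ 2 - f2 y ^ 2 / m ^ 2) y :=
    is_const_of_deriv_eq_zero (fun y => (hd y).differentiableAt) (fun y => (hd y).deriv)
  have ht : Tendsto (fun y => (f y - y * f1 y) ^ 2 - 4 * f1 y ^ 2 - f2 y ^ 2 / m ^ 2) atTop (nhds 0) := by
    have := (((h.t0.sub h.t1').pow 2).sub ((h.t1.pow 2).const_mul 4)).sub ((h.t2.pow 2).div_const (m ^ 2))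
    simpa using this
  have ht2 : Tendsto (fun y => (f y - y * f1 y) ^ 2 - 4 * f1 y ^ 2 - f2 y ^ 2 / m ^ 2) atTop
      (nhds ((f y - y * f1 y) ^ 2 - 4 * f1 y ^ 2 - f2 y ^ 2 / m ^ 2)) := by
    refine tendsto_const_nhds.congr (fun x => ?_)
    exact hc y x
  have := tendsto_nhds_unique ht ht2
  linarith

theorem dA (h : SemiODE m f f1 f2) (y : ℝ) :
    HasDerivAt (fun y => f y - y * f1 y) (-(y * f2 y)) y := by
  refine ((h.d0 y).sub ((hasDerivAt_id y).mul (h.d1 y))).congr_deriv ?_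
  simp

theorem abs_f2_le (h : SemiODE m f f1 f2) (y : ℝ) : |f2 y| ≤ m * |f y - y * f1 y| := by
  have hm : 0 < m := by have := h.hm; positivity
  have e := h.first_integral y
  have : f2 y ^ 2 ≤ (m * |f y - y * f1 y|) ^ 2 := by
    rw [mul_pow, sq_abs, e, mul_add, mul_div_cancel₀ _ (by positivity)]
    have : 0 ≤ m ^ 2 * (4 * f1 y ^ 2) := by positivity
    linarith
  exact abs_le_of_sq_le_sq this (by positivity)

theorem A_pos (h : SemiODE m f f1 f2) {y : ℝ} (hy : 0 ≤ y) : 0 < f y - y * f1 y := by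
  have hm : 0 < m := by have := h.hm; positivity
  have hmono : MonotoneOn (fun y => (f y - y * f1 y) ^ 2 * Real.exp (m * y ^ 2)) (Set.Ici 0) := by
    have hd : ∀ y, HasDerivAt (fun y => (f y - y * f1 y) ^ 2 * Real.exp (m * y ^ 2))
      (2 * (f y - y * f1 y) * (-(y * f2 y)) * Real.exp (m * y ^ 2) +
        (f y - y * f1 y) ^ 2 * (Real.exp (m * y ^ 2) * (m * (2 * y)))) y := by
      intro y
      refine (((h.dA y).pow 2).mul ((((hasDerivAt_id y).pow 2).const_mul m).exp)).congr_deriv ?_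
      simp
    refine monotoneOn_of_deriv_nonneg (convex_Ici 0) (fun y _ => (hd y).continuousAt.continuousWithinAt)
      (fun y _ => (hd y).differentiableAt.differentiableWithinAt) ?_
    intro y hy
    rw [interior_Ici] at hy
    rw [(hd y).deriv]
    have hy : 0 < y := hy
    have e := h.abs_f2_le y
    set A := f y - y * f1 y
    have : A * f2 y ≤ m * A ^ 2 := by
      calc A * f2 y ≤ |A * f2 y| := le_abs_self _
        _ = |A| * |f2 y| := abs_mul _ _
        _ ≤ |A| * (m * |A|) := by gcongr
        _ = m * A ^ 2 := by rw [← sq_abs A]; ring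
    have : 0 ≤ 2 * y * Real.exp (m * y ^ 2) * (m * A ^ 2 - A * f2 y) := by
      have := Real.exp_pos (m * y ^ 2)
      have : 0 ≤ m * A ^ 2 - A * f2 y := by linarith
      positivity
    linarith
  have hne : ∀ z, 0 ≤ z → f z - z * f1 z ≠ 0 := by
    intro z hz h0
    have := hmono (Set.mem_Ici.2 le_rfl) (Set.mem_Ici.2 hz) hz
    simp [h0] at this
    have := h.pos
    nlinarith
  by_contra hcon
  push Not at hcon
  have hcont : ContinuousOn (fun y => f y - y * f1 y) (Set.Icc 0 y) :=
    fun z _ => (h.dA z).continuousAt.continuousWithinAt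
  have := intermediate_value_Icc' hy hcont
  have h00 : (0:ℝ) ∈ Set.Icc (f y - y * f1 y) (f 0 - 0 * f1 0) := by
    refine ⟨hcon, ?_⟩
    have := h.pos
    simp; linarith
  obtain ⟨z, hz, hz0⟩ := this h00
  exact hne z hz.1 hz0

theorem f2_le (h : SemiODE m f f1 f2) {y : ℝ} (hy : 0 ≤ y) : |f2 y| ≤ m * (f y - y * f1 y) := by
  have := h.abs_f2_le y
  rwa [abs_of_pos (h.A_pos hy)] at this

theorem f1_le (h : SemiODE m f f1 f2) {y : ℝ} (hy : 0 ≤ y) : 2 * |f1 y| ≤ f y - y * f1 y := by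
  have e := h.first_integral y
  have : 0 ≤ f2 y ^ 2 / m ^ 2 := by positivity
  have : |2 * f1 y| ≤ f y - y * f1 y :=
    abs_le_of_sq_le_sq (by rw [e]; linarith) (h.A_pos hy).le
  rwa [abs_mul, abs_two] at this

theorem f_pos (h : SemiODE m f f1 f2) {y : ℝ} (hy : 0 ≤ y) : 0 < f y := by
  rcases hy.eq_or_lt with rfl | hy
  · exact h.pos
  have hanti : StrictAntiOn (fun y => f y / y) (Set.Ioi 0) := by
    have hd : ∀ y, 0 < y → HasDerivAt (fun y => f y / y) ((f1 y * y - f y * 1) / y ^ 2) y :=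
      fun y hy => (h.d0 y).div (hasDerivAt_id y) hy.ne'
    refine strictAntiOn_of_deriv_neg (convex_Ioi 0)
      (fun y hy => (hd y hy).continuousAt.continuousWithinAt) ?_
    intro y hy
    rw [interior_Ioi] at hy
    have hy : 0 < y := hy
    rw [(hd y hy).deriv]
    have := h.A_pos hy.le
    apply div_neg_of_neg_of_pos _ (by positivity)
    linarith
  have ht : Tendsto (fun y => f y / y) atTop (nhds 0) := by
    simpa [div_eq_mul_inv] using h.t0.mul tendsto_inv_atTop_zero
  have hge : 0 ≤ f (y + 1) / (y + 1) := by
    refine le_of_tendsto ht ?_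
    filter_upwards [eventually_ge_atTop (y + 1)] with z hz
    exact hanti.antitoneOn (Set.mem_Ioi.2 (by linarith)) (Set.mem_Ioi.2 (by linarith)) hz
  have := hanti (Set.mem_Ioi.2 hy) (Set.mem_Ioi.2 (by linarith : 0 < y + 1)) (by linarith)
  have : 0 < f y / y := lt_of_le_of_lt hge this
  exact (div_pos_iff_of_pos_right hy).1 this

theorem f1_nonpos (h : SemiODE m f f1 f2) {y : ℝ} (hy : 2 ≤ y) : f1 y ≤ 0 := by
  have hm : 0 < m := by have := h.hm; positivity
  by_contra hcon
  push Not at hcon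
  have hfy := h.f_pos (y := y) (by linarith)
  obtain ⟨N, hN⟩ := (h.t0.eventually (gt_mem_nhds hfy)).exists_forall_of_atTop
  obtain ⟨c, hc, hc'⟩ : ∃ c, y < c ∧ f1 c < 0 := by
    have hlt : y < max N (y + 1) := lt_of_lt_of_le (by linarith) (le_max_right _ _)
    obtain ⟨c, hc, hce⟩ := exists_hasDerivAt_eq_slope f f1 hlt
      (fun z _ => (h.d0 z).continuousAt.continuousWithinAt) (fun z _ => h.d0 z)
    refine ⟨c, hc.1, ?_⟩
    rw [hce]
    apply div_neg_of_neg_of_pos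
    · have := hN (max N (y + 1)) (le_max_left _ _)
      linarith
    · linarith
  have hcl : ContinuousOn f1 (Set.Ici y) := fun z _ => (h.d1 z).continuousAt.continuousWithinAt
  obtain ⟨M, hM⟩ := (h.t1.eventually (lt_mem_nhds hc')).exists_forall_of_atTop
  have hyR : y ≤ max c M := le_trans hc.le (le_max_left _ _)
  obtain ⟨y1, hy1, hmin⟩ := isCompact_Icc.exists_isMinOn (s := Set.Icc y (max c M)) ⟨y, le_rfl, hyR⟩
    (fun z _ => (h.d1 z).continuousAt.continuousWithinAt : ContinuousOn f1 (Set.Icc y (max c M)))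
  have hle : f1 y1 ≤ f1 c := hmin ⟨hc.le, le_max_left _ _⟩
  have hlt : y < y1 := by
    rcases hy1.1.eq_or_lt with e | e
    · rw [← e] at hle; linarith
    · exact e
  have hloc : IsLocalMin f1 y1 := by
    filter_upwards [lt_mem_nhds hlt] with z hz
    by_cases hzM : z ≤ max c M
    · exact hmin ⟨hz.le, hzM⟩
    · push Not at hzM
      have := hM z ((le_max_right c M).trans hzM.le)
      linarith
  have hd1 : deriv f1 = f2 := funext fun z => (h.d1 z).deriv
  have hf2 : f2 y1 = 0 := hloc.hasDerivAt_eq_zero (h.d1 y1)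
  have hneg : deriv (deriv f1) y1 < 0 := by
    rw [hd1, (h.d2 y1).deriv]
    have hfp := h.f_pos (y := y1) (by linarith)
    have a : (4 - y1 ^ 2) < 0 := by nlinarith
    have b : f1 y1 < 0 := by linarith
    have : 0 < (4 - y1 ^ 2) * f1 y1 := mul_pos_of_neg_of_neg a b
    have : 0 < y1 * f y1 := mul_pos (by linarith) hfp
    have : 0 < m ^ 2 * ((4 - y1 ^ 2) * f1 y1 + y1 * f y1) := by positivity
    linarith
  have hmax := isLocalMax_of_deriv_deriv_neg hneg (by rw [hd1]; exact hf2) (h.d1 y1).continuousAt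
  have heq : f1 =ᶠ[nhds y1] fun _ => f1 y1 := by
    filter_upwards [hloc, hmax] with z h1 h2
    exact le_antisymm h2 h1
  have := heq.deriv.deriv_eq
  rw [this] at hneg
  simp at hneg


theorem f2_le' (h : SemiODE m f f1 f2) {y : ℝ} (hy : 0 ≤ y) (hy2 : y < 2) :
    |f2 y| ≤ 8 * m * f y / (4 - y ^ 2) := by
  have hm : 0 < m := by have := h.hm; positivity
  have hq : 0 < 4 - y ^ 2 := by nlinarith
  have e1 := h.f2_le hy
  have e2 := h.f1_le hy
  have e3 := h.A_pos hy
  have e4 := h.f_pos hy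
  refine e1.trans ?_
  rw [le_div_iff₀ hq]
  have e5 : -f1 y ≤ |f1 y| := neg_le_abs _
  have e6 : (2 - y) * (f y - y * f1 y) ≤ 2 * f y := by nlinarith
  have : (2 + y) * ((2 - y) * (f y - y * f1 y)) ≤ (2 + y) * (2 * f y) := by gcongr
  have : (2 + y) * (2 * f y) ≤ 4 * (2 * f y) := by gcongr; linarith
  have : m * ((2 + y) * ((2 - y) * (f y - y * f1 y))) ≤ m * (4 * (2 * f y)) := by
    gcongr; linarith
  linarith

/-- corrected quotient -/
noncomputable def gq (m : ℝ) (f f2 : ℝ → ℝ) (y : ℝ) : ℝ :=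
  f y / √(4 - y ^ 2) + f2 y / (m ^ 2 * √(4 - y ^ 2) ^ 3)

theorem gq_deriv (h : SemiODE m f f1 f2) {y : ℝ} (hq : 0 < 4 - y ^ 2) :
    HasDerivAt (gq m f f2) (3 * y * f2 y / (m ^ 2 * √(4 - y ^ 2) ^ 5)) y := by
  have hm : 0 < m := by have := h.hm; positivity
  have hs : 0 < √(4 - y ^ 2) := Real.sqrt_pos.2 hq
  have ds : HasDerivAt (fun y : ℝ => √(4 - y ^ 2)) (-(2 * y) / (2 * √(4 - y ^ 2))) y := by
    refine (((hasDerivAt_id y).pow 2).const_sub 4 |>.sqrt (by simpa using hq.ne')).congr_deriv ?_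
    simp
  have e := ((h.d0 y).div ds hs.ne').add ((h.d2 y).div ((ds.pow 3).const_mul (m ^ 2))
    (by simp only [Pi.pow_apply]; positivity))
  refine e.congr_deriv ?_
  have hq2 : √(4 - y ^ 2) ^ 2 = 4 - y ^ 2 := Real.sq_sqrt hq.le
  set s := √(4 - y ^ 2)
  rw [← hq2]
  simp
  field_simp
  ring

theorem gq_close (h : SemiODE m f f1 f2) {y : ℝ} (hy : 0 ≤ y) (hy2 : y < 2) :
    |gq m f f2 y - f y / √(4 - y ^ 2)| ≤ 8 * (1 / (m * (4 - y ^ 2) ^ 2)) * (f y / √(4 - y ^ 2)) := by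
  have hm : 0 < m := by have := h.hm; positivity
  have hq : 0 < 4 - y ^ 2 := by nlinarith
  have hs : 0 < √(4 - y ^ 2) := Real.sqrt_pos.2 hq
  have e := h.f2_le' hy hy2
  unfold gq
  rw [add_sub_cancel_left, abs_div, abs_of_pos (by positivity : 0 < m ^ 2 * √(4 - y ^ 2) ^ 3)]
  rw [div_le_iff₀ (by positivity)]
  refine e.trans (le_of_eq ?_)
  have hq2 : √(4 - y ^ 2) ^ 2 = 4 - y ^ 2 := Real.sq_sqrt hq.le
  set s := √(4 - y ^ 2)
  rw [← hq2]
  field_simp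

set_option maxHeartbeats 1000000 in
theorem bulk (h : SemiODE m f f1 f2) {y : ℝ} (hy : 0 ≤ y) (hy2 : y < 2)
    (hb : 16 ≤ m * (4 - y ^ 2) ^ 2) :
    |f y - f 0 / 2 * √(4 - y ^ 2)| ≤ 68 * f 0 * √(4 - y ^ 2) / (m * (4 - y ^ 2) ^ 2) := by
  have hm : 0 < m := by have := h.hm; positivity
  have hqz : ∀ z ∈ Set.Icc 0 y, 0 < 4 - z ^ 2 := fun z hz => by nlinarith [hz.1, hz.2]
  have hbz : ∀ z ∈ Set.Icc 0 y, 16 ≤ m * (4 - z ^ 2) ^ 2 := fun z hz => by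
    refine hb.trans ?_
    have := hqz y ⟨hy, le_rfl⟩
    have : z ^ 2 ≤ y ^ 2 := by nlinarith [hz.1, hz.2]
    gcongr
  have hk : ∀ z ∈ Set.Icc 0 y, 1 / (m * (4 - z ^ 2) ^ 2) ≤ 1 / 16 := fun z hz => by
    have := hbz z hz
    gcongr
  have hhpos : ∀ z ∈ Set.Icc 0 y, 0 < f z / √(4 - z ^ 2) := fun z hz =>
    div_pos (h.f_pos hz.1) (Real.sqrt_pos.2 (hqz z hz))
  have hcl : ∀ z ∈ Set.Icc 0 y, |gq m f f2 z - f z / √(4 - z ^ 2)| ≤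
      8 * (1 / (m * (4 - z ^ 2) ^ 2)) * (f z / √(4 - z ^ 2)) := fun z hz =>
    h.gq_close hz.1 (hz.2.trans_lt hy2)
  have hhg : ∀ z ∈ Set.Icc 0 y, f z / √(4 - z ^ 2) ≤ 2 * gq m f f2 z := fun z hz => by
    have a := hcl z hz
    have b := hk z hz
    have c := hhpos z hz
    have d := (abs_le.1 a).1
    nlinarith
  have hg' : ∀ z ∈ Set.Icc 0 y, |3 * z * f2 z / (m ^ 2 * √(4 - z ^ 2) ^ 5)| ≤
      48 * z / (m * (4 - z ^ 2) ^ 3) * gq m f f2 z := fun z hz => by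
    have a := h.f2_le' hz.1 (hz.2.trans_lt hy2)
    have b := hhg z hz
    have hq := hqz z hz
    have hz0 : 0 ≤ z := hz.1
    have hs : 0 < √(4 - z ^ 2) := Real.sqrt_pos.2 hq
    calc |3 * z * f2 z / (m ^ 2 * √(4 - z ^ 2) ^ 5)|
        = 3 * z / (m ^ 2 * √(4 - z ^ 2) ^ 5) * |f2 z| := by
          rw [abs_div, abs_mul, abs_of_nonneg (by positivity : 0 ≤ 3 * z),
            abs_of_pos (by positivity : 0 < m ^ 2 * √(4 - z ^ 2) ^ 5)]
          ring
      _ ≤ 3 * z / (m ^ 2 * √(4 - z ^ 2) ^ 5) * (8 * m * f z / (4 - z ^ 2)) := by gcongr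
      _ = 24 * z / (m * (4 - z ^ 2) ^ 3) * (f z / √(4 - z ^ 2)) := by
          have hq2 : √(4 - z ^ 2) ^ 2 = 4 - z ^ 2 := Real.sq_sqrt hq.le
          set s := √(4 - z ^ 2)
          rw [← hq2]
          field_simp
          ring
      _ ≤ 24 * z / (m * (4 - z ^ 2) ^ 3) * (2 * gq m f f2 z) := by gcongr
      _ = _ := by ring
  have dk : ∀ z ∈ Set.Icc 0 y, HasDerivAt (fun z : ℝ => 12 * (1 / (m * (4 - z ^ 2) ^ 2)))
      (48 * z / (m * (4 - z ^ 2) ^ 3)) z := fun z hz => by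
    have hq := hqz z hz
    have e := ((((hasDerivAt_id z).pow 2).const_sub 4).pow 2).const_mul m
    refine (((hasDerivAt_const z (1:ℝ)).div e (by simp; exact ⟨hm.ne', hq.ne'⟩)).const_mul 12).congr_deriv ?_
    simp
    field_simp
    ring
  have hsubI : ∀ z ∈ interior (Set.Icc 0 y), z ∈ Set.Icc 0 y := fun z hz => interior_subset hz
  have hanti : AntitoneOn (fun z => gq m f f2 z * Real.exp (-(12 * (1 / (m * (4 - z ^ 2) ^ 2)))))
      (Set.Icc 0 y) := by
    have hd := fun z hz => (h.gq_deriv (hqz z hz)).mul (dk z hz).neg.exp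
    refine antitoneOn_of_deriv_nonpos (convex_Icc 0 y)
      (fun z hz => (hd z hz).continuousAt.continuousWithinAt)
      (fun z hz => (hd z (hsubI z hz)).differentiableAt.differentiableWithinAt) ?_
    intro z hz
    have hz := hsubI z hz
    refine (hd z hz).deriv.trans_le ?_
    have a := (abs_le.1 (hg' z hz)).2
    have b := Real.exp_pos (-(12 * (1 / (m * (4 - z ^ 2) ^ 2))))
    simp only [Pi.neg_apply] at *
    nlinarith
  have hmono : MonotoneOn (fun z => gq m f f2 z * Real.exp (12 * (1 / (m * (4 - z ^ 2) ^ 2))))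
      (Set.Icc 0 y) := by
    have hd := fun z hz => (h.gq_deriv (hqz z hz)).mul (dk z hz).exp
    refine monotoneOn_of_deriv_nonneg (convex_Icc 0 y)
      (fun z hz => (hd z hz).continuousAt.continuousWithinAt)
      (fun z hz => (hd z (hsubI z hz)).differentiableAt.differentiableWithinAt) ?_
    intro z hz
    have hz := hsubI z hz
    refine le_trans ?_ (hd z hz).deriv.ge
    have a := (abs_le.1 (hg' z hz)).1
    have b := Real.exp_pos (12 * (1 / (m * (4 - z ^ 2) ^ 2)))
    nlinarith
  have m0 : (0:ℝ) ∈ Set.Icc 0 y := ⟨le_rfl, hy⟩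
  have my : y ∈ Set.Icc 0 y := ⟨hy, le_rfl⟩
  have A1 := hanti m0 my hy
  have A2 := hmono m0 my hy
  have A3 := hcl y my
  have A4 := hcl 0 m0
  have A5 := hk y my
  have A6 := hhpos y my
  have A7 := hhg y my
  have hs : 0 < √(4 - y ^ 2) := Real.sqrt_pos.2 (hqz y my)
  have hk0 : 1 / (m * (4 - (0:ℝ) ^ 2) ^ 2) ≤ 1 / (m * (4 - y ^ 2) ^ 2) := by
    have := hqz y my
    gcongr
  have hk00 : 0 < 1 / (m * (4 - (0:ℝ) ^ 2) ^ 2) := by norm_num; positivity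
  have hs0 : √(4 - (0:ℝ) ^ 2) = 2 := by
    rw [show (4 - (0:ℝ) ^ 2) = 2 ^ 2 by norm_num]; exact Real.sqrt_sq (by norm_num)
  rw [hs0] at A4
  have hfin : 68 * f 0 * √(4 - y ^ 2) / (m * (4 - y ^ 2) ^ 2)
    = 68 * f 0 * (1 / (m * (4 - y ^ 2) ^ 2)) * √(4 - y ^ 2) := by ring
  rw [hfin]
  have hfy : f y = f y / √(4 - y ^ 2) * √(4 - y ^ 2) := by field_simp
  have hf0 := h.pos
  simp only at A1 A2
  set s := √(4 - y ^ 2)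
  set k := 1 / (m * (4 - y ^ 2) ^ 2)
  set k0 := 1 / (m * (4 - (0:ℝ) ^ 2) ^ 2)
  set g := gq m f f2 y
  set g0 := gq m f f2 0
  set hh := f y / s
  have hkpos : 0 < k := hk00.trans_le hk0
  have hgpos : 0 < g := by linarith
  obtain ⟨A4a, A4b⟩ := abs_le.1 A4
  have B1 : |g0 - f 0 / 2| ≤ 4 * k * f 0 := by
    refine A4.trans ?_
    nlinarith
  obtain ⟨B1a, B1b⟩ := abs_le.1 B1
  have hg0 : g0 ≤ f 0 := by nlinarith
  have hg0p : 0 < g0 := by nlinarith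
  have ex : Real.exp (12 * k) ≤ 1 + 24 * k := by
    have := Real.abs_exp_sub_one_sub_id_le (x := 12 * k) (by rw [abs_of_pos (by positivity)]; linarith)
    have := (abs_le.1 this).2
    nlinarith
  have C1 : g ≤ g0 * Real.exp (12 * k) := by
    have e1 : Real.exp (-(12 * k0)) ≤ 1 := Real.exp_le_one_iff.2 (by linarith)
    have e2 : g * Real.exp (-(12 * k)) ≤ g0 := by nlinarith
    rw [Real.exp_neg, ← div_eq_mul_inv, div_le_iff₀ (Real.exp_pos _)] at e2
    exact e2
  have C2 : g0 * (1 - 12 * k) ≤ g := by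
    have e1 : 1 ≤ Real.exp (12 * k0) := Real.one_le_exp (by linarith)
    have e2 : g0 ≤ g * Real.exp (12 * k) := by nlinarith
    have e3 : g0 * Real.exp (-(12 * k)) ≤ g := by
      rw [Real.exp_neg, ← div_eq_mul_inv, div_le_iff₀ (Real.exp_pos _)]
      exact e2
    have e4 := Real.add_one_le_exp (-(12 * k))
    nlinarith
  have C3 : g ≤ g0 * (1 + 24 * k) := C1.trans (by gcongr)
  have C4 : |hh - f 0 / 2| ≤ 68 * f 0 * k := by
    obtain ⟨A3a, A3b⟩ := abs_le.1 A3
    have e1 : g ≤ 5 / 2 * f 0 := by nlinarith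
    have e2 : 8 * k * hh ≤ 40 * k * f 0 := by
      have : hh ≤ 5 * f 0 := by linarith
      calc 8 * k * hh ≤ 8 * k * (5 * f 0) := by gcongr
        _ = _ := by ring
    have e3 : g0 * k ≤ f 0 * k := by gcongr
    rw [abs_le]
    constructor <;> linarith
  calc |f y - f 0 / 2 * s| = |hh - f 0 / 2| * s := by
        rw [← abs_of_pos hs, ← abs_mul, abs_of_pos hs, sub_mul, ← hfy]
    _ ≤ _ := by gcongr

theorem core (h : SemiODE m f f1 f2) {y δ : ℝ} (hy : 0 ≤ y) (hδ : 0 < δ) (hδ1 : m * δ ^ 4 = 1) :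
    |f y - f 0 / 2 * √(4 - y ^ 2)| ≤ 20 * f 0 * δ := by
  have hm : 0 < m := by have := h.hm; positivity
  have hf0 := h.pos
  have hδ2 : δ ≤ 1 := by
    by_contra hc
    push Not at hc
    have : 1 < δ ^ 4 := one_lt_pow₀ hc (by norm_num)
    nlinarith [h.hm]
  have hbulk : ∀ z, 0 ≤ z → 4 * δ ^ 2 ≤ 4 - z ^ 2 → |f z - f 0 / 2 * √(4 - z ^ 2)| ≤ 9 * f 0 * δ := by
    intro z hz hzq
    have hq : 0 < 4 - z ^ 2 := lt_of_lt_of_le (by positivity) hzq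
    have hz2 : z < 2 := by nlinarith
    have hb : 16 ≤ m * (4 - z ^ 2) ^ 2 := by
      calc (16:ℝ) = m * (4 * δ ^ 2) ^ 2 := by linear_combination (-16) * hδ1
        _ ≤ _ := by gcongr
    refine (h.bulk hz hz2 hb).trans ?_
    have hs : 2 * δ ≤ √(4 - z ^ 2) := Real.le_sqrt_of_sq_le (by linarith)
    have hq2 : √(4 - z ^ 2) ^ 2 = 4 - z ^ 2 := Real.sq_sqrt hq.le
    have hs0 : 0 < √(4 - z ^ 2) := Real.sqrt_pos.2 hq
    set s := √(4 - z ^ 2)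
    rw [← hq2, div_le_iff₀ (by positivity)]
    have e1 : (2 * δ) ^ 3 ≤ s ^ 3 := by gcongr
    calc 68 * f 0 * s = 68 * f 0 * s * (m * δ ^ 4) := by rw [hδ1]; ring
      _ = 8.5 * f 0 * s * m * δ * ((2 * δ) ^ 3) := by ring
      _ ≤ 9 * f 0 * s * m * δ * (s ^ 3) := by gcongr; norm_num
      _ = _ := by ring
  by_cases hc : 4 * δ ^ 2 ≤ 4 - y ^ 2
  · refine (hbulk y hy hc).trans ?_
    gcongr; norm_num
  push Not at hc
  have hδδ : δ ^ 2 ≤ 1 := by nlinarith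
  have hy0sq : √(4 - 4 * δ ^ 2) ^ 2 = 4 - 4 * δ ^ 2 := Real.sq_sqrt (by linarith)
  have hy00 : 0 ≤ √(4 - 4 * δ ^ 2) := Real.sqrt_nonneg _
  set y0 := √(4 - 4 * δ ^ 2) with hy0
  have hy0y : y0 ≤ y := by
    apply le_of_sq_le_sq _ hy
    linarith
  have hy02 : y0 ≤ 2 := by nlinarith
  have F0 : f y0 ≤ 10 * f 0 * δ := by
    have := hbulk y0 hy00 (by rw [hy0sq]; linarith)
    have e : √(4 - y0 ^ 2) = 2 * δ := by
      rw [hy0sq, show 4 - (4 - 4 * δ ^ 2) = (2 * δ) ^ 2 by ring]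
      exact Real.sqrt_sq (by positivity)
    rw [e] at this
    have := (abs_le.1 this).2
    linarith
  have hanti : AntitoneOn (fun y => f y / (y + 2)) (Set.Ici 0) := by
    have hd : ∀ y, 0 ≤ y → HasDerivAt (fun y => f y / (y + 2)) ((f1 y * (y + 2) - f y * 1) / (y + 2) ^ 2) y :=
      fun y hy => (h.d0 y).div ((hasDerivAt_id y).add_const 2) (by simp; positivity)
    refine antitoneOn_of_deriv_nonpos (convex_Ici 0)
      (fun y hy => (hd y hy).continuousAt.continuousWithinAt)
      (fun y hy => (hd y (interior_subset hy)).differentiableAt.differentiableWithinAt) ?_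
    intro y hy
    have hy : 0 ≤ y := interior_subset hy
    rw [(hd y hy).deriv]
    have := h.f1_le hy
    have := le_abs_self (f1 y)
    apply div_nonpos_of_nonpos_of_nonneg _ (by positivity)
    linarith
  have F1 : ∀ z, y0 ≤ z → z ≤ 2 → f z ≤ 20 * f 0 * δ := by
    intro z hz hz2
    have := hanti (Set.mem_Ici.2 hy00) (Set.mem_Ici.2 (hy00.trans hz)) hz
    simp only at this
    rw [div_le_div_iff₀ (by linarith) (by linarith)] at this
    have hp := h.f_pos hy00
    have hp2 := h.f_pos (hy00.trans hz)
    nlinarith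
  have F2 : f y ≤ 20 * f 0 * δ := by
    by_cases hy2 : y ≤ 2
    · exact F1 y hy0y hy2
    push Not at hy2
    have hanti2 : AntitoneOn f (Set.Ici 2) := by
      refine antitoneOn_of_deriv_nonpos (convex_Ici 2)
        (fun y hy => (h.d0 y).continuousAt.continuousWithinAt)
        (fun y hy => (h.d0 y).differentiableAt.differentiableWithinAt) ?_
      intro y hy
      rw [(h.d0 y).deriv]
      exact h.f1_nonpos (interior_subset hy)
    exact (hanti2 (Set.mem_Ici.2 le_rfl) (Set.mem_Ici.2 hy2.le) hy2.le).trans (F1 2 hy02 le_rfl)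
  have F3 := h.f_pos hy
  have F4 : √(4 - y ^ 2) ≤ 2 * δ := by
    apply Real.sqrt_le_iff.2
    constructor
    · positivity
    · linarith
  have F5 := Real.sqrt_nonneg (4 - y ^ 2)
  have F6 : f 0 / 2 * √(4 - y ^ 2) ≤ f 0 / 2 * (2 * δ) := by gcongr
  have F7 : 0 ≤ f 0 / 2 * √(4 - y ^ 2) := by positivity
  have F8 : 0 < f 0 * δ := by positivity
  rw [abs_le]
  constructor <;> linarith

end SemiODE

namespace SemiAux

/-- binomial transform -/
noncomputable def bt (b : ℕ → ℝ) (m : ℕ) : ℝ := ∑ s ∈ Finset.range (m + 1), (m.choose s : ℝ) * b s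

theorem bt_succ (b : ℕ → ℝ) (m : ℕ) : bt (fun s => b (s + 1)) m = bt b (m + 1) - bt b m := by
  unfold bt
  rw [Finset.sum_range_succ' (fun s => ((m + 1).choose s : ℝ) * b s) (m + 1),
    Finset.sum_range_succ' (fun s => (m.choose s : ℝ) * b s) m]
  have : ∑ s ∈ Finset.range (m + 1), ((m + 1).choose (s + 1) : ℝ) * b (s + 1)
    = ∑ s ∈ Finset.range (m + 1), (m.choose s : ℝ) * b (s + 1)
      + ∑ s ∈ Finset.range (m + 1), (m.choose (s + 1) : ℝ) * b (s + 1) := by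
    rw [← Finset.sum_add_distrib]
    refine Finset.sum_congr rfl fun s _ => ?_
    rw [Nat.choose_succ_succ]
    push_cast
    ring
  rw [this, Finset.sum_range_succ (fun s => (m.choose (s + 1) : ℝ) * b (s + 1)) m]
  simp

theorem bt_mul (b : ℕ → ℝ) (m : ℕ) :
    bt (fun s => s * b s) (m + 1) = (m + 1) * (bt b (m + 1) - bt b m) := by
  rw [← bt_succ]
  unfold bt
  rw [Finset.sum_range_succ', Finset.mul_sum]
  simp only [Nat.cast_zero, zero_mul, mul_zero, add_zero]
  refine Finset.sum_congr rfl fun s _ => ?_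
  have := Nat.add_one_mul_choose_eq m s
  have h : ((m : ℝ) + 1) * (m.choose s : ℝ) = ((m + 1).choose (s + 1) : ℝ) * (s + 1) := by
    exact_mod_cast this
  push_cast
  linear_combination (-b (s + 1)) * h

/-- the summand at the origin -/
noncomputable def bb (s : ℕ) : ℝ := (s.centralBinom : ℝ) * (-1 / 2) ^ s

theorem bb_succ (s : ℕ) : ((s + 1 : ℕ) : ℝ) * bb (s + 1) = -(2 * (s * bb s) + bb s) := by
  have h : ((s : ℝ) + 1) * ((s + 1).centralBinom : ℝ) = 2 * (2 * s + 1) * (s.centralBinom : ℝ) := by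
    exact_mod_cast Nat.succ_mul_centralBinom_succ s
  unfold bb
  push_cast
  rw [pow_succ]
  linear_combination ((-1 / 2 : ℝ) ^ s * (-1 / 2)) * h

theorem bt_bb_rec (m : ℕ) : ((m : ℝ) + 2) * bt bb (m + 2) = (m + 1) * bt bb m := by
  have h1 := bt_succ (fun s => s * bb s) (m + 1)
  have h2 : bt (fun s => ((s + 1 : ℕ) : ℝ) * bb (s + 1)) (m + 1)
      = -(2 * bt (fun s => s * bb s) (m + 1) + bt bb (m + 1)) := by
    simp only [bb_succ]
    unfold bt
    rw [Finset.mul_sum, ← Finset.sum_add_distrib, ← Finset.sum_neg_distrib]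
    refine Finset.sum_congr rfl fun s _ => ?_
    ring
  have h3 := bt_mul bb m
  have h4 := bt_mul bb (m + 1)
  rw [h2, h3, h4] at h1
  push_cast at h1
  linear_combination -h1

theorem bt_even (k : ℕ) : bt bb (2 * k) = (k.centralBinom : ℝ) / 4 ^ k ∧ bt bb (2 * k + 1) = 0 := by
  induction k with
  | zero => norm_num [bt, bb, Finset.sum_range_succ, Nat.centralBinom, Nat.choose]
  | succ k ih =>
    have h1 := bt_bb_rec (2 * k)
    have h2 := bt_bb_rec (2 * k + 1)
    rw [ih.1] at h1
    rw [ih.2] at h2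
    have h : ((k : ℝ) + 1) * ((k + 1).centralBinom : ℝ) = 2 * (2 * k + 1) * (k.centralBinom : ℝ) := by
      exact_mod_cast Nat.succ_mul_centralBinom_succ k
    constructor
    · rw [show 2 * (k + 1) = 2 * k + 2 by ring]
      push_cast at h1
      have hk : (2 * (k : ℝ) + 2) ≠ 0 := by positivity
      apply mul_left_cancel₀ hk
      rw [h1, pow_succ]
      field_simp
      linear_combination (-2) * h
    · rw [show 2 * (k + 1) + 1 = 2 * k + 1 + 2 by ring]
      rw [mul_zero] at h2
      have : ((2 * k + 1 : ℕ) : ℝ) + 2 ≠ 0 := by positivity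
      exact (mul_eq_zero.1 h2).resolve_left this

/-- the value of the polynomial part at the origin -/
noncomputable def c0 (m : ℕ) : ℝ := ∑ s ∈ Finset.range m, (m.choose (s + 1) : ℝ) * bb s

theorem c0_succ (m : ℕ) : c0 (m + 1) = c0 m + bt bb m := by
  have e : c0 m = ∑ s ∈ Finset.range (m + 1), (m.choose (s + 1) : ℝ) * bb s := by
    rw [Finset.sum_range_succ]; simp [c0]
  rw [e]
  unfold c0 bt
  rw [← Finset.sum_add_distrib]
  refine Finset.sum_congr rfl fun s _ => ?_
  rw [Nat.choose_succ_succ]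
  push_cast
  ring

theorem c0_val (k : ℕ) : c0 (2 * k + 1) = (2 * k + 1) * ((k.centralBinom : ℝ) / 4 ^ k) ∧
    c0 (2 * k + 2) = (2 * k + 1) * ((k.centralBinom : ℝ) / 4 ^ k) := by
  induction k with
  | zero => norm_num [c0, bb, Finset.sum_range_succ, Nat.centralBinom, Nat.choose]
  | succ k ih =>
    have h : ((k : ℝ) + 1) * ((k + 1).centralBinom : ℝ) = 2 * (2 * k + 1) * (k.centralBinom : ℝ) := by
      exact_mod_cast Nat.succ_mul_centralBinom_succ k
    have h1 : c0 (2 * (k + 1) + 1) = (2 * (k + 1 : ℕ) + 1) * (((k + 1).centralBinom : ℝ) / 4 ^ (k + 1)) := by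
      rw [c0_succ, (bt_even (k + 1)).1, show 2 * (k + 1) = 2 * k + 2 by ring, ih.2, pow_succ]
      push_cast
      field_simp
      linear_combination (-2) * h
    refine ⟨h1, ?_⟩
    rw [show 2 * (k + 1) + 2 = (2 * (k + 1) + 1) + 1 by ring, c0_succ, (bt_even (k + 1)).2, h1, add_zero]

theorem c0_sq (k : ℕ) : ((2 * k + 1) * ((k.centralBinom : ℝ) / 4 ^ k)) ^ 2 = (2 * k + 1) / Real.Wallis.W k := by
  rw [Real.Wallis.W_eq_factorial_ratio]
  have h : (k.centralBinom : ℝ) * ((k.factorial : ℝ) * k.factorial) = (2 * k).factorial := by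
    have := Nat.choose_mul_factorial_mul_factorial (n := 2 * k) (k := k) (by omega)
    rw [show 2 * k - k = k by omega] at this
    rw [Nat.centralBinom]
    rw [← mul_assoc]
    exact_mod_cast this
  rw [← h, show (2:ℝ) ^ (4 * k) = (4 ^ k) ^ 2 by rw [← pow_mul, show (4:ℝ) = 2 ^ 2 by norm_num, ← pow_mul]; congr 1; ring]
  have : (k.factorial : ℝ) ≠ 0 := by positivity
  have : (k.centralBinom : ℝ) ≠ 0 := by exact_mod_cast (Nat.centralBinom_pos k).ne'
  field_simp

theorem c0_main (m : ℕ) (hm : 1 ≤ m) : 0 < c0 m ∧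
    2 * ((m : ℝ) - 1) / Real.pi ≤ c0 m ^ 2 ∧ c0 m ^ 2 ≤ 2 * ((m : ℝ) + 1) / Real.pi := by
  obtain ⟨k, hk, h1, h2⟩ : ∃ k : ℕ, c0 m = (2 * k + 1) * ((k.centralBinom : ℝ) / 4 ^ k) ∧
      m ≤ 2 * k + 2 ∧ 2 * k + 1 ≤ m := by
    rcases Nat.even_or_odd' m with ⟨c, rfl | rfl⟩
    · obtain ⟨d, rfl⟩ : ∃ d, c = d + 1 := ⟨c - 1, by omega⟩
      exact ⟨d, (c0_val d).2, by omega, by omega⟩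
    · exact ⟨c, (c0_val c).1, by omega, by omega⟩
  have hcb : (0:ℝ) < k.centralBinom := by exact_mod_cast Nat.centralBinom_pos k
  refine ⟨by rw [hk]; positivity, ?_⟩
  rw [hk, c0_sq]
  have hW := Real.Wallis.W_pos k
  have hW1 := Real.Wallis.W_le k
  have hW2 := Real.Wallis.le_W k
  have hpi := Real.pi_pos
  have h1' : (m : ℝ) ≤ 2 * k + 2 := by exact_mod_cast h1
  have h2' : 2 * (k : ℝ) + 1 ≤ m := by exact_mod_cast h2
  have hk0 : (0:ℝ) ≤ k := k.cast_nonneg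
  constructor
  · rw [div_le_div_iff₀ hpi hW]
    have : 2 * ((m : ℝ) - 1) ≤ 2 * (2 * k + 1) := by linarith
    calc 2 * ((m : ℝ) - 1) * Real.Wallis.W k ≤ 2 * (2 * k + 1) * (Real.pi / 2) := by gcongr
      _ = _ := by ring
  · rw [div_le_div_iff₀ hW hpi]
    calc (2 * (k : ℝ) + 1) * Real.pi = 2 * (2 * k + 2) * ((2 * k + 1) / (2 * k + 2) * (Real.pi / 2)) := by
          field_simp
      _ ≤ 2 * (m + 1) * Real.Wallis.W k := by
          have : 2 * (2 * (k : ℝ) + 2) ≤ 2 * (m + 1) := by linarith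
          exact mul_le_mul this hW2 (by positivity) (by positivity)

end SemiAux

namespace SemiAux
open Polynomial

theorem derivative_hermite_succ (n : ℕ) :
    derivative (hermite (n + 1)) = ((n : ℤ[X]) + 1) * hermite n := by
  induction n with
  | zero => simp
  | succ n ih =>
    rw [hermite_succ (n + 1), derivative_sub, derivative_mul, ih, hermite_succ n]
    simp only [derivative_X, derivative_mul, derivative_add, derivative_natCast, derivative_one]
    push_cast
    ring

/-- derivatives of the Gaussian -/
noncomputable def G (k : ℕ) (t : ℝ) : ℝ := (-1) ^ k * aeval t (hermite k) * Real.exp (-(t ^ 2 / 2))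

theorem G_deriv (k : ℕ) (t : ℝ) : HasDerivAt (G k) (G (k + 1) t) t := by
  have e1 : HasDerivAt (fun t : ℝ => aeval t (hermite k)) (aeval t (derivative (hermite k))) t :=
    (hermite k).hasDerivAt_aeval t
  have e2 : HasDerivAt (fun t : ℝ => Real.exp (-(t ^ 2 / 2))) (Real.exp (-(t ^ 2 / 2)) * (-(2 * t / 2))) t := by
    refine (((hasDerivAt_id t).pow 2).div_const 2).neg.exp.congr_deriv ?_
    simp
  refine ((e1.const_mul ((-1) ^ k)).mul e2).congr_deriv ?_
  simp only [G, hermite_succ, map_sub, map_mul, aeval_X, pow_succ]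
  ring

theorem t_G_zero (t : ℝ) : t * G 0 t = - G 1 t := by
  simp [G]

theorem t_G (k : ℕ) (t : ℝ) : t * G (k + 1) t = - G (k + 2) t - (k + 1) * G k t := by
  have : aeval t (hermite (k + 2)) = t * aeval t (hermite (k + 1)) - (k + 1) * aeval t (hermite k) := by
    rw [hermite_succ (k + 1), derivative_hermite_succ]
    simp
  simp only [G, this, pow_succ]
  ring

theorem G_tendsto (k : ℕ) : Tendsto (G k) atTop (nhds 0) := by
  have h : ∀ p : ℤ[X], Tendsto (fun t : ℝ => aeval t p * Real.exp (-(t ^ 2 / 2))) atTop (nhds 0) := by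
    intro p
    have h1 : ∀ n : ℕ, Tendsto (fun t : ℝ => t ^ n * Real.exp (-(t ^ 2 / 2))) atTop (nhds 0) := by
      intro n
      have h0 := Real.tendsto_pow_mul_exp_neg_atTop_nhds_zero n
      refine squeeze_zero' (Filter.eventually_atTop.2 ⟨0, fun t ht => by positivity⟩) ?_ h0
      filter_upwards [eventually_ge_atTop 2] with t ht
      have : Real.exp (-(t ^ 2 / 2)) ≤ Real.exp (-t) := Real.exp_le_exp.2 (by nlinarith)
      gcongr
    have h2 : (fun t : ℝ => aeval t p * Real.exp (-(t ^ 2 / 2))) =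
        fun t => ∑ i ∈ Finset.range (p.natDegree + 1), (p.coeff i : ℝ) * (t ^ i * Real.exp (-(t ^ 2 / 2))) := by
      funext t
      rw [aeval_eq_sum_range, Finset.sum_mul]
      refine Finset.sum_congr rfl fun i _ => ?_
      rw [zsmul_eq_mul]; ring
    rw [h2]
    have := tendsto_finsetSum (Finset.range (p.natDegree + 1))
      (fun i _ => (h1 i).const_mul (p.coeff i : ℝ))
    simpa using this
  have := (h (hermite k)).const_mul ((-1) ^ k)
  simp only [mul_zero] at this
  refine this.congr fun t => ?_
  simp only [G]; ring

theorem tG_tendsto (k : ℕ) : Tendsto (fun t => t * G (k + 1) t) atTop (nhds 0) := by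
  simp only [t_G]
  have := (G_tendsto (k + 2)).neg.sub ((G_tendsto k).const_mul ((k:ℝ) + 1))
  simpa using this

/-- coefficients in the Gaussian-derivative expansion -/
noncomputable def aa (m j : ℕ) : ℝ := (m.choose (j + 1) : ℝ) / (j.factorial : ℝ)

/-- the density, in the unscaled variable, and its derivatives -/
noncomputable def F (i m : ℕ) (t : ℝ) : ℝ := ∑ j ∈ Finset.range m, aa m j * G (2 * j + i) t

theorem F_deriv (i m : ℕ) (t : ℝ) : HasDerivAt (F i m) (F (i + 1) m t) t := by
  unfold F
  exact HasDerivAt.fun_sum fun j _ => (G_deriv (2 * j + i) t).const_mul (aa m j)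

theorem F_tendsto (i m : ℕ) : Tendsto (F i m) atTop (nhds 0) := by
  have := tendsto_finsetSum (Finset.range m)
      (fun j _ => (G_tendsto (2 * j + i)).const_mul (aa m j))
  simp only [mul_zero, Finset.sum_const_zero] at this
  exact this

theorem tF_tendsto (i m : ℕ) : Tendsto (fun t => t * F (i + 1) m t) atTop (nhds 0) := by
  have := tendsto_finsetSum (Finset.range m)
      (fun j _ => (tG_tendsto (2 * j + i)).const_mul (aa m j))
  simp only [mul_zero, Finset.sum_const_zero] at this
  refine this.congr fun t => ?_
  unfold F
  rw [Finset.mul_sum]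
  refine Finset.sum_congr rfl fun j _ => ?_
  rw [add_assoc]
  ring

theorem aa_succ (m j : ℕ) (hj : j < m) :
    ((m : ℝ) - j - 1) * aa m j = (j + 1) * (j + 2) * aa m (j + 1) := by
  have h : (m.choose (j + 2) : ℝ) * (j + 2) = m.choose (j + 1) * (m - (j + 1)) := by
    have := Nat.choose_succ_right_eq m (j + 1)
    have h2 : ((m - (j + 1) : ℕ) : ℝ) = (m : ℝ) - (j + 1) := by
      rw [Nat.cast_sub (by omega)]; push_cast; ring
    rw [← h2]
    have h3 : ((m.choose (j + 1 + 1) * (j + 1 + 1) : ℕ) : ℝ) = ((m.choose (j + 1) * (m - (j + 1)) : ℕ) : ℝ) := by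
      rw [this]
    push_cast at h3
    rw [← h3]
    ring_nf
  unfold aa
  rw [Nat.factorial_succ]
  push_cast
  have : (j.factorial : ℝ) ≠ 0 := by positivity
  field_simp
  linear_combination -h

theorem F_ode (m : ℕ) (t : ℝ) :
    F 3 m t + (4 * m - t ^ 2) * F 1 m t + t * F 0 m t = 0 := by
  have key : ∀ j ∈ Finset.range m, aa m j * G (2 * j + 3) t + (4 * m - t ^ 2) * (aa m j * G (2 * j + 1) t)
      + t * (aa m j * G (2 * j + 0) t) =
      (fun j : ℕ => 4 * (j : ℝ) * (j + 1) * aa m j * G (2 * j - 1) t) (j + 1)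
        - (fun j : ℕ => 4 * (j : ℝ) * (j + 1) * aa m j * G (2 * j - 1) t) j := by
    intro j hj
    have h1 := aa_succ m j (Finset.mem_range.1 hj)
    have h2 := t_G (2 * j) t
    have h3 := t_G (2 * j + 1) t
    simp only
    rw [show 2 * (j + 1) - 1 = 2 * j + 1 by omega]
    rcases j with _ | i
    · have h4 := t_G_zero t
      simp only [Nat.cast_zero, mul_zero, zero_add, zero_mul, sub_zero, Nat.cast_one, one_mul] at *
      linear_combination (4 * G 1 t) * h1 - t * aa m 0 * h2 + aa m 0 * h3
        + 2 * aa m 0 * h4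
    · have h4 := t_G (2 * i + 1) t
      rw [show 2 * (i + 1) - 1 = 2 * i + 1 by omega]
      rw [show 2 * (i + 1) = 2 * i + 2 by ring] at *
      push_cast at *
      simp only [add_zero, add_assoc, Nat.reduceAdd] at *
      norm_num at *
      linear_combination (4 * G (2 * i + 3) t) * h1 - t * aa m (i+1) * h2 + aa m (i+1) * h3
       + (2 * (i:ℝ) + 4) * aa m (i+1) * h4
  unfold F
  rw [Finset.mul_sum, Finset.mul_sum, ← Finset.sum_add_distrib, ← Finset.sum_add_distrib,
    Finset.sum_congr rfl key,
    Finset.sum_range_sub (fun j : ℕ => 4 * (j : ℝ) * (j + 1) * aa m j * G (2 * j - 1) t) m]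
  simp [aa]


theorem coeff_even (j r : ℕ) (hr : r ≤ j) : ((coeff (hermite (2 * j)) (2 * r) : ℤ) : ℝ) =
    ((2 * j).factorial : ℝ) / ((2 * r).factorial * (j - r).factorial) * (-1 / 2) ^ (j - r) := by
  obtain ⟨n, rfl⟩ := Nat.exists_eq_add_of_le' hr
  have h := coeff_hermite_explicit n (2 * r)
  rw [show 2 * (n + r) = 2 * n + 2 * r by ring, h, show n + r - r = n by omega]
  have h1 : ((2 * n + 2 * r).choose (2 * r) : ℝ) * (2 * r).factorial * (2 * n).factorial
      = (2 * n + 2 * r).factorial := by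
    have := Nat.choose_mul_factorial_mul_factorial (n := 2 * n + 2 * r) (k := 2 * r) (by omega)
    rw [show 2 * n + 2 * r - 2 * r = 2 * n by omega] at this
    exact_mod_cast this
  have h2 : ((2 * n).factorial : ℝ) = (2 * n - 1).doubleFactorial * (2 ^ n * n.factorial) := by
    have : (2 * n).factorial = (2 * n - 1).doubleFactorial * (2 ^ n * n.factorial) := by
      rcases n with _ | n
      · simp
      · rw [← Nat.doubleFactorial_two_mul, show 2 * (n + 1) - 1 = 2 * n + 1 by omega,
          show 2 * (n + 1) = (2 * n + 1) + 1 by ring, Nat.factorial_eq_mul_doubleFactorial, mul_comm]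
    exact_mod_cast this
  push_cast
  rw [← h1, h2]
  have : (n.factorial : ℝ) ≠ 0 := by positivity
  have : ((2 * r).factorial : ℝ) ≠ 0 := by positivity
  rw [div_pow]
  field_simp

theorem sum_range_two_mul (g : ℕ → ℝ) (n : ℕ) :
    ∑ i ∈ Finset.range (2 * n), g i = ∑ i ∈ Finset.range n, (g (2 * i) + g (2 * i + 1)) := by
  induction n with
  | zero => simp
  | succ n ih =>
    rw [show 2 * (n + 1) = 2 * n + 1 + 1 by ring, Finset.sum_range_succ, Finset.sum_range_succ, ih,
      Finset.sum_range_succ]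
    ring

theorem hermite_even (j : ℕ) (t : ℝ) : aeval t (hermite (2 * j)) = ∑ r ∈ Finset.range (j + 1),
    ((2 * j).factorial : ℝ) / ((2 * r).factorial * (j - r).factorial) * (-1 / 2) ^ (j - r) * (t ^ 2) ^ r := by
  rw [aeval_eq_sum_range' (n := 2 * (j + 1)) (by rw [natDegree_hermite]; omega), sum_range_two_mul]
  refine Finset.sum_congr rfl fun r hr => ?_
  rw [coeff_hermite_of_odd_add (n := 2 * j) (k := 2 * r + 1) ⟨j + r, by ring⟩, zsmul_eq_mul,
    coeff_even j r (by have := Finset.mem_range.1 hr; omega), pow_mul]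
  simp

theorem fm_sum (m : ℕ) (q : ℝ) : ∑ r ∈ Finset.range m,
      (1 / (Nat.factorial (2 * r) : ℝ)) *
        (∑ s ∈ Finset.range (m - r + 1),
          (Nat.choose m (r + s + 1) : ℝ) *
            ((Nat.factorial (2 * r + 2 * s) : ℝ) /
              ((Nat.factorial (r + s) : ℝ) * (Nat.factorial s : ℝ))) *
            (-(1 : ℝ) / 2) ^ s) *
        q ^ r = ∑ j ∈ Finset.range m, aa m j * ∑ r ∈ Finset.range (j + 1),
    ((2 * j).factorial : ℝ) / ((2 * r).factorial * (j - r).factorial) * (-1 / 2) ^ (j - r) * q ^ r := by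
  let T : ℕ → ℕ → ℝ := fun r s => (1 / (Nat.factorial (2 * r) : ℝ)) * ((Nat.choose m (r + s + 1) : ℝ) *
            ((Nat.factorial (2 * r + 2 * s) : ℝ) /
              ((Nat.factorial (r + s) : ℝ) * (Nat.factorial s : ℝ))) *
            (-(1 : ℝ) / 2) ^ s) * q ^ r
  have h1 : ∀ r ∈ Finset.range m, (1 / (Nat.factorial (2 * r) : ℝ)) *
        (∑ s ∈ Finset.range (m - r + 1),
          (Nat.choose m (r + s + 1) : ℝ) *
            ((Nat.factorial (2 * r + 2 * s) : ℝ) /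
              ((Nat.factorial (r + s) : ℝ) * (Nat.factorial s : ℝ))) *
            (-(1 : ℝ) / 2) ^ s) *
        q ^ r = ∑ s ∈ Finset.range (m - r), T r s := by
    intro r hr
    have hr := Finset.mem_range.1 hr
    rw [Finset.sum_range_succ, show r + (m - r) + 1 = m + 1 by omega, Nat.choose_succ_self]
    simp only [T, Finset.mul_sum, Finset.sum_mul, Nat.cast_zero, zero_mul, add_zero]
  have h2 : ∀ j ∈ Finset.range m, aa m j * ∑ r ∈ Finset.range (j + 1),
    ((2 * j).factorial : ℝ) / ((2 * r).factorial * (j - r).factorial) * (-1 / 2) ^ (j - r) * q ^ r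
      = ∑ r ∈ Finset.range (j + 1), T r (j - r) := by
    intro j hj
    rw [Finset.mul_sum]
    refine Finset.sum_congr rfl fun r hr => ?_
    have hr := Finset.mem_range.1 hr
    simp only [T, aa]
    rw [show r + (j - r) = j by omega, show 2 * r + 2 * (j - r) = 2 * j by omega]
    have : (j.factorial : ℝ) ≠ 0 := by positivity
    have : ((2 * r).factorial : ℝ) ≠ 0 := by positivity
    have : ((j - r).factorial : ℝ) ≠ 0 := by positivity
    field_simp
  rw [Finset.sum_congr rfl h1, Finset.sum_congr rfl h2, Finset.sum_range_diag_flip]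

theorem F_zero_eq (m : ℕ) (t : ℝ) : F 0 m t = Real.exp (-(t ^ 2 / 2)) *
    ∑ j ∈ Finset.range m, aa m j * ∑ r ∈ Finset.range (j + 1),
    ((2 * j).factorial : ℝ) / ((2 * r).factorial * (j - r).factorial) * (-1 / 2) ^ (j - r) * (t ^ 2) ^ r := by
  unfold F
  rw [Finset.mul_sum]
  refine Finset.sum_congr rfl fun j _ => ?_
  rw [add_zero, G, hermite_even, pow_mul]
  norm_num
  ring

theorem fm_eq (m : ℕ) (x : ℝ) : fmFn m x = 1 / √(2 * Real.pi * m) * F 0 m (√m * x) := by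
  rw [F_zero_eq, mul_pow, Real.sq_sqrt m.cast_nonneg, ← fm_sum, fmFn]
  rw [neg_div]
  ring

theorem F_zero_zero (m : ℕ) : F 0 m 0 = c0 m := by
  rw [F_zero_eq]
  unfold c0
  simp only [ne_eq, OfNat.ofNat_ne_zero, not_false_eq_true, zero_pow, zero_div, neg_zero, Real.exp_zero, one_mul]
  refine Finset.sum_congr rfl fun j _ => ?_
  rw [Finset.sum_range_succ']
  have h : (j.centralBinom : ℝ) * ((j.factorial : ℝ) * j.factorial) = (2 * j).factorial := by
    have := Nat.choose_mul_factorial_mul_factorial (n := 2 * j) (k := j) (by omega)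
    rw [show 2 * j - j = j by omega] at this
    rw [Nat.centralBinom]
    rw [← mul_assoc]
    exact_mod_cast this
  rw [← h]
  have : (j.factorial : ℝ) ≠ 0 := by positivity
  simp [aa, bb]
  field_simp

theorem semi (m : ℕ) (hm : 1 ≤ m) : SemiODE (m : ℝ) (fun y => fmFn m y)
    (fun y => 1 / √(2 * Real.pi * m) * √m * F 1 m (√m * y))
    (fun y => 1 / √(2 * Real.pi * m) * m * F 2 m (√m * y)) := by
  have hm' : (1:ℝ) ≤ m := by exact_mod_cast hm
  have hs : 0 < √(m:ℝ) := Real.sqrt_pos.2 (by linarith)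
  have hsq : √(m:ℝ) ^ 2 = m := Real.sq_sqrt (by linarith)
  have hlin : ∀ y : ℝ, HasDerivAt (fun y => √(m:ℝ) * y) (√m) y := fun y => by
    simpa using (hasDerivAt_id y).const_mul √(m:ℝ)
  have hd : ∀ i y, HasDerivAt (fun y => F i m (√m * y)) (F (i + 1) m (√m * y) * √m) y := fun i y =>
    (F_deriv i m (√m * y)).comp y (hlin y)
  have htop : Tendsto (fun y => √(m:ℝ) * y) atTop atTop := tendsto_id.const_mul_atTop hs
  simp only [fm_eq]
  constructor
  · exact hm'
  · intro y
    refine ((hd 0 y).const_mul (1 / √(2 * Real.pi * m))).congr_deriv ?_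
    ring
  · intro y
    refine ((hd 1 y).const_mul (1 / √(2 * Real.pi * m) * √m)).congr_deriv ?_
    linear_combination (1 / √(2 * Real.pi * m)) * F 2 m (√m * y) * hsq
  · intro y
    refine ((hd 2 y).const_mul (1 / √(2 * Real.pi * m) * m)).congr_deriv ?_
    have := F_ode m (√m * y)
    set c := 1 / √(2 * Real.pi * m)
    rw [mul_pow, hsq] at this
    linear_combination (c * m * √m) * this - c * m * y * F 0 m (√m * y) * hsq
  · simpa using ((F_tendsto 0 m).comp htop).const_mul (1 / √(2 * Real.pi * m))
  · simpa using ((F_tendsto 1 m).comp htop).const_mul (1 / √(2 * Real.pi * m) * √m)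
  · have := ((tF_tendsto 0 m).comp htop).const_mul (1 / √(2 * Real.pi * m))
    simp only [mul_zero] at this
    refine this.congr fun y => ?_
    simp only [Function.comp, zero_add]
    ring
  · simpa using ((F_tendsto 2 m).comp htop).const_mul (1 / √(2 * Real.pi * m) * m)
  · rw [mul_zero, F_zero_zero]
    have := (c0_main m hm).1
    have := Real.pi_pos
    positivity

theorem f0_bound (m : ℕ) (hm : 1 ≤ m) : |fmFn m 0 * Real.pi - 1| ≤ 1 / m := by
  have hm' : (1:ℝ) ≤ m := by exact_mod_cast hm
  obtain ⟨h0, h1, h2⟩ := c0_main m hm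
  have hpi := Real.pi_pos
  have e : fmFn m 0 = 1 / √(2 * Real.pi * m) * c0 m := by rw [fm_eq, mul_zero, F_zero_zero]
  have hp : 0 < fmFn m 0 * Real.pi := by rw [e]; positivity
  have e2 : (fmFn m 0 * Real.pi) ^ 2 = c0 m ^ 2 * (Real.pi / (2 * m)) := by
    rw [e, mul_pow, mul_pow, div_pow, Real.sq_sqrt (by positivity)]
    field_simp
  have e3 : (fmFn m 0 * Real.pi) ^ 2 ≤ 1 + 1 / m := by
    rw [e2]
    calc c0 m ^ 2 * (Real.pi / (2 * m)) ≤ 2 * ((m : ℝ) + 1) / Real.pi * (Real.pi / (2 * m)) := by gcongr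
      _ = _ := by field_simp
  have e4 : 1 - 1 / m ≤ (fmFn m 0 * Real.pi) ^ 2 := by
    rw [e2]
    calc _ = 2 * ((m : ℝ) - 1) / Real.pi * (Real.pi / (2 * m)) := by field_simp
      _ ≤ c0 m ^ 2 * (Real.pi / (2 * m)) := by gcongr
  set p := fmFn m 0 * Real.pi
  have : 0 < 1 / (m:ℝ) := by positivity
  rw [abs_le]
  constructor
  · by_contra hc
    push Not at hc
    nlinarith
  · nlinarith

theorem main_bound (m : ℕ) (hm : 1 ≤ m) (x : ℝ) :
    |fmFn m x - fWig x| ≤ 41 * (m : ℝ) ^ (-(1 / 4) : ℝ) := by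
  have hm' : (1:ℝ) ≤ m := by exact_mod_cast hm
  wlog hx : 0 ≤ x generalizing x
  · have := this (-x) (by linarith)
    have e1 : fmFn m (-x) = fmFn m x := by simp [fmFn]
    have e2 : fWig (-x) = fWig x := by simp [fWig, neg_div]
    rwa [e1, e2] at this
  have hw : fWig x = 1 / Real.pi / 2 * √(4 - x ^ 2) := by
    unfold fWig
    rw [abs_of_nonneg hx]
    split_ifs with h
    · rw [show 4 - x ^ 2 = 2 ^ 2 * (1 - (x / 2) ^ 2) by ring, Real.sqrt_mul (by norm_num),
        Real.sqrt_sq (by norm_num)]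
      ring
    · rw [Real.sqrt_eq_zero_of_nonpos (by nlinarith)]; simp
  set δ := (m : ℝ) ^ (-(1 / 4) : ℝ) with hδ
  have hδ0 : 0 < δ := by positivity
  have hδ4 : m * δ ^ 4 = 1 := by
    rw [hδ, ← Real.rpow_natCast, ← Real.rpow_mul (by linarith)]
    norm_num
    rw [Real.rpow_neg_one]
    field_simp
  have h1 := (semi m hm).core hx hδ0 hδ4
  have h2 := f0_bound m hm
  have hpi := Real.pi_gt_three
  have hδm : 1 / (m:ℝ) ≤ δ := by
    have e : 1 / (m:ℝ) = δ ^ 4 := by field_simp; linarith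
    have : δ ≤ 1 := Real.rpow_le_one_of_one_le_of_nonpos hm' (by norm_num)
    rw [e]
    exact pow_le_of_le_one hδ0.le this (by norm_num)
  have hm1 : 1 / (m:ℝ) ≤ 1 := by rw [div_le_one (by linarith)]; exact hm'
  have hf0 := (semi m hm).pos
  have hs2 : √(4 - x ^ 2) ≤ 2 := Real.sqrt_le_iff.2 ⟨by norm_num, by nlinarith⟩
  have hs0 := Real.sqrt_nonneg (4 - x ^ 2)
  have h3 : |fmFn m 0 - 1 / Real.pi| ≤ δ := by
    have : fmFn m 0 - 1 / Real.pi = (fmFn m 0 * Real.pi - 1) / Real.pi := by field_simp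
    rw [this, abs_div, abs_of_pos Real.pi_pos, div_le_iff₀ Real.pi_pos]
    nlinarith
  have h4 : fmFn m 0 ≤ 2 := by
    have := (abs_le.1 h2).2
    nlinarith
  rw [hw]
  calc |fmFn m x - 1 / Real.pi / 2 * √(4 - x ^ 2)|
      = |(fmFn m x - fmFn m 0 / 2 * √(4 - x ^ 2)) + (fmFn m 0 - 1 / Real.pi) * (√(4 - x ^ 2) / 2)| := by
        congr 1; ring
    _ ≤ |fmFn m x - fmFn m 0 / 2 * √(4 - x ^ 2)| + |(fmFn m 0 - 1 / Real.pi) * (√(4 - x ^ 2) / 2)| :=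
        abs_add_le _ _
    _ ≤ 20 * 2 * δ + δ * 1 := by
        rw [abs_mul, abs_of_nonneg (by positivity : 0 ≤ √(4 - x ^ 2) / 2)]
        have : √(4 - x ^ 2) / 2 ≤ 1 := by linarith
        have : 20 * fmFn m 0 * δ ≤ 20 * 2 * δ := by gcongr
        gcongr
        linarith
    _ = 41 * δ := by ring

end SemiAux

/-- `|f_m - f_Wig| ≪_ε m^{-2/9+ε}` uniformly in `x`; in particular `f_m`
converges uniformly to `f_Wig` as `m → ∞`. -/
theorem fm_uniform_convergence_to_semicircle :
    (∀ ε : ℝ, 0 < ε → ∃ C : ℝ, 0 < C ∧ ∀ m : ℕ, 1 ≤ m → ∀ x : ℝ,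
      |fmFn m x - fWig x| ≤ C * (m : ℝ) ^ (-(2 / 9) + ε)) ∧
    TendstoUniformly (fun (m : ℕ) (x : ℝ) => fmFn m x) fWig atTop := by
  constructor
  · intro ε hε
    refine ⟨41, by norm_num, fun m hm x => (SemiAux.main_bound m hm x).trans ?_⟩
    have hm' : (1:ℝ) ≤ m := by exact_mod_cast hm
    gcongr
    linarith
  · rw [Metric.tendstoUniformly_iff]
    intro ε hε
    have ht : Tendsto (fun m : ℕ => 41 * (m : ℝ) ^ (-(1 / 4) : ℝ)) atTop (nhds 0) := by
      have := ((tendsto_rpow_neg_atTop (by norm_num : (0:ℝ) < 1 / 4)).comp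
        tendsto_natCast_atTop_atTop).const_mul 41
      simpa using this
    filter_upwards [ht.eventually (gt_mem_nhds hε), eventually_ge_atTop 1] with m h1 h2 x
    rw [dist_comm, Real.dist_eq]
    exact (SemiAux.main_bound m h2 x).trans_lt h1
end
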